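/- Let n ≥ 2 and θ ∈ (2·arccos(1/√3), π). Let c₁ ≥ 0, M > 0, and let u be a bounded smooth function on 𝒪_θ × (0,1) satisfying |∂ₜu + Δu| ≤ c₁(|∇u| + |u|) on 𝒪_θ × (0,1), u(x,0) = 0 for all x ∈ 𝒪_θ (in the sense of continuous extension), and |u| < M on 𝒪_θ × (0,1). Then there exists γ₁ > 0 depending only on c₁ such that u ≡ 0 on 𝒪_θ × (0, γ₁). -/

import Mathlib

open Real Set Filter

/-- The Laplacian of `f` at `x`, computed as the sum of the second partial
derivatives in the coordinate directions. -/
noncomputable def lap {n : ℕ} (f : EuclideanSpace ℝ (Fin n) → ℝ)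
    (x : EuclideanSpace ℝ (Fin n)) : ℝ :=
  ∑ i, fderiv ℝ (fun y => fderiv ℝ f y (EuclideanSpace.single i 1)) x
      (EuclideanSpace.single i 1)

/-- The open cone `𝒪_θ = {x : x₁ > |x| cos (θ/2)}` in `ℝⁿ`. -/
def cone (n : ℕ) [NeZero n] (θ : ℝ) : Set (EuclideanSpace ℝ (Fin n)) :=
  {x | ‖x‖ * Real.cos (θ / 2) < x 0}

section

open scoped ContDiff Topology
open MeasureTheory

section Directional

variable {V : Type*} [NormedAddCommGroup V] [NormedSpace ℝ V]

/-- The derivative of `g` in the direction `w`, as a function. -/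
noncomputable def dir (w : V) (g : V → ℝ) (p : V) : ℝ := fderiv ℝ g p w

@[fun_prop]
theorem ContDiff.dir {g : V → ℝ} (hg : ContDiff ℝ ∞ g) (w : V) : ContDiff ℝ ∞ (dir w g) := by
  have h : ContDiff ℝ ∞ (fderiv ℝ g) := hg.fderiv_right (by norm_cast)
  exact h.clm_apply contDiff_const

theorem ContDiffOn.dir {g : V → ℝ} {Ω : Set V} (hg : ContDiffOn ℝ ∞ g Ω) (hΩ : IsOpen Ω) (w : V) :
    ContDiffOn ℝ ∞ (dir w g) Ω := by
  have h : ContDiffOn ℝ ∞ (fderiv ℝ g) Ω := hg.fderiv_of_isOpen hΩ (by norm_cast)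
  exact h.clm_apply contDiffOn_const

theorem HasCompactSupport.dir {g : V → ℝ} (hg : HasCompactSupport g) (w : V) :
    HasCompactSupport (dir w g) := hg.fderiv_apply ℝ w

theorem tsupport_dir_subset (g : V → ℝ) (w : V) : tsupport (dir w g) ⊆ tsupport g :=
  tsupport_fderiv_apply_subset ℝ w

theorem dir_congr {f g : V → ℝ} {p : V} (h : f =ᶠ[𝓝 p] g) (w : V) :
    dir w f =ᶠ[𝓝 p] dir w g := by
  filter_upwards [h.fderiv (𝕜 := ℝ)] with x hx
  simp only [dir, hx]

theorem dir_add' {f g : V → ℝ} {p : V} (hf : DifferentiableAt ℝ f p) (hg : DifferentiableAt ℝ g p)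
    (w : V) : dir w (fun p => f p + g p) p = dir w f p + dir w g p := by
  simp [dir, fderiv_fun_add hf hg]

theorem dir_mul' {f g : V → ℝ} {p : V} (hf : DifferentiableAt ℝ f p) (hg : DifferentiableAt ℝ g p)
    (w : V) : dir w (fun p => f p * g p) p = dir w f p * g p + f p * dir w g p := by
  simp [dir, fderiv_fun_mul hf hg]; ring

theorem dir_const (w : V) (c : ℝ) (p : V) : dir w (fun _ => c) p = 0 := by simp [dir]

theorem dir_const_mul (w : V) (c : ℝ) (g : V → ℝ) : dir w (fun p => c * g p) = fun p => c * dir w g p := by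
  funext p
  simp only [dir]
  change fderiv ℝ (c • g) p w = _
  rw [fderiv_const_smul_field]; simp

theorem ContDiff.diffAt {g : V → ℝ} (hg : ContDiff ℝ ∞ g) (p : V) : DifferentiableAt ℝ g p :=
  hg.differentiable (by simp) p

theorem dir_add {f g : V → ℝ} (hf : ContDiff ℝ ∞ f) (hg : ContDiff ℝ ∞ g) (w : V) :
    dir w (fun p => f p + g p) = fun p => dir w f p + dir w g p :=
  funext fun p => dir_add' (hf.diffAt p) (hg.diffAt p) w

theorem dir_sub {f g : V → ℝ} (hf : ContDiff ℝ ∞ f) (hg : ContDiff ℝ ∞ g) (w : V) :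
    dir w (fun p => f p - g p) = fun p => dir w f p - dir w g p := by
  funext p; simp [dir, fderiv_fun_sub (hf.diffAt p) (hg.diffAt p)]

theorem dir_mul {f g : V → ℝ} (hf : ContDiff ℝ ∞ f) (hg : ContDiff ℝ ∞ g) (w : V) :
    dir w (fun p => f p * g p) = fun p => dir w f p * g p + f p * dir w g p :=
  funext fun p => dir_mul' (hf.diffAt p) (hg.diffAt p) w

theorem dir_sq {f : V → ℝ} (hf : ContDiff ℝ ∞ f) (w : V) :
    dir w (fun p => f p ^ 2) = fun p => 2 * f p * dir w f p := by
  have : (fun p => f p ^ 2) = fun p => f p * f p := by funext p; ring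
  rw [this, dir_mul hf hf]; funext p; ring

theorem dir_sum {ι : Type*} (s : Finset ι) {f : ι → V → ℝ} (hf : ∀ i, ContDiff ℝ ∞ (f i)) (w : V) :
    dir w (fun p => ∑ i ∈ s, f i p) = fun p => ∑ i ∈ s, dir w (f i) p := by
  funext p
  simp only [dir]
  rw [fderiv_fun_sum (fun i _ => (hf i).diffAt p)]
  simp

theorem dir_comp {g : ℝ → ℝ} {f : V → ℝ} {p : V} {g' : ℝ} (hg : HasDerivAt g g' (f p))
    (hf : DifferentiableAt ℝ f p) (w : V) : dir w (fun p => g (f p)) p = g' * dir w f p := by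
  have := (hg.comp_hasFDerivAt p hf.hasFDerivAt).fderiv
  simp only [dir]
  change fderiv ℝ (g ∘ f) p w = _
  rw [this]; simp

theorem dir_comm_at {g : V → ℝ} {p : V} (hg : ContDiffAt ℝ ∞ g p) (w w' : V) :
    dir w (dir w' g) p = dir w' (dir w g) p := by
  have hd : DifferentiableAt ℝ (fderiv ℝ g) p :=
    (hg.fderiv_right (m := ∞) (by norm_cast)).differentiableAt (by simp)
  have hs : IsSymmSndFDerivAt ℝ g p := hg.isSymmSndFDerivAt (by simpa using (WithTop.coe_le_coe.2 (le_top : (2 : ℕ∞) ≤ ⊤)))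
  have key : ∀ a b : V, dir a (dir b g) p = fderiv ℝ (fderiv ℝ g) p a b := by
    intro a b
    simp only [dir]
    have : fderiv ℝ (fun y => fderiv ℝ g y b) p = _ := fderiv_clm_apply hd (differentiableAt_const b)
    change fderiv ℝ (fun y => fderiv ℝ g y b) p a = _
    rw [this]; simp
  rw [key, key]; exact hs.eq _ _

theorem dir_comm {g : V → ℝ} (hg : ContDiff ℝ ∞ g) (w w' : V) :
    dir w (dir w' g) = dir w' (dir w g) :=
  funext fun _ => dir_comm_at hg.contDiffAt w w'

theorem integral_dir_eq_zero [FiniteDimensional ℝ V] [MeasurableSpace V] [BorelSpace V]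
    (μ : Measure V) [μ.IsAddHaarMeasure] {X : V → ℝ} (hX : ContDiff ℝ ∞ X)
    (hc : HasCompactSupport X) (w : V) : ∫ p, dir w X p ∂μ = 0 := by
  have h := integral_mul_fderiv_eq_neg_fderiv_mul_of_integrable (μ := μ) (f := fun _ : V => (1 : ℝ))
    (g := X) (v := w) (by simp)
    (by
      simp only [one_mul]
      exact (hX.dir w).continuous.integrable_of_hasCompactSupport (hc.dir w))
    (by simpa using (hX.continuous.integrable_of_hasCompactSupport hc))
    (fun x _ => differentiableAt_const _) (fun x _ => hX.diffAt x)
  simpa [dir] using h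

/-- A smooth function on an open set agrees, near a given closed subset, with a smooth function
on the whole space. -/
theorem exists_contDiff_eventuallyEq [FiniteDimensional ℝ V] {g : V → ℝ} {Ω K : Set V}
    (hΩ : IsOpen Ω) (hg : ContDiffOn ℝ ∞ g Ω) (hK : IsClosed K) (hKΩ : K ⊆ Ω) :
    ∃ G : V → ℝ, ContDiff ℝ ∞ G ∧ ∀ p ∈ K, G =ᶠ[𝓝 p] g := by
  obtain ⟨f, h0, h1, -⟩ := exists_contMDiffMap_zero_one_nhds_of_isClosed (modelWithCornersSelf ℝ V)
    (M := V) (n := (⊤ : ℕ∞)) hΩ.isClosed_compl hK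
    (Set.disjoint_left.2 fun x hx hx' => hx (hKΩ hx'))
  have hf : ContDiff ℝ ∞ f := f.contMDiff.contDiff
  refine ⟨fun p => f p * g p, contDiff_iff_contDiffAt.2 fun p => ?_, fun p hp => ?_⟩
  · by_cases hp : p ∈ Ω
    · exact hf.contDiffAt.mul (hg.contDiffAt (hΩ.mem_nhds hp))
    · have : (fun p => f p * g p) =ᶠ[𝓝 p] fun _ => 0 := by
        filter_upwards [h0.filter_mono (nhds_le_nhdsSet (x := p) hp)] with x hx
        simp [hx]
      exact contDiffAt_const.congr_of_eventuallyEq this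
  · filter_upwards [h1.filter_mono (nhds_le_nhdsSet hp)] with x hx
    simp [hx]

theorem contDiff_mul_of_tsupport {f g : V → ℝ} {Ω : Set V} (hΩ : IsOpen Ω) (hf : ContDiff ℝ ∞ f)
    (hg : ContDiffOn ℝ ∞ g Ω) (hs : tsupport f ⊆ Ω) : ContDiff ℝ ∞ (fun p => f p * g p) := by
  refine contDiff_iff_contDiffAt.2 fun p => ?_
  by_cases hp : p ∈ Ω
  · exact hf.contDiffAt.mul (hg.contDiffAt (hΩ.mem_nhds hp))
  · have : (fun p => f p * g p) =ᶠ[𝓝 p] fun _ => 0 := by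
      filter_upwards [notMem_tsupport_iff_eventuallyEq.1 fun h => hp (hs h)] with x hx
      simp [hx]
    exact contDiffAt_const.congr_of_eventuallyEq this

end Directional

section Identity

variable {V : Type*} [NormedAddCommGroup V] [NormedSpace ℝ V] {ι : Type*} [Fintype ι]

/-- The inner product of the gradients of `f` and `g` along the frame `e`. -/
noncomputable def gdot (e : ι → V) (f g : V → ℝ) (p : V) : ℝ :=
  ∑ i, dir (e i) f p * dir (e i) g p

/-- The Laplacian along the frame `e`. -/
noncomputable def lapl (e : ι → V) (g : V → ℝ) (p : V) : ℝ := ∑ i, dir (e i) (dir (e i) g) p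

/-- The Hessian quadratic form along the frame `e`. -/
noncomputable def hess (e : ι → V) (g : V → ℝ) (p : V) (ξ : ι → ℝ) : ℝ :=
  ∑ i, ∑ j, dir (e i) (dir (e j) g) p * ξ i * ξ j

@[fun_prop]
theorem ContDiff.gdot {e : ι → V} {f g : V → ℝ} (hf : ContDiff ℝ ∞ f) (hg : ContDiff ℝ ∞ g) :
    ContDiff ℝ ∞ (gdot e f g) := by
  unfold _root_.gdot; fun_prop

@[fun_prop]
theorem ContDiff.lapl {e : ι → V} {g : V → ℝ} (hg : ContDiff ℝ ∞ g) :
    ContDiff ℝ ∞ (lapl e g) := by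
  unfold _root_.lapl; fun_prop

theorem dir_gdot {e : ι → V} {f g : V → ℝ} (hf : ContDiff ℝ ∞ f) (hg : ContDiff ℝ ∞ g) (w : V)
    (p : V) : dir w (gdot e f g) p =
      ∑ i, (dir w (dir (e i) f) p * dir (e i) g p + dir (e i) f p * dir w (dir (e i) g) p) := by
  unfold gdot
  rw [dir_sum _ (fun i => by fun_prop)]
  refine Finset.sum_congr rfl fun i _ => ?_
  rw [dir_mul (by fun_prop) (by fun_prop)]

variable (e : ι → V) (τ : V)

/-- Spatial components of the vector field behind the Carleman identity. -/
noncomputable def fluxX (ζ v φ q P : V → ℝ) (i : ι) (p : V) : ℝ :=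
  ζ p * (2 * (dir (e i) v p * dir τ v p) - 4 * (dir (e i) v p * gdot e φ v p)
    + 2 * (dir (e i) φ p * gdot e v v p) + 2 * (dir (e i) v p * (q p * v p))
    - v p * v p * dir (e i) q p - 2 * (P p * (dir (e i) φ p * (v p * v p))))

/-- Time component of the vector field behind the Carleman identity. -/
noncomputable def fluxT (ζ v P : V → ℝ) (p : V) : ℝ :=
  ζ p * (P p * (v p * v p) - gdot e v v p)

variable {e τ} {ζ v φ q P : V → ℝ}

theorem sum_dir_fluxX (hζ : ContDiff ℝ ∞ ζ) (hv : ContDiff ℝ ∞ v) (hφ : ContDiff ℝ ∞ φ)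
    (hq : ContDiff ℝ ∞ q) (hP : ContDiff ℝ ∞ P) (hζe : ∀ i p, dir (e i) ζ p = 0) (p : V) :
    ∑ i, dir (e i) (fluxX e τ ζ v φ q P i) p =
      ζ p * (2 * (lapl e v p * dir τ v p) + 2 * gdot e v (dir τ v) p
        - 4 * (lapl e v p * gdot e φ v p) - 4 * hess e φ p (fun i => dir (e i) v p)
        + 2 * (lapl e φ p * gdot e v v p) + 2 * (lapl e v p * q p * v p)
        + 2 * q p * gdot e v v p - v p ^ 2 * lapl e q p - 2 * v p ^ 2 * gdot e P φ p
        - 2 * P p * v p ^ 2 * lapl e φ p - 4 * P p * v p * gdot e φ v p) := by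
  have h1 : ∀ i, dir (e i) (fluxX e τ ζ v φ q P i) p =
      ζ p * (2 * (dir (e i) (dir (e i) v) p * dir τ v p + dir (e i) v p * dir (e i) (dir τ v) p)
       - 4 * (dir (e i) (dir (e i) v) p * gdot e φ v p + dir (e i) v p * dir (e i) (gdot e φ v) p)
       + 2 * (dir (e i) (dir (e i) φ) p * gdot e v v p + dir (e i) φ p * dir (e i) (gdot e v v) p)
       + 2 * (dir (e i) (dir (e i) v) p * (q p * v p)
          + dir (e i) v p * (dir (e i) q p * v p + q p * dir (e i) v p))
       - ((dir (e i) v p * v p + v p * dir (e i) v p) * dir (e i) q p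
          + v p * v p * dir (e i) (dir (e i) q) p)
       - 2 * (dir (e i) P p * (dir (e i) φ p * (v p * v p))
          + P p * (dir (e i) (dir (e i) φ) p * (v p * v p)
            + dir (e i) φ p * (dir (e i) v p * v p + v p * dir (e i) v p)))) := by
    intro i
    unfold fluxX
    rw [dir_mul hζ (by fun_prop), dir_sub (by fun_prop) (by fun_prop),
      dir_sub (by fun_prop) (by fun_prop), dir_add (by fun_prop) (by fun_prop),
      dir_add (by fun_prop) (by fun_prop), dir_sub (by fun_prop) (by fun_prop)]
    simp only [dir_const_mul]
    rw [dir_mul (by fun_prop) (by fun_prop), dir_mul (by fun_prop) (by fun_prop),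
      dir_mul (by fun_prop) (by fun_prop), dir_mul (by fun_prop) (by fun_prop),
      dir_mul (f := q) (by fun_prop) (by fun_prop), dir_mul (f := fun p => v p * v p) (by fun_prop) (by fun_prop),
      dir_mul (f := P) (by fun_prop) (by fun_prop),
      dir_mul (f := dir (e i) φ) (g := fun p => v p * v p) (by fun_prop) (by fun_prop),
      dir_mul (f := v) (g := v) hv hv]
    simp only [hζe]
    ring
  have h2 : ∑ i, dir (e i) φ p * dir (e i) (gdot e v v) p
      = 2 * ∑ i, ∑ j, dir (e i) φ p * (dir (e i) (dir (e j) v) p * dir (e j) v p) := by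
    rw [Finset.mul_sum]
    refine Finset.sum_congr rfl fun i _ => ?_
    rw [dir_gdot hv hv, Finset.mul_sum, Finset.mul_sum]
    refine Finset.sum_congr rfl fun j _ => ?_
    ring
  have h3 : ∑ i, dir (e i) v p * dir (e i) (gdot e φ v) p
      = hess e φ p (fun i => dir (e i) v p)
        + ∑ i, ∑ j, dir (e i) φ p * (dir (e i) (dir (e j) v) p * dir (e j) v p) := by
    have : ∑ i, ∑ j, dir (e i) φ p * (dir (e i) (dir (e j) v) p * dir (e j) v p)
        = ∑ i, ∑ j, dir (e j) φ p * (dir (e i) (dir (e j) v) p * dir (e i) v p) := by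
      rw [Finset.sum_comm]
      refine Finset.sum_congr rfl fun i _ => Finset.sum_congr rfl fun j _ => ?_
      rw [dir_comm hv]
    rw [this, hess, ← Finset.sum_add_distrib]
    refine Finset.sum_congr rfl fun i _ => ?_
    rw [dir_gdot hφ hv, Finset.mul_sum, ← Finset.sum_add_distrib]
    refine Finset.sum_congr rfl fun j _ => ?_
    ring
  obtain ⟨G₁, hG₁⟩ : ∃ x, gdot e φ v p = x := ⟨_, rfl⟩
  obtain ⟨G₂, hG₂⟩ : ∃ x, gdot e v v p = x := ⟨_, rfl⟩
  calc ∑ i, dir (e i) (fluxX e τ ζ v φ q P i) p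
      = ζ p * (2 * (lapl e v p * dir τ v p) + 2 * gdot e v (dir τ v) p
        - 4 * (lapl e v p * G₁) - 4 * ∑ i, dir (e i) v p * dir (e i) (gdot e φ v) p
        + 2 * (lapl e φ p * G₂) + 2 * ∑ i, dir (e i) φ p * dir (e i) (gdot e v v) p
        + 2 * (lapl e v p * q p * v p)
        + 2 * q p * gdot e v v p - v p ^ 2 * lapl e q p - 2 * v p ^ 2 * gdot e P φ p
        - 2 * P p * v p ^ 2 * lapl e φ p - 4 * P p * v p * gdot e φ v p) := by
        conv_lhs => simp only [h1, hG₁, hG₂]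
        simp only [lapl, gdot, Finset.mul_sum, Finset.sum_mul, ← Finset.sum_add_distrib,
          ← Finset.sum_sub_distrib]
        refine Finset.sum_congr rfl fun i _ => ?_
        ring
    _ = _ := by rw [h2, h3, hG₁, hG₂]; ring

theorem dir_fluxT (hζ : ContDiff ℝ ∞ ζ) (hv : ContDiff ℝ ∞ v) (hP : ContDiff ℝ ∞ P)
    (p : V) : dir τ (fluxT e ζ v P) p =
      ζ p * (dir τ P p * v p ^ 2 + 2 * P p * v p * dir τ v p - 2 * gdot e v (dir τ v) p)
        + dir τ ζ p * (P p * v p ^ 2 - gdot e v v p) := by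
  have h : dir τ (gdot e v v) p = 2 * gdot e v (dir τ v) p := by
    rw [dir_gdot hv hv, gdot, Finset.mul_sum]
    refine Finset.sum_congr rfl fun j _ => ?_
    rw [dir_comm hv τ (e j)]; ring
  unfold fluxT
  rw [dir_mul hζ (by fun_prop), dir_sub (by fun_prop) (by fun_prop),
    dir_mul hP (by fun_prop), dir_mul hv hv]
  simp only [h]
  ring

/-- The coefficient of `v²` in the Carleman identity. -/
noncomputable def zeroCoeff (e : ι → V) (τ : V) (φ q P : V → ℝ) (p : V) : ℝ :=
  lapl e q p - dir τ P p + 2 * gdot e P φ p + 2 * P p * (q p + lapl e φ p)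

theorem integral_carleman_identity [FiniteDimensional ℝ V] [MeasurableSpace V] [BorelSpace V]
    (μ : Measure V) [μ.IsAddHaarMeasure]
    (hζ : ContDiff ℝ ∞ ζ) (hv : ContDiff ℝ ∞ v) (hvc : HasCompactSupport v) (hφ : ContDiff ℝ ∞ φ)
    (hq : ContDiff ℝ ∞ q) (hP : ContDiff ℝ ∞ P) (hζe : ∀ i p, dir (e i) ζ p = 0) :
    ∫ p, (ζ p * (2 * (lapl e v p + P p * v p) * (dir τ v p - 2 * gdot e φ v p + q p * v p)
      - (4 * hess e φ p (fun i => dir (e i) v p) - 2 * (q p + lapl e φ p) * gdot e v v p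
        + zeroCoeff e τ φ q P p * v p ^ 2))
      - dir τ ζ p * (gdot e v v p - P p * v p ^ 2)) ∂μ = 0 := by
  have hX : ∀ i, ContDiff ℝ ∞ (fluxX e τ ζ v φ q P i) := fun i => by unfold fluxX; fun_prop
  have hT : ContDiff ℝ ∞ (fluxT e ζ v P) := by unfold fluxT; fun_prop
  have hgd : ∀ p, p ∉ tsupport v → ∀ f, gdot e f v p = 0 := fun p hp f => by
    refine Finset.sum_eq_zero fun i _ => ?_
    rw [image_eq_zero_of_notMem_tsupport fun h => hp (tsupport_dir_subset v (e i) h), mul_zero]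
  have hXc : ∀ i, HasCompactSupport (fluxX e τ ζ v φ q P i) := fun i => by
    refine HasCompactSupport.intro hvc fun p hp => ?_
    have h0 : v p = 0 := image_eq_zero_of_notMem_tsupport hp
    have h1 : dir (e i) v p = 0 :=
      image_eq_zero_of_notMem_tsupport fun h => hp (tsupport_dir_subset v _ h)
    simp [fluxX, h0, h1, hgd p hp]
  have hTc : HasCompactSupport (fluxT e ζ v P) := by
    refine HasCompactSupport.intro hvc fun p hp => ?_
    have h0 : v p = 0 := image_eq_zero_of_notMem_tsupport hp
    simp [fluxT, h0, hgd p hp]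
  have hint : ∫ p, (∑ i, dir (e i) (fluxX e τ ζ v φ q P i) p + dir τ (fluxT e ζ v P) p) ∂μ = 0 := by
    rw [integral_add, integral_finsetSum, integral_dir_eq_zero μ hT hTc]
    · simp [integral_dir_eq_zero μ (hX _) (hXc _)]
    · exact fun i _ => ((hX i).dir _).continuous.integrable_of_hasCompactSupport ((hXc i).dir _)
    · exact integrable_finsetSum _ fun i _ =>
        ((hX i).dir _).continuous.integrable_of_hasCompactSupport ((hXc i).dir _)
    · exact (hT.dir _).continuous.integrable_of_hasCompactSupport (hTc.dir _)
  rw [← hint]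
  refine integral_congr_ae (Eventually.of_forall fun p => ?_)
  simp only
  rw [sum_dir_fluxX hζ hv hφ hq hP hζe, dir_fluxT hζ hv hP, zeroCoeff]
  ring

end Identity

section Carleman

variable {V : Type*} [NormedAddCommGroup V] [NormedSpace ℝ V] {ι : Type*} [Fintype ι]
  {e : ι → V} {τ : V} {ζ U φ q : V → ℝ}

/-- The coefficient of `v²` in the Carleman identity for `P = |∇φ|² - ∂ₜφ`, expanded. -/
noncomputable def zeroTerm (e : ι → V) (τ : V) (φ q : V → ℝ) (p : V) : ℝ :=
  4 * hess e φ p (fun i => dir (e i) φ p) - 4 * gdot e φ (dir τ φ) p + dir τ (dir τ φ) p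
    + lapl e q p + 2 * (q p + lapl e φ p) * (gdot e φ φ p - dir τ φ p)

theorem zeroCoeff_eq_zeroTerm (hφ : ContDiff ℝ ∞ φ) (q : V → ℝ) (p : V) :
    zeroCoeff e τ φ q (fun p => gdot e φ φ p - dir τ φ p) p = zeroTerm e τ φ q p := by
  have h1 : ∀ w, dir w (fun p => gdot e φ φ p - dir τ φ p) p
      = 2 * gdot e (dir w φ) φ p - dir w (dir τ φ) p := by
    intro w
    rw [dir_sub (by fun_prop) (by fun_prop)]
    simp only
    rw [dir_gdot hφ hφ, gdot, Finset.mul_sum]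
    congr 1
    refine Finset.sum_congr rfl fun i _ => ?_
    rw [dir_comm hφ w]; ring
  have h2 : gdot e (fun p => gdot e φ φ p - dir τ φ p) φ p
      = 2 * hess e φ p (fun i => dir (e i) φ p) - gdot e φ (dir τ φ) p := by
    rw [gdot, gdot, hess, Finset.mul_sum, ← Finset.sum_sub_distrib]
    refine Finset.sum_congr rfl fun i _ => ?_
    rw [h1, gdot]
    have : ∑ j, dir (e i) (dir (e j) φ) p * dir (e i) φ p * dir (e j) φ p
        = (∑ j, dir (e j) (dir (e i) φ) p * dir (e j) φ p) * dir (e i) φ p := by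
      rw [Finset.sum_mul]
      refine Finset.sum_congr rfl fun j _ => ?_
      rw [dir_comm hφ (e j)]; ring
    rw [this]; ring
  have h3 : gdot e (dir τ φ) φ p = gdot e φ (dir τ φ) p :=
    Finset.sum_congr rfl fun i _ => mul_comm _ _
  simp only [zeroCoeff, zeroTerm, h2]
  rw [h1, h3]; ring

theorem dir_exp (hφ : ContDiff ℝ ∞ φ) (w : V) :
    dir w (fun p => Real.exp (φ p)) = fun p => Real.exp (φ p) * dir w φ p :=
  funext fun p => dir_comp (Real.hasDerivAt_exp _) (hφ.diffAt p) w

theorem hess_congr {f g : V → ℝ} {p : V} (h : f =ᶠ[𝓝 p] g) : hess e f p = hess e g p := by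
  funext ξ
  simp only [hess, fun i j => (dir_congr (dir_congr h (e j)) (e i)).self_of_nhds]

theorem lapl_congr {f g : V → ℝ} {p : V} (h : f =ᶠ[𝓝 p] g) : lapl e f p = lapl e g p := by
  simp only [lapl, fun i j => (dir_congr (dir_congr h (e j)) (e i)).self_of_nhds]

theorem gdot_congr {f g f' g' : V → ℝ} {p : V} (h : f =ᶠ[𝓝 p] g) (h' : f' =ᶠ[𝓝 p] g') :
    gdot e f f' p = gdot e g g' p := by
  simp only [gdot, fun i => (dir_congr h (e i)).self_of_nhds,
    fun i => (dir_congr h' (e i)).self_of_nhds]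

theorem zeroTerm_congr {φ' q' : V → ℝ} {p : V} (h : φ =ᶠ[𝓝 p] φ') (h' : q =ᶠ[𝓝 p] q') :
    zeroTerm e τ φ q p = zeroTerm e τ φ' q' p := by
  simp only [zeroTerm, hess_congr h, fun i => (dir_congr h (e i)).self_of_nhds, lapl_congr h,
    lapl_congr h', gdot_congr h h, gdot_congr h (dir_congr h τ), (dir_congr h τ).self_of_nhds,
    (dir_congr (dir_congr h τ) τ).self_of_nhds, h'.self_of_nhds]

variable [FiniteDimensional ℝ V] [MeasurableSpace V] [BorelSpace V]
  (μ : Measure V) [μ.IsAddHaarMeasure]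

theorem carleman_global (hζ : ContDiff ℝ ∞ ζ) (hζe : ∀ i p, dir (e i) ζ p = 0)
    (hζ0 : ∀ p, 0 ≤ ζ p) (hζτ : ∀ p, 0 ≤ dir τ ζ p)
    (hU : ContDiff ℝ ∞ U) (hUc : HasCompactSupport U) (hφ : ContDiff ℝ ∞ φ) (hq : ContDiff ℝ ∞ q)
    {κ κ₀ : ℝ} (hκ : 0 ≤ κ)
    (h1 : ∀ p ∈ tsupport U, 0 < ζ p → ∀ ξ : ι → ℝ,
      κ * ∑ i, ξ i ^ 2 ≤ 4 * hess e φ p ξ - 2 * (q p + lapl e φ p) * ∑ i, ξ i ^ 2)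
    (h2 : ∀ p ∈ tsupport U, 0 < ζ p →
      κ₀ + (q p + lapl e φ p) ^ 2 + κ * gdot e φ φ p ≤ zeroTerm e τ φ q p) :
    ∫ p, (ζ p * (Real.exp (2 * φ p) * (κ / 2 * gdot e U U p + κ₀ * U p ^ 2
        - (dir τ U p + lapl e U p) ^ 2))
      - dir τ ζ p * (Real.exp (2 * φ p) * ((gdot e φ φ p - dir τ φ p) * U p ^ 2))) ∂μ ≤ 0 := by
  have hE : ContDiff ℝ ∞ fun p => Real.exp (φ p) := Real.contDiff_exp.comp hφ
  obtain ⟨v, hv⟩ : ∃ v, v = fun p => Real.exp (φ p) * U p := ⟨_, rfl⟩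
  obtain ⟨P, hPd⟩ : ∃ P, P = fun p => gdot e φ φ p - dir τ φ p := ⟨_, rfl⟩
  have hvp : ∀ p, v p = Real.exp (φ p) * U p := fun p => by rw [hv]
  have hvs : ContDiff ℝ ∞ v := by rw [hv]; exact hE.mul hU
  have hP : ContDiff ℝ ∞ P := by rw [hPd]; fun_prop
  have hsupp : ∀ p, p ∉ tsupport U → v =ᶠ[𝓝 p] fun _ => 0 := fun p hp => by
    filter_upwards [notMem_tsupport_iff_eventuallyEq.1 hp] with x hx
    simp [hv, hx]
  have hvc : HasCompactSupport v := HasCompactSupport.intro hUc fun p hp => (hsupp p hp).self_of_nhds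
  have hvdir : ∀ w, dir w v = fun p => Real.exp (φ p) * (dir w φ p * U p + dir w U p) := by
    intro w
    rw [hv, dir_mul hE hU, dir_exp hφ]; funext p; ring
  have hvdir2 : ∀ w p, dir w (dir w v) p = Real.exp (φ p) *
      (dir w φ p * (dir w φ p * U p + dir w U p) + dir w (dir w φ) p * U p + dir w φ p * dir w U p
        + dir w (dir w U) p) := by
    intro w p
    rw [hvdir, dir_mul hE (by fun_prop), dir_exp hφ, dir_add (by fun_prop) (by fun_prop),
      dir_mul (by fun_prop) hU]
    ring
  have hlapl : ∀ p, lapl e v p = Real.exp (φ p) * (gdot e φ φ p * U p + 2 * gdot e φ U p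
      + lapl e φ p * U p + lapl e U p) := by
    intro p
    simp only [lapl, gdot, hvdir2, Finset.mul_sum, Finset.sum_mul, ← Finset.sum_add_distrib]
    refine Finset.sum_congr rfl fun i _ => ?_
    ring
  have hgφ : ∀ p, gdot e φ v p = Real.exp (φ p) * (gdot e φ φ p * U p + gdot e φ U p) := by
    intro p
    simp only [gdot, hvdir, Finset.mul_sum, Finset.sum_mul, ← Finset.sum_add_distrib]
    refine Finset.sum_congr rfl fun i _ => ?_
    ring
  have hgv : ∀ p, Real.exp (2 * φ p) * gdot e U U p / 2
      ≤ gdot e v v p + gdot e φ φ p * v p ^ 2 := by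
    intro p
    simp only [gdot, hvdir, hvp, Finset.mul_sum, Finset.sum_mul, Finset.sum_div,
      ← Finset.sum_add_distrib]
    refine Finset.sum_le_sum fun i _ => ?_
    rw [show 2 * φ p = φ p + φ p by ring, Real.exp_add]
    nlinarith [sq_nonneg (Real.exp (φ p) * (2 * (dir (e i) φ p * U p) + dir (e i) U p))]
  have hid := integral_carleman_identity (e := e) (τ := τ) μ hζ hvs hvc hφ hq hP hζe
  rw [← neg_zero, ← hid, ← integral_neg]
  have hU0 : ∀ p, p ∉ tsupport U → U p = 0 ∧ (∀ w, dir w U p = 0) ∧ (∀ w w', dir w (dir w' U) p = 0) :=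
    fun p hp => ⟨image_eq_zero_of_notMem_tsupport hp, fun w =>
      image_eq_zero_of_notMem_tsupport fun h => hp (tsupport_dir_subset U w h), fun w w' =>
      image_eq_zero_of_notMem_tsupport fun h => hp (tsupport_dir_subset U w'
        (tsupport_dir_subset _ w h))⟩
  have hdv0 : ∀ p, p ∉ tsupport U → v p = 0 ∧ ∀ w, dir w v p = 0 := fun p hp => by
    obtain ⟨h, h', -⟩ := hU0 p hp
    simp [hvp, hvdir, h, h']
  have hzt := fun p => zeroCoeff_eq_zeroTerm (e := e) (τ := τ) hφ q p
  rw [← hPd] at hzt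
  simp only [hzt]
  have hcont : ∀ {G : V → ℝ}, Continuous G → (∀ p, p ∉ tsupport U → G p = 0) → Integrable G μ :=
    fun hG h0 => hG.integrable_of_hasCompactSupport (HasCompactSupport.intro hUc h0)
  have hzc : Continuous (zeroTerm e τ φ q) := by
    have : ContDiff ℝ ∞ (zeroCoeff e τ φ q P) := by unfold zeroCoeff; fun_prop
    rw [← funext hzt]; exact this.continuous
  have hhc : Continuous fun p => hess e φ p (fun i => dir (e i) v p) := by
    have : ContDiff ℝ ∞ fun p => hess e φ p (fun i => dir (e i) v p) := by unfold hess; fun_prop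
    exact this.continuous
  refine integral_mono (hcont ?_ ?_) (hcont ?_ ?_) fun p => ?_
  · have : ContDiff ℝ ∞ fun p => Real.exp (2 * φ p) := Real.contDiff_exp.comp (by fun_prop)
    exact ContDiff.continuous (𝕜 := ℝ) (n := ∞) (by fun_prop)
  · intro p hp
    obtain ⟨h, h', h''⟩ := hU0 p hp
    simp [h, h', h'', gdot, lapl]
  · have hsm : ContDiff ℝ ∞ fun p => (lapl e v p + P p * v p) *
      (dir τ v p - 2 * gdot e φ v p + q p * v p) := by fun_prop
    have c1 := hsm.continuous
    have c2 : Continuous fun p => (q p + lapl e φ p) * gdot e v v p :=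
      ContDiff.continuous (𝕜 := ℝ) (n := ∞) (by fun_prop)
    have c3 : Continuous fun p => dir τ ζ p * (gdot e v v p - P p * v p ^ 2) :=
      ContDiff.continuous (𝕜 := ℝ) (n := ∞) (by fun_prop)
    have c4 := hζ.continuous
    have c5 := hvs.continuous
    have : Continuous fun p => -(ζ p * (2 * ((lapl e v p + P p * v p) *
      (dir τ v p - 2 * gdot e φ v p + q p * v p)) -
        (4 * hess e φ p (fun i => dir (e i) v p) - 2 * ((q p + lapl e φ p) * gdot e v v p)
        + zeroTerm e τ φ q p * v p ^ 2))
      - dir τ ζ p * (gdot e v v p - P p * v p ^ 2)) := by fun_prop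
    convert this using 2
    ring
  · intro p hp
    obtain ⟨h, h'⟩ := hdv0 p hp
    simp [h, h', gdot, hess]
  · have hg0 : 0 ≤ gdot e v v p := Finset.sum_nonneg fun i _ => mul_self_nonneg _
    have hexp : Real.exp (2 * φ p) = Real.exp (φ p) ^ 2 := by
      rw [← Real.exp_nat_mul]; norm_num
    have hPp : gdot e φ φ p - dir τ φ p = P p := by rw [hPd]
    simp only [hPp]
    have hbot : - (dir τ ζ p * (Real.exp (2 * φ p) * (P p * U p ^ 2))) ≤
        dir τ ζ p * (gdot e v v p - P p * v p ^ 2) := by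
      rw [hexp, hvp]
      nlinarith [mul_nonneg (hζτ p) hg0]
    rcases (hζ0 p).eq_or_lt with hz | hz
    · rw [← hz]; linarith
    by_cases hp : p ∈ tsupport U
    · have k1 := h1 p hp hz (fun i => dir (e i) v p)
      have k2 := h2 p hp hz
      have hgg : ∑ i, dir (e i) v p ^ 2 = gdot e v v p :=
        Finset.sum_congr rfl fun i _ => sq _
      rw [hgg] at k1
      have hSB : 2 * (lapl e v p + P p * v p) * (dir τ v p - 2 * gdot e φ v p + q p * v p)
          ≤ Real.exp (φ p) ^ 2 * (dir τ U p + lapl e U p) ^ 2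
            + (q p + lapl e φ p) ^ 2 * v p ^ 2 := by
        have key : lapl e v p + P p * v p + (dir τ v p - 2 * gdot e φ v p + q p * v p)
            = Real.exp (φ p) * (dir τ U p + lapl e U p) + (q p + lapl e φ p) * v p := by
          rw [hlapl, hgφ, hvdir, ← hPp, hvp]; ring
        obtain ⟨S, hS⟩ : ∃ S, S = lapl e v p + P p * v p := ⟨_, rfl⟩
        obtain ⟨B, hB⟩ : ∃ B, B = dir τ v p - 2 * gdot e φ v p + q p * v p := ⟨_, rfl⟩
        obtain ⟨a, ha⟩ : ∃ a, a = Real.exp (φ p) * (dir τ U p + lapl e U p) := ⟨_, rfl⟩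
        obtain ⟨b, hb⟩ : ∃ b, b = (q p + lapl e φ p) * v p := ⟨_, rfl⟩
        rw [← hS, ← hB, ← ha, ← hb] at key
        rw [← hS, ← hB, ← mul_pow, ← mul_pow, ← ha, ← hb]
        nlinarith [sq_nonneg (S - B), sq_nonneg (a - b), congrArg (· ^ 2) key]
      have hgv' := mul_le_mul_of_nonneg_left (hgv p) hκ
      have k2' := mul_le_mul_of_nonneg_right k2 (sq_nonneg (v p))
      have hmain : Real.exp (2 * φ p) * (κ / 2 * gdot e U U p + κ₀ * U p ^ 2
          - (dir τ U p + lapl e U p) ^ 2) ≤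
          - (2 * (lapl e v p + P p * v p) * (dir τ v p - 2 * gdot e φ v p + q p * v p)
          - (4 * hess e φ p (fun i => dir (e i) v p) - 2 * (q p + lapl e φ p) * gdot e v v p
            + zeroTerm e τ φ q p * v p ^ 2)) := by
        have : κ₀ * v p ^ 2 = Real.exp (2 * φ p) * (κ₀ * U p ^ 2) := by rw [hexp, hvp]; ring
        rw [← hexp] at hSB
        nlinarith
      have := mul_le_mul_of_nonneg_left hmain hz.le
      linarith
    · obtain ⟨h, h', h''⟩ := hU0 p hp
      obtain ⟨k, k'⟩ := hdv0 p hp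
      simp [h, h', h'', k, k', gdot, lapl, hess]

/-- A Carleman inequality for the backward heat operator `∂_τ + Δ`. -/
theorem carleman {Ω : Set V} (hΩ : IsOpen Ω) (hζ : ContDiff ℝ ∞ ζ)
    (hζe : ∀ i p, dir (e i) ζ p = 0) (hζ0 : ∀ p, 0 ≤ ζ p) (hζτ : ∀ p, 0 ≤ dir τ ζ p)
    (hU : ContDiff ℝ ∞ U) (hUc : HasCompactSupport U) (hUΩ : tsupport U ⊆ Ω)
    (hφ : ContDiffOn ℝ ∞ φ Ω) (hq : ContDiffOn ℝ ∞ q Ω) {κ κ₀ : ℝ} (hκ : 0 ≤ κ)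
    (h1 : ∀ p ∈ tsupport U, 0 < ζ p → ∀ ξ : ι → ℝ,
      κ * ∑ i, ξ i ^ 2 ≤ 4 * hess e φ p ξ - 2 * (q p + lapl e φ p) * ∑ i, ξ i ^ 2)
    (h2 : ∀ p ∈ tsupport U, 0 < ζ p →
      κ₀ + (q p + lapl e φ p) ^ 2 + κ * gdot e φ φ p ≤ zeroTerm e τ φ q p) :
    ∫ p, (ζ p * (Real.exp (2 * φ p) * (κ / 2 * gdot e U U p + κ₀ * U p ^ 2
        - (dir τ U p + lapl e U p) ^ 2))
      - dir τ ζ p * (Real.exp (2 * φ p) * ((gdot e φ φ p - dir τ φ p) * U p ^ 2))) ∂μ ≤ 0 := by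
  obtain ⟨φ', hφ', hφe⟩ := exists_contDiff_eventuallyEq hΩ hφ (isClosed_tsupport U) hUΩ
  obtain ⟨q', hq', hqe⟩ := exists_contDiff_eventuallyEq hΩ hq (isClosed_tsupport U) hUΩ
  have h := carleman_global (e := e) (τ := τ) μ hζ hζe hζ0 hζτ hU hUc hφ' hq' hκ (κ₀ := κ₀)
    (fun p hp hz ξ => by
      rw [hess_congr (hφe p hp), lapl_congr (hφe p hp), (hqe p hp).self_of_nhds]
      exact h1 p hp hz ξ)
    (fun p hp hz => by
      rw [lapl_congr (hφe p hp), (hqe p hp).self_of_nhds, gdot_congr (hφe p hp) (hφe p hp),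
        zeroTerm_congr (hφe p hp) (hqe p hp)]
      exact h2 p hp hz)
  refine le_of_eq_of_le (integral_congr_ae (Eventually.of_forall fun p => ?_)) h
  simp only
  by_cases hp : p ∈ tsupport U
  · rw [gdot_congr (hφe p hp) (hφe p hp), (hφe p hp).self_of_nhds,
      (dir_congr (hφe p hp) τ).self_of_nhds]
  · have k : U p = 0 := image_eq_zero_of_notMem_tsupport hp
    have k' : ∀ w, dir w U p = 0 := fun w =>
      image_eq_zero_of_notMem_tsupport fun h => hp (tsupport_dir_subset U w h)
    have k'' : lapl e U p = 0 := Finset.sum_eq_zero fun i _ =>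
      image_eq_zero_of_notMem_tsupport fun h => hp (tsupport_dir_subset U _
        (tsupport_dir_subset _ _ h))
    simp [k, k', k'', gdot]

end Carleman

section Caccioppoli

variable {V : Type*} [NormedAddCommGroup V] [NormedSpace ℝ V] {ι : Type*} [Fintype ι]
  {e : ι → V} {τ : V} {η u : V → ℝ}
  [FiniteDimensional ℝ V] [MeasurableSpace V] [BorelSpace V]
  (μ : Measure V) [μ.IsAddHaarMeasure]

theorem caccioppoli_global (hη : ContDiff ℝ ∞ η) (hηc : HasCompactSupport η) (hη0 : ∀ p, 0 ≤ η p)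
    (hu : ContDiff ℝ ∞ u) {c : ℝ}
    (hL : ∀ p ∈ tsupport η, |dir τ u p + lapl e u p| ≤ c * (√(gdot e u u p) + |u p|)) :
    ∫ p, (η p * gdot e u u p - u p ^ 2 * (lapl e η p - dir τ η p + (c ^ 2 + 2 * c) * η p)) ∂μ
      ≤ 0 := by
  have hX : ∀ i, ContDiff ℝ ∞ fun p => 2 * (η p * (u p * dir (e i) u p)) -
    dir (e i) η p * (u p * u p) := fun i => by fun_prop
  have hT : ContDiff ℝ ∞ fun p => η p * (u p * u p) := by fun_prop
  have hη0' : ∀ p, p ∉ tsupport η → η p = 0 ∧ (∀ w, dir w η p = 0) ∧ lapl e η p = 0 :=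
    fun p hp => ⟨image_eq_zero_of_notMem_tsupport hp, fun w =>
      image_eq_zero_of_notMem_tsupport fun h => hp (tsupport_dir_subset η w h),
      Finset.sum_eq_zero fun i _ =>
      image_eq_zero_of_notMem_tsupport fun h => hp (tsupport_dir_subset η _
        (tsupport_dir_subset _ _ h))⟩
  have hXc : ∀ i, HasCompactSupport fun p => 2 * (η p * (u p * dir (e i) u p)) -
    dir (e i) η p * (u p * u p) := fun i => by
    refine HasCompactSupport.intro hηc fun p hp => ?_
    obtain ⟨h, h', -⟩ := hη0' p hp
    simp [h, h']
  have hTc : HasCompactSupport fun p => η p * (u p * u p) := by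
    refine HasCompactSupport.intro hηc fun p hp => ?_
    simp [(hη0' p hp).1]
  have hint : ∫ p, (∑ i, dir (e i) (fun p => 2 * (η p * (u p * dir (e i) u p)) -
      dir (e i) η p * (u p * u p)) p + dir τ (fun p => η p * (u p * u p)) p) ∂μ = 0 := by
    rw [integral_add, integral_finsetSum, integral_dir_eq_zero μ hT hTc]
    · simp [fun i => integral_dir_eq_zero μ (hX i) (hXc i) (e i)]
    · exact fun i _ => ((hX i).dir _).continuous.integrable_of_hasCompactSupport ((hXc i).dir _)
    · exact integrable_finsetSum _ fun i _ =>
        ((hX i).dir _).continuous.integrable_of_hasCompactSupport ((hXc i).dir _)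
    · exact (hT.dir _).continuous.integrable_of_hasCompactSupport (hTc.dir _)
  have hdiv : ∀ p, ∑ i, dir (e i) (fun p => 2 * (η p * (u p * dir (e i) u p)) -
      dir (e i) η p * (u p * u p)) p + dir τ (fun p => η p * (u p * u p)) p =
      2 * (η p * gdot e u u p) + 2 * (η p * u p) * (dir τ u p + lapl e u p)
        - u p ^ 2 * lapl e η p + dir τ η p * u p ^ 2 := by
    intro p
    have : ∀ i, dir (e i) (fun p => 2 * (η p * (u p * dir (e i) u p)) -
      dir (e i) η p * (u p * u p)) p = 2 * (η p * (dir (e i) u p * dir (e i) u p))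
        + 2 * (η p * u p) * dir (e i) (dir (e i) u) p - u p ^ 2 * dir (e i) (dir (e i) η) p := by
      intro i
      rw [dir_sub (by fun_prop) (by fun_prop), dir_const_mul, dir_mul hη (by fun_prop),
        dir_mul hu (by fun_prop), dir_mul (hη.dir _) (by fun_prop), dir_mul hu hu]
      ring
    simp only [this, Finset.sum_sub_distrib, Finset.sum_add_distrib, ← Finset.mul_sum]
    rw [dir_mul hη (by fun_prop), dir_mul hu hu]
    simp only [gdot, lapl]
    ring
  simp only [hdiv] at hint
  rw [← hint]
  have hcont : ∀ {G : V → ℝ}, ContDiff ℝ ∞ G → (∀ p, p ∉ tsupport η → G p = 0) → Integrable G μ :=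
    fun hG h0 => hG.continuous.integrable_of_hasCompactSupport (HasCompactSupport.intro hηc h0)
  refine integral_mono (hcont (by fun_prop) ?_) (hcont (by fun_prop) ?_) fun p => ?_
  · intro p hp
    obtain ⟨h, h', h''⟩ := hη0' p hp
    simp [h, h', h'']
  · intro p hp
    obtain ⟨h, h', h''⟩ := hη0' p hp
    simp [h, h', h'']
  · simp only
    by_cases hp : p ∈ tsupport η
    · have hg0 : 0 ≤ gdot e u u p := Finset.sum_nonneg fun i _ => mul_self_nonneg _
      have k := hL p hp
      obtain ⟨s, hs⟩ : ∃ s, s = √(gdot e u u p) := ⟨_, rfl⟩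
      have hs2 : s ^ 2 = gdot e u u p := by rw [hs, Real.sq_sqrt hg0]
      rw [← hs] at k
      have h1 : -(2 * u p * (dir τ u p + lapl e u p)) ≤ s ^ 2 + (c ^ 2 + 2 * c) * u p ^ 2 := by
        have h2 : -(2 * u p * (dir τ u p + lapl e u p)) ≤ 2 * |u p| * |dir τ u p + lapl e u p| := by
          rw [mul_assoc, mul_assoc, ← abs_mul]
          linarith [neg_abs_le (u p * (dir τ u p + lapl e u p))]
        have h3 := mul_le_mul_of_nonneg_left k (abs_nonneg (u p))
        have h4 : |u p| ^ 2 = u p ^ 2 := sq_abs _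
        rw [← h4]
        nlinarith [sq_nonneg (s - c * |u p|)]
      rw [← hs2]
      nlinarith [mul_le_mul_of_nonneg_left h1 (hη0 p)]
    · obtain ⟨h, h', h''⟩ := hη0' p hp
      simp [h, h', h'']

/-- A Caccioppoli inequality for the backward heat operator `∂_τ + Δ`. -/
theorem caccioppoli {Ω : Set V} (hΩ : IsOpen Ω) (hη : ContDiff ℝ ∞ η) (hηc : HasCompactSupport η)
    (hηΩ : tsupport η ⊆ Ω) (hη0 : ∀ p, 0 ≤ η p) (hu : ContDiffOn ℝ ∞ u Ω) {c : ℝ}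
    (hL : ∀ p ∈ Ω, |dir τ u p + lapl e u p| ≤ c * (√(gdot e u u p) + |u p|)) :
    ∫ p, (η p * gdot e u u p - u p ^ 2 * (lapl e η p - dir τ η p + (c ^ 2 + 2 * c) * η p)) ∂μ
      ≤ 0 := by
  obtain ⟨u', hu', hue⟩ := exists_contDiff_eventuallyEq hΩ hu (isClosed_tsupport η) hηΩ
  have h := caccioppoli_global (e := e) (τ := τ) μ hη hηc hη0 hu' (c := c) fun p hp => by
    rw [lapl_congr (hue p hp), gdot_congr (hue p hp) (hue p hp), (hue p hp).self_of_nhds,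
      (dir_congr (hue p hp) τ).self_of_nhds]
    exact hL p (hηΩ hp)
  refine le_of_eq_of_le (integral_congr_ae (Eventually.of_forall fun p => ?_)) h
  simp only
  by_cases hp : p ∈ tsupport η
  · rw [gdot_congr (hue p hp) (hue p hp), (hue p hp).self_of_nhds]
  · have k : η p = 0 := image_eq_zero_of_notMem_tsupport hp
    have k' : ∀ w, dir w η p = 0 := fun w =>
      image_eq_zero_of_notMem_tsupport fun h => hp (tsupport_dir_subset η w h)
    have k'' : lapl e η p = 0 := Finset.sum_eq_zero fun i _ =>
      image_eq_zero_of_notMem_tsupport fun h => hp (tsupport_dir_subset η _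
        (tsupport_dir_subset _ _ h))
    simp [k, k', k'']

end Caccioppoli

section Separable

variable {n : ℕ}

/-- Spatial coordinate directions in space-time. -/
noncomputable def ex (i : Fin n) : EuclideanSpace ℝ (Fin n) × ℝ := (EuclideanSpace.single i 1, 0)

/-- The time direction in space-time. -/
def et : EuclideanSpace ℝ (Fin n) × ℝ := (0, 1)

/-- The squared norm of the space variable. -/
noncomputable def nsq (p : EuclideanSpace ℝ (Fin n) × ℝ) : ℝ := ‖p.1‖ ^ 2

instance : (volume : Measure (EuclideanSpace ℝ (Fin n) × ℝ)).IsAddHaarMeasure :=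
  inferInstanceAs (Measure.prod volume volume).IsAddHaarMeasure

@[fun_prop]
theorem contDiff_coord (i : Fin n) :
    ContDiff ℝ ∞ fun p : EuclideanSpace ℝ (Fin n) × ℝ => p.1 i :=
  (EuclideanSpace.proj (𝕜 := ℝ) i ∘L ContinuousLinearMap.fst ℝ _ ℝ).contDiff

@[fun_prop]
theorem contDiff_nsq : ContDiff ℝ ∞ (nsq (n := n)) := by
  unfold nsq; exact contDiff_fst.norm_sq ℝ

theorem nsq_eq (p : EuclideanSpace ℝ (Fin n) × ℝ) : nsq p = ∑ i, p.1 i ^ 2 := by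
  rw [nsq, EuclideanSpace.norm_sq_eq]; simp

theorem nsq_nonneg (p : EuclideanSpace ℝ (Fin n) × ℝ) : 0 ≤ nsq p := sq_nonneg _

theorem dir_coord (w : EuclideanSpace ℝ (Fin n) × ℝ) (i : Fin n)
    (p : EuclideanSpace ℝ (Fin n) × ℝ) : dir w (fun p => p.1 i) p = w.1 i := by
  have := (EuclideanSpace.proj (𝕜 := ℝ) i ∘L ContinuousLinearMap.fst ℝ _ ℝ).fderiv (x := p)
  exact congrArg (fun L => L w) this

theorem dir_snd (w p : EuclideanSpace ℝ (Fin n) × ℝ) : dir w (fun p => p.2) p = w.2 :=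
  congrArg (fun L => L w) ((ContinuousLinearMap.snd ℝ (EuclideanSpace ℝ (Fin n)) ℝ).fderiv (x := p))

theorem dir_nsq (w p : EuclideanSpace ℝ (Fin n) × ℝ) : dir w nsq p = 2 * ∑ i, p.1 i * w.1 i := by
  have : (nsq (n := n)) = fun p => ∑ i, p.1 i ^ 2 := funext nsq_eq
  rw [this, dir_sum _ (fun i => by fun_prop), Finset.mul_sum]
  refine Finset.sum_congr rfl fun i _ => ?_
  rw [dir_sq (by fun_prop)]
  simp only [dir_coord]; ring

theorem dir_ex_coord (i j : Fin n) (p : EuclideanSpace ℝ (Fin n) × ℝ) :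
    dir (ex j) (fun p => p.1 i) p = if i = j then 1 else 0 := by
  rw [dir_coord]; simp [ex]

theorem dir_ex_nsq (i : Fin n) (p : EuclideanSpace ℝ (Fin n) × ℝ) :
    dir (ex i) nsq p = 2 * p.1 i := by
  rw [dir_nsq]; simp [ex]

theorem dir_et_nsq (p : EuclideanSpace ℝ (Fin n) × ℝ) : dir et nsq p = 0 := by
  rw [dir_nsq]; simp [et]

theorem differentiableAt_comp_snd {p : EuclideanSpace ℝ (Fin n) × ℝ} {k : ℝ → ℝ}
    (hk : DifferentiableAt ℝ k p.2) :
    DifferentiableAt ℝ (fun p : EuclideanSpace ℝ (Fin n) × ℝ => k p.2) p :=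
  hk.comp p differentiableAt_snd

theorem differentiableAt_comp_nsq {p : EuclideanSpace ℝ (Fin n) × ℝ} {k : ℝ → ℝ}
    (hk : DifferentiableAt ℝ k (nsq p)) :
    DifferentiableAt ℝ (fun p : EuclideanSpace ℝ (Fin n) × ℝ => k (nsq p)) p :=
  hk.comp p (contDiff_nsq.diffAt p)

theorem dir_comp_snd {p : EuclideanSpace ℝ (Fin n) × ℝ} {k : ℝ → ℝ} {d : ℝ}
    (hk : HasDerivAt k d p.2) (w) :
    dir w (fun p : EuclideanSpace ℝ (Fin n) × ℝ => k p.2) p = d * w.2 := by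
  rw [dir_comp hk differentiableAt_snd, dir_snd]

variable [NeZero n]

/-- Functions of time, of the first coordinate, and of the squared norm of the space variable, in
the separated form used for Carleman weights. -/
noncomputable def sep (k₀ k₁ k₂ g h : ℝ → ℝ) (p : EuclideanSpace ℝ (Fin n) × ℝ) : ℝ :=
  k₀ p.2 + k₁ p.2 * nsq p + k₂ p.2 * (g (p.1 0) + h (nsq p))

/-- The space-time region cut out by conditions on time, first coordinate and squared norm. -/
def sepDomain (n : ℕ) [NeZero n] (I J S : Set ℝ) : Set (EuclideanSpace ℝ (Fin n) × ℝ) :=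
  {p | p.2 ∈ I ∧ p.1 0 ∈ J ∧ nsq p ∈ S}

theorem isOpen_sepDomain {I J S : Set ℝ} (hI : IsOpen I) (hJ : IsOpen J) (hS : IsOpen S) :
    IsOpen (sepDomain n I J S) :=
  (hI.preimage continuous_snd).inter ((hJ.preimage (contDiff_coord 0).continuous).inter
    (hS.preimage contDiff_nsq.continuous))

theorem contDiffOn_sep {I J S : Set ℝ} {k₀ k₁ k₂ g h : ℝ → ℝ} (h0 : ContDiffOn ℝ ∞ k₀ I)
    (h1 : ContDiffOn ℝ ∞ k₁ I) (h2 : ContDiffOn ℝ ∞ k₂ I) (hg : ContDiffOn ℝ ∞ g J)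
    (hh : ContDiffOn ℝ ∞ h S) : ContDiffOn ℝ ∞ (sep k₀ k₁ k₂ g h) (sepDomain n I J S) := by
  have hT : ∀ {k : ℝ → ℝ}, ContDiffOn ℝ ∞ k I →
      ContDiffOn ℝ ∞ (fun p : EuclideanSpace ℝ (Fin n) × ℝ => k p.2) (sepDomain n I J S) :=
    fun hk => hk.comp contDiff_snd.contDiffOn fun p hp => hp.1
  have hG : ContDiffOn ℝ ∞ (fun p : EuclideanSpace ℝ (Fin n) × ℝ => g (p.1 0))
      (sepDomain n I J S) := hg.comp (contDiff_coord 0).contDiffOn fun p hp => hp.2.1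
  have hH : ContDiffOn ℝ ∞ (fun p : EuclideanSpace ℝ (Fin n) × ℝ => h (nsq p))
      (sepDomain n I J S) := hh.comp contDiff_nsq.contDiffOn fun p hp => hp.2.2
  exact ((hT h0).add ((hT h1).mul contDiff_nsq.contDiffOn)).add ((hT h2).mul (hG.add hH))

section Derivatives

variable {k₀ k₁ k₂ g h g' h' k₀' k₁' k₂' : ℝ → ℝ} {p : EuclideanSpace ℝ (Fin n) × ℝ}

theorem differentiableAt_comp_coord {k : ℝ → ℝ} (hk : DifferentiableAt ℝ k (p.1 0)) :
    DifferentiableAt ℝ (fun p : EuclideanSpace ℝ (Fin n) × ℝ => k (p.1 0)) p :=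
  hk.comp p ((contDiff_coord 0).diffAt p)

theorem dir_comp_coord {k : ℝ → ℝ} {d : ℝ} (hk : HasDerivAt k d (p.1 0)) (w) :
    dir w (fun p : EuclideanSpace ℝ (Fin n) × ℝ => k (p.1 0)) p = d * w.1 0 := by
  rw [dir_comp (f := fun p : EuclideanSpace ℝ (Fin n) × ℝ => p.1 0) hk
    ((contDiff_coord 0).diffAt p), dir_coord]

theorem dir_sep {d₀ d₁ d₂ dg dh : ℝ} (h0 : HasDerivAt k₀ d₀ p.2) (h1 : HasDerivAt k₁ d₁ p.2)
    (h2 : HasDerivAt k₂ d₂ p.2) (hg : HasDerivAt g dg (p.1 0)) (hh : HasDerivAt h dh (nsq p)) (w) :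
    dir w (sep k₀ k₁ k₂ g h) p =
      (d₀ + d₁ * nsq p + d₂ * (g (p.1 0) + h (nsq p))) * w.2
      + (k₁ p.2 + k₂ p.2 * dh) * dir w nsq p + k₂ p.2 * dg * w.1 0 := by
  have a0 := differentiableAt_comp_snd h0.differentiableAt
  have a1 := differentiableAt_comp_snd h1.differentiableAt
  have a2 := differentiableAt_comp_snd h2.differentiableAt
  have ag := differentiableAt_comp_coord hg.differentiableAt
  have ah := differentiableAt_comp_nsq hh.differentiableAt
  have as := contDiff_nsq.diffAt p
  have b1 : DifferentiableAt ℝ (fun p => k₁ p.2 * nsq p) p := a1.mul as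
  have b2 : DifferentiableAt ℝ (fun p : EuclideanSpace ℝ (Fin n) × ℝ => g (p.1 0) + h (nsq p)) p :=
    ag.add ah
  have b3 : DifferentiableAt ℝ (fun p => k₀ p.2 + k₁ p.2 * nsq p) p := a0.add b1
  have b4 : DifferentiableAt ℝ (fun p : EuclideanSpace ℝ (Fin n) × ℝ =>
    k₂ p.2 * (g (p.1 0) + h (nsq p))) p := a2.mul b2
  unfold sep
  rw [dir_add' b3 b4, dir_add' a0 b1, dir_mul' a1 as,
    dir_mul' a2 b2, dir_add' ag ah, dir_comp_snd h0, dir_comp_snd h1, dir_comp_snd h2,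
    dir_comp_coord hg, dir_comp hh as]
  ring

theorem dir_ex_sep {d₀ d₁ d₂ dg dh : ℝ} (h0 : HasDerivAt k₀ d₀ p.2) (h1 : HasDerivAt k₁ d₁ p.2)
    (h2 : HasDerivAt k₂ d₂ p.2) (hg : HasDerivAt g dg (p.1 0)) (hh : HasDerivAt h dh (nsq p))
    (i : Fin n) : dir (ex i) (sep k₀ k₁ k₂ g h) p =
      2 * (k₁ p.2 + k₂ p.2 * dh) * p.1 i + k₂ p.2 * dg * (if i = 0 then 1 else 0) := by
  rw [dir_sep h0 h1 h2 hg hh, dir_ex_nsq]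
  simp [ex, eq_comm]; ring

theorem dir_et_sep {d₀ d₁ d₂ dg dh : ℝ} (h0 : HasDerivAt k₀ d₀ p.2) (h1 : HasDerivAt k₁ d₁ p.2)
    (h2 : HasDerivAt k₂ d₂ p.2) (hg : HasDerivAt g dg (p.1 0)) (hh : HasDerivAt h dh (nsq p)) :
    dir et (sep k₀ k₁ k₂ g h) p = d₀ + d₁ * nsq p + d₂ * (g (p.1 0) + h (nsq p)) := by
  rw [dir_sep h0 h1 h2 hg hh, dir_et_nsq]
  simp [et]

theorem sum_affine (x : EuclideanSpace ℝ (Fin n)) (a b a' b' : ℝ) :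
    ∑ i, (b * x i + a * (if i = 0 then 1 else 0)) * (b' * x i + a' * (if i = 0 then 1 else 0))
      = b * b' * ∑ i, x i ^ 2 + (a * b' + a' * b) * x 0 + a * a' := by
  have : ∀ i, (b * x i + a * (if i = 0 then 1 else 0)) * (b' * x i + a' * (if i = 0 then 1 else 0))
      = b * b' * x i ^ 2 + (a * b' + a' * b) * (x i * if i = 0 then 1 else 0)
        + a * a' * (if i = 0 then 1 else 0) := by
    intro i; split_ifs <;> ring
  simp only [this, Finset.sum_add_distrib, ← Finset.mul_sum]
  simp

end Derivatives

/-- Successive derivatives of the profiles of a separated function. -/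
structure SepData (I J S : Set ℝ) where
  (k₀ k₀' k₀'' k₁ k₁' k₁'' k₂ k₂' k₂'' g g' g'' h h' h'' : ℝ → ℝ)
  hk₀ : ∀ t ∈ I, HasDerivAt k₀ (k₀' t) t
  hk₀' : ∀ t ∈ I, HasDerivAt k₀' (k₀'' t) t
  hk₁ : ∀ t ∈ I, HasDerivAt k₁ (k₁' t) t
  hk₁' : ∀ t ∈ I, HasDerivAt k₁' (k₁'' t) t
  hk₂ : ∀ t ∈ I, HasDerivAt k₂ (k₂' t) t
  hk₂' : ∀ t ∈ I, HasDerivAt k₂' (k₂'' t) t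
  hg : ∀ y ∈ J, HasDerivAt g (g' y) y
  hg' : ∀ y ∈ J, HasDerivAt g' (g'' y) y
  hh : ∀ s ∈ S, HasDerivAt h (h' s) s
  hh' : ∀ s ∈ S, HasDerivAt h' (h'' s) s

namespace SepData

variable {I J S : Set ℝ} (D : SepData I J S)

/-- The separated function given by the data. -/
noncomputable def fn : EuclideanSpace ℝ (Fin n) × ℝ → ℝ := sep D.k₀ D.k₁ D.k₂ D.g D.h

/-- Half the radial coefficient of the gradient. -/
noncomputable def rad (p : EuclideanSpace ℝ (Fin n) × ℝ) : ℝ := D.k₁ p.2 + D.k₂ p.2 * D.h' (nsq p)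

/-- The coefficient of the first basis vector in the gradient. -/
noncomputable def axial (p : EuclideanSpace ℝ (Fin n) × ℝ) : ℝ := D.k₂ p.2 * D.g' (p.1 0)

variable {D} {p : EuclideanSpace ℝ (Fin n) × ℝ} (hI : IsOpen I) (hJ : IsOpen J) (hS : IsOpen S)
  (hp : p ∈ sepDomain n I J S)

include hp in
theorem dir_ex_fn (i : Fin n) : dir (ex i) D.fn p =
    2 * D.rad p * p.1 i + D.axial p * (if i = 0 then 1 else 0) :=
  dir_ex_sep (D.hk₀ _ hp.1) (D.hk₁ _ hp.1) (D.hk₂ _ hp.1) (D.hg _ hp.2.1) (D.hh _ hp.2.2) i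

include hp in
theorem dir_et_fn : dir et D.fn p = sep D.k₀' D.k₁' D.k₂' D.g D.h p :=
  dir_et_sep (D.hk₀ _ hp.1) (D.hk₁ _ hp.1) (D.hk₂ _ hp.1) (D.hg _ hp.2.1) (D.hh _ hp.2.2)

include hI hJ hS hp in
theorem eventually_mem : ∀ᶠ x in 𝓝 p, x ∈ sepDomain n I J S :=
  (isOpen_sepDomain hI hJ hS).mem_nhds hp

include hI hJ hS hp in
theorem dir_et_et_fn : dir et (dir et D.fn) p = sep D.k₀'' D.k₁'' D.k₂'' D.g D.h p := by
  have : dir et D.fn =ᶠ[𝓝 p] sep D.k₀' D.k₁' D.k₂' D.g D.h :=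
    (eventually_mem hI hJ hS hp).mono fun x hx => dir_et_fn hx
  rw [(dir_congr this et).self_of_nhds]
  exact dir_et_sep (D.hk₀' _ hp.1) (D.hk₁' _ hp.1) (D.hk₂' _ hp.1) (D.hg _ hp.2.1) (D.hh _ hp.2.2)

include hI hJ hS hp in
theorem dir_ex_et_fn (i : Fin n) : dir (ex i) (dir et D.fn) p =
    2 * (D.k₁' p.2 + D.k₂' p.2 * D.h' (nsq p)) * p.1 i
      + D.k₂' p.2 * D.g' (p.1 0) * (if i = 0 then 1 else 0) := by
  have : dir et D.fn =ᶠ[𝓝 p] sep D.k₀' D.k₁' D.k₂' D.g D.h :=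
    (eventually_mem hI hJ hS hp).mono fun x hx => dir_et_fn hx
  rw [(dir_congr this (ex i)).self_of_nhds]
  exact dir_ex_sep (D.hk₀' _ hp.1) (D.hk₁' _ hp.1) (D.hk₂' _ hp.1) (D.hg _ hp.2.1) (D.hh _ hp.2.2) i

include hI hJ hS hp in
theorem dir_ex_ex_fn (i j : Fin n) : dir (ex i) (dir (ex j) D.fn) p =
    2 * D.rad p * (if j = i then 1 else 0) + 4 * D.k₂ p.2 * D.h'' (nsq p) * (p.1 i * p.1 j)
      + D.k₂ p.2 * D.g'' (p.1 0) * ((if i = 0 then 1 else 0) * (if j = 0 then 1 else 0)) := by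
  have : dir (ex j) D.fn =ᶠ[𝓝 p] fun p => 2 * (D.k₁ p.2 + D.k₂ p.2 * D.h' (nsq p)) * p.1 j +
      D.k₂ p.2 * D.g' (p.1 0) * (if j = 0 then 1 else 0) :=
    (eventually_mem hI hJ hS hp).mono fun x hx => dir_ex_fn hx j
  rw [(dir_congr this (ex i)).self_of_nhds]
  have a1 := differentiableAt_comp_snd (D.hk₁ _ hp.1).differentiableAt
  have a2 := differentiableAt_comp_snd (D.hk₂ _ hp.1).differentiableAt
  have ag := differentiableAt_comp_coord (D.hg' _ hp.2.1).differentiableAt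
  have ah := differentiableAt_comp_nsq (D.hh' _ hp.2.2).differentiableAt
  have ax := (contDiff_coord j).diffAt p
  have ac : ∀ c : ℝ, DifferentiableAt ℝ (fun _ : EuclideanSpace ℝ (Fin n) × ℝ => c) p :=
    fun c => differentiableAt_const c
  have b1 : DifferentiableAt ℝ (fun p : EuclideanSpace ℝ (Fin n) × ℝ =>
    D.k₂ p.2 * D.h' (nsq p)) p := a2.mul ah
  have b2 : DifferentiableAt ℝ (fun p : EuclideanSpace ℝ (Fin n) × ℝ =>
    D.k₁ p.2 + D.k₂ p.2 * D.h' (nsq p)) p := a1.add b1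
  have b3 : DifferentiableAt ℝ (fun p : EuclideanSpace ℝ (Fin n) × ℝ =>
    2 * (D.k₁ p.2 + D.k₂ p.2 * D.h' (nsq p))) p := (ac 2).mul b2
  have b4 : DifferentiableAt ℝ (fun p : EuclideanSpace ℝ (Fin n) × ℝ =>
    2 * (D.k₁ p.2 + D.k₂ p.2 * D.h' (nsq p)) * p.1 j) p := b3.mul ax
  have b5 : DifferentiableAt ℝ (fun p : EuclideanSpace ℝ (Fin n) × ℝ =>
    D.k₂ p.2 * D.g' (p.1 0)) p := a2.mul ag
  have b6 : DifferentiableAt ℝ (fun p : EuclideanSpace ℝ (Fin n) × ℝ =>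
    D.k₂ p.2 * D.g' (p.1 0) * (if j = 0 then 1 else 0)) p := b5.mul (ac _)
  rw [dir_add' b4 b6, dir_mul' b3 ax, dir_const_mul, dir_mul' b5 (ac _), dir_const, dir_mul' a2 ag]
  simp only
  rw [dir_add' a1 b1, dir_mul' a2 ah,
    dir_comp_snd (D.hk₁ _ hp.1), dir_comp_snd (D.hk₂ _ hp.1),
    dir_comp_coord (D.hg' _ hp.2.1),
    dir_comp (D.hh' _ hp.2.2) (contDiff_nsq.diffAt p), dir_ex_coord, dir_ex_nsq]
  have : (ex i).2 = 0 := rfl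
  have h0 : (ex i).1 0 = if i = 0 then 1 else 0 := by simp [ex, eq_comm]
  rw [this, h0]
  simp only [rad]
  ring

include hI hJ hS hp in
theorem lapl_fn : lapl ex D.fn p =
    2 * n * D.rad p + 4 * D.k₂ p.2 * D.h'' (nsq p) * nsq p + D.k₂ p.2 * D.g'' (p.1 0) := by
  have : ∀ i, dir (ex i) (dir (ex i) D.fn) p
      = 2 * D.rad p + 4 * D.k₂ p.2 * D.h'' (nsq p) * p.1 i ^ 2
      + D.k₂ p.2 * D.g'' (p.1 0) * (if i = 0 then 1 else 0) := by
    intro i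
    rw [dir_ex_ex_fn hI hJ hS hp, if_pos rfl]
    split_ifs <;> ring
  rw [lapl, Finset.sum_congr rfl fun i _ => this i]
  simp only [Finset.sum_add_distrib, ← Finset.mul_sum, nsq_eq]
  simp; ring

include hI hJ hS hp in
theorem hess_fn (ξ : Fin n → ℝ) : hess ex D.fn p ξ =
    2 * D.rad p * ∑ i, ξ i ^ 2 + 4 * D.k₂ p.2 * D.h'' (nsq p) * (∑ i, p.1 i * ξ i) ^ 2
      + D.k₂ p.2 * D.g'' (p.1 0) * ξ 0 ^ 2 := by
  simp only [hess, dir_ex_ex_fn hI hJ hS hp]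
  have : ∀ i, ∑ j, (2 * D.rad p * (if j = i then (1 : ℝ) else 0) +
      4 * D.k₂ p.2 * D.h'' (nsq p) * (p.1 i * p.1 j)
      + D.k₂ p.2 * D.g'' (p.1 0) * ((if i = 0 then 1 else 0) * (if j = 0 then 1 else 0)))
        * ξ i * ξ j = 2 * D.rad p * ξ i ^ 2 + 4 * D.k₂ p.2 * D.h'' (nsq p) *
        ((∑ j, p.1 j * ξ j) * (p.1 i * ξ i))
        + D.k₂ p.2 * D.g'' (p.1 0) * (ξ 0 * (ξ i * if i = 0 then 1 else 0)) := by
    intro i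
    have : ∀ j, (2 * D.rad p * (if j = i then (1 : ℝ) else 0) +
      4 * D.k₂ p.2 * D.h'' (nsq p) * (p.1 i * p.1 j)
      + D.k₂ p.2 * D.g'' (p.1 0) * ((if i = 0 then 1 else 0) * (if j = 0 then 1 else 0)))
        * ξ i * ξ j = 2 * D.rad p * ξ i * (ξ j * if j = i then 1 else 0) +
        4 * D.k₂ p.2 * D.h'' (nsq p) * (p.1 i * ξ i) * (p.1 j * ξ j)
        + D.k₂ p.2 * D.g'' (p.1 0) * (if i = 0 then 1 else 0) * ξ i *
          (ξ j * if j = 0 then 1 else 0) := by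
      intro j; ring
    simp only [this, Finset.sum_add_distrib, ← Finset.mul_sum]
    simp; ring
  simp only [this, Finset.sum_add_distrib, ← Finset.mul_sum]
  simp; ring

include hp in
theorem gdot_fn : gdot ex D.fn D.fn p =
    4 * D.rad p ^ 2 * nsq p + 4 * D.rad p * D.axial p * p.1 0 + D.axial p ^ 2 := by
  simp only [gdot, dir_ex_fn hp, sum_affine, nsq_eq]
  ring

include hI hJ hS hp in
theorem zeroTerm_fn (Q : SepData I J S) : zeroTerm ex et D.fn Q.fn p =
    4 * (2 * D.rad p * gdot ex D.fn D.fn p + 4 * D.k₂ p.2 * D.h'' (nsq p) *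
        (2 * D.rad p * nsq p + D.axial p * p.1 0) ^ 2
      + D.k₂ p.2 * D.g'' (p.1 0) * (2 * D.rad p * p.1 0 + D.axial p) ^ 2)
    - 4 * (2 * D.rad p * (2 * (D.k₁' p.2 + D.k₂' p.2 * D.h' (nsq p))) * nsq p
      + (D.axial p * (2 * (D.k₁' p.2 + D.k₂' p.2 * D.h' (nsq p)))
        + D.k₂' p.2 * D.g' (p.1 0) * (2 * D.rad p)) * p.1 0
      + D.axial p * (D.k₂' p.2 * D.g' (p.1 0)))
    + sep D.k₀'' D.k₁'' D.k₂'' D.g D.h p + lapl ex Q.fn p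
    + 2 * (Q.fn p + lapl ex D.fn p) * (gdot ex D.fn D.fn p - sep D.k₀' D.k₁' D.k₂' D.g D.h p) := by
  rw [zeroTerm, dir_et_et_fn hI hJ hS hp, dir_et_fn hp, hess_fn hI hJ hS hp]
  have h1 : gdot ex D.fn (dir et D.fn) p =
      2 * D.rad p * (2 * (D.k₁' p.2 + D.k₂' p.2 * D.h' (nsq p))) * nsq p
      + (D.axial p * (2 * (D.k₁' p.2 + D.k₂' p.2 * D.h' (nsq p)))
        + D.k₂' p.2 * D.g' (p.1 0) * (2 * D.rad p)) * p.1 0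
      + D.axial p * (D.k₂' p.2 * D.g' (p.1 0)) := by
    simp only [gdot, dir_ex_fn hp, dir_ex_et_fn hI hJ hS hp, sum_affine, nsq_eq]
  have h2 : ∑ i, dir (ex i) D.fn p ^ 2 = gdot ex D.fn D.fn p :=
    Finset.sum_congr rfl fun i _ => sq _
  have h3 : ∑ i, p.1 i * dir (ex i) D.fn p = 2 * D.rad p * nsq p + D.axial p * p.1 0 := by
    have := sum_affine p.1 0 1 (D.axial p) (2 * D.rad p)
    simp only [dir_ex_fn hp, nsq_eq]
    refine (Finset.sum_congr rfl fun i _ => ?_).trans (this.trans ?_)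
    · rw [one_mul, zero_mul, add_zero]
    · ring
  rw [h1, h2, h3, dir_ex_fn hp]
  simp only [if_true, mul_one]

end SepData

end Separable

section TimeProfile

/-- A smooth nonincreasing time profile vanishing for `2 ≤ t`. -/
noncomputable def prof (K t : ℝ) : ℝ := expNegInvGlue ((2 - t) / K)

/-- The derivative of `prof`. -/
noncomputable def prof₁ (K t : ℝ) : ℝ :=
  -(((2 - t) / K)⁻¹ ^ 2 * expNegInvGlue ((2 - t) / K)) / K

/-- The second derivative of `prof`. -/
noncomputable def prof₂ (K t : ℝ) : ℝ :=
  (((2 - t) / K)⁻¹ ^ 4 - 2 * ((2 - t) / K)⁻¹ ^ 3) * expNegInvGlue ((2 - t) / K) / K ^ 2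

theorem contDiff_prof (K : ℝ) : ContDiff ℝ ∞ (prof K) :=
  expNegInvGlue.contDiff.comp (by fun_prop)

theorem prof_nonneg (K t : ℝ) : 0 ≤ prof K t := expNegInvGlue.nonneg _

theorem hasDerivAt_prof_arg (K t : ℝ) : HasDerivAt (fun t : ℝ => (2 - t) / K) (-1 / K) t :=
  ((hasDerivAt_id t).const_sub 2).div_const K

theorem hasDerivAt_prof (K t : ℝ) : HasDerivAt (prof K) (prof₁ K t) t := by
  have h := (expNegInvGlue.hasDerivAt_polynomial_eval_inv_mul 1 ((2 - t) / K)).comp t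
    (hasDerivAt_prof_arg K t)
  have e : prof K = (fun x => Polynomial.eval x⁻¹ 1 * expNegInvGlue x) ∘ fun t => (2 - t) / K := by
    funext t; simp [prof]
  rw [e]
  exact h.congr_deriv (by simp [prof₁]; ring)

theorem hasDerivAt_prof₁ (K t : ℝ) : HasDerivAt (prof₁ K) (prof₂ K t) t := by
  have h := (((expNegInvGlue.hasDerivAt_polynomial_eval_inv_mul (Polynomial.X ^ 2)
    ((2 - t) / K)).comp t (hasDerivAt_prof_arg K t)).neg).div_const K
  have e : prof₁ K = fun t => -((fun x => Polynomial.eval x⁻¹ (Polynomial.X ^ 2) *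
      expNegInvGlue x) ∘ fun t => (2 - t) / K) t / K := by
    funext t; simp only [prof₁, Function.comp, Polynomial.eval_pow, Polynomial.eval_X]
  rw [e]
  exact h.congr_deriv (by simp [prof₂]; ring)

theorem mul_prof_le {K t : ℝ} (hK : 1 ≤ K) (ht : 1 ≤ t) : K * prof K t ≤ -prof₁ K t := by
  rcases le_or_gt 2 t with h | h
  · have : expNegInvGlue ((2 - t) / K) = 0 :=
      expNegInvGlue.zero_of_nonpos (div_nonpos_of_nonpos_of_nonneg (by linarith) (by linarith))
    simp [prof, prof₁, this]
  · have hE := expNegInvGlue.nonneg ((2 - t) / K)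
    have hy : K ≤ ((2 - t) / K)⁻¹ := by
      rw [inv_div, le_div_iff₀ (by linarith)]; nlinarith
    simp only [prof, prof₁]
    rw [neg_div, neg_neg, le_div_iff₀ (by linarith)]
    have : K ^ 2 ≤ ((2 - t) / K)⁻¹ ^ 2 := by gcongr
    nlinarith [mul_le_mul_of_nonneg_right this hE]

theorem prof₁_nonpos {K : ℝ} (hK : 1 ≤ K) (t : ℝ) : prof₁ K t ≤ 0 := by
  have hE := expNegInvGlue.nonneg ((2 - t) / K)
  unfold prof₁
  exact div_nonpos_of_nonpos_of_nonneg (neg_nonpos.2 (by positivity)) (by linarith)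

theorem le_prof₂ {K L t : ℝ} (hL : 0 ≤ L) (hK : 10 + 2 * L ≤ K) (ht : 1 ≤ t) :
    8 * -prof₁ K t + 2 * L * prof K t ≤ prof₂ K t := by
  rcases le_or_gt 2 t with h | h
  · have : expNegInvGlue ((2 - t) / K) = 0 :=
      expNegInvGlue.zero_of_nonpos (div_nonpos_of_nonpos_of_nonneg (by linarith) (by linarith))
    simp [prof, prof₁, prof₂, this]
  · have hE := expNegInvGlue.nonneg ((2 - t) / K)
    have hy : K ≤ ((2 - t) / K)⁻¹ := by
      rw [inv_div, le_div_iff₀ (by linarith)]; nlinarith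
    simp only [prof, prof₁, prof₂]
    generalize expNegInvGlue ((2 - t) / K) = E at *
    generalize ((2 - t) / K)⁻¹ = y at *
    have hK0 : 0 < K := by linarith
    rw [le_div_iff₀ (by positivity), neg_div, neg_neg]
    have e1 : (8 * (y ^ 2 * E / K) + 2 * L * E) * K ^ 2 = (8 * K * y ^ 2 + 2 * L * K ^ 2) * E := by
      field_simp
    rw [e1]
    refine mul_le_mul_of_nonneg_right ?_ hE
    have h1 : K ^ 2 ≤ y ^ 2 := by gcongr
    have h2 : 2 * y + 8 * K + 2 * L ≤ y ^ 2 := by nlinarith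
    have h3 := mul_le_mul_of_nonneg_left h2 (sq_nonneg y)
    nlinarith [mul_le_mul_of_nonneg_left h1 hL]

end TimeProfile

section Algebra

set_option maxHeartbeats 1600000 in
/-- The algebraic inequality behind the Carleman estimate in the cone. -/
theorem carleman_weight_le {α m τ A B C K L Λ b e x s : ℝ} (hα : 1 / 2 ≤ α) (hα1 : α ≤ 1)
    (hm : 0 < m) (hm3 : 3 * m < 1) (hαm : 2 * m ≤ (2 * α - 1) * (1 - m))
    (hτ : 1 / 12 ≤ τ) (hτ4 : τ ≤ 1 / 4) (hA : 0 ≤ A) (hB : K * A ≤ B) (hL : 0 ≤ L)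
    (hK : 13 ≤ 4 * (1 - 3 * m) * K) (hC : 8 * B + 2 * L * A ≤ C) (hΛ : -(L * A) ≤ Λ)
    (he : 0 < e) (hbe : e ≤ b) (hx : 1 ≤ x) (hs : 1000 ≤ s) (hf : m * (e * s) + 1 ≤ b * x ^ 2)
    {F N : ℝ} (hF : F = -2 * τ - 1 - 2 * m * A * e)
    (hN : N = (τ + m * A * e) ^ 2 * s - 2 * (τ + m * A * e) * (A * b * x) * x + (A * b * x) ^ 2) :
    1 + F ^ 2 + N ≤
      4 * (-(τ + m * A * e) * N + 2 * A * m * (1 - α) * (e / s) *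
          (-(τ + m * A * e) * s + A * b * x * x) ^ 2
        + A * (2 * α - 1) * b * (-(τ + m * A * e) * x + A * b * x) ^ 2)
      - 4 * (-(τ + m * A * e) * (4 * τ ^ 2 + m * B * e) * s
        + (A * b * x * (4 * τ ^ 2 + m * B * e) + -B * b * x * -(τ + m * A * e)) * x
        + A * b * x * (-B * b * x))
      + (-16 * τ ^ 3 * s + C / (2 * α) * (b * x ^ 2 - m * (e * s))) + Λ
      + 2 * F * (N - (2 * τ ^ 2 * s - B / (2 * α) * (b * x ^ 2 - m * (e * s)))) := by
  have hb : 0 < b := he.trans_le hbe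
  have hs0 : 0 < s := by linarith
  have hme : m * e ≤ e := mul_le_of_le_one_left he.le (by linarith)
  have hα0 : 0 < α := by linarith
  obtain ⟨f, hfd⟩ : ∃ f, f = b * x ^ 2 - m * (e * s) := ⟨_, rfl⟩
  rw [← hfd]
  have hf1 : 1 ≤ f := by linarith
  have hK0 : 0 < K := by
    by_contra h
    linarith [mul_nonneg (by linarith : 0 ≤ 4 * (1 - 3 * m)) (by linarith : 0 ≤ -K)]
  have hB0 : 0 ≤ B := le_trans (by positivity) hB
  have hC0 : 0 ≤ C := le_trans (by positivity) hC
  obtain ⟨P, hP⟩ : ∃ P, P = b * (b * x ^ 2) - 2 * m * e * (b * x ^ 2) + m ^ 2 * e * (e * s) :=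
    ⟨_, rfl⟩
  obtain ⟨W, hW⟩ : ∃ W, W = b * (b * x ^ 2) := ⟨_, rfl⟩
  have hmS : m * (e * s) ≤ b * x ^ 2 := by linarith
  have hX0 : 0 ≤ b * x ^ 2 := by positivity
  have heX : e * (b * x ^ 2) ≤ W := hW ▸ mul_le_mul_of_nonneg_right hbe hX0
  have hmS2 : m ^ 2 * e * (e * s) ≤ m * e * (b * x ^ 2) := by
    linarith [mul_le_mul_of_nonneg_left hmS (by positivity : 0 ≤ m * e)]
  have hPW : P ≤ W := by linarith [mul_nonneg (mul_nonneg hm.le he.le) hX0]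
  have hNP : N = A ^ 2 * P - 2 * A * τ * f + τ ^ 2 * s := by rw [hN, hP, hfd]; ring
  have heW : e ^ 2 ≤ W := by
    have h1 : 1 ≤ x ^ 2 := one_le_pow₀ hx
    calc e ^ 2 ≤ b ^ 2 := by gcongr
      _ ≤ b ^ 2 * x ^ 2 := le_mul_of_one_le_right (sq_nonneg b) h1
      _ = W := by rw [hW]; ring
  have hW0 : 0 ≤ W := hW ▸ by positivity
  -- the cubic part
  have hcub : 0 ≤ (2 * α - 1) * b * (b - m * e) ^ 2 * x ^ 2 - 2 * m * e * P := by
    have h1 : 0 ≤ (b - m * e) * ((2 * α - 1) * (b - m * e) - 2 * m * e) := by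
      refine mul_nonneg (by linarith) ?_
      have : (1 - m) * e ≤ b - m * e := by linarith
      linarith [mul_le_mul_of_nonneg_left this (by linarith : 0 ≤ 2 * α - 1),
        mul_le_mul_of_nonneg_right hαm he.le]
    have h2 := mul_nonneg hX0 h1
    have h3 := mul_le_mul_of_nonneg_left hmS2 (by positivity : 0 ≤ 2 * m * e)
    rw [hP]
    linarith
  -- mixed terms
  have hmix : 4 * (1 - 3 * m) * W ≤ 4 * P - 2 * m / α * e * f := by
    have h1 : 2 * m / α ≤ 4 * m := by
      rw [div_le_iff₀ hα0]; linarith [mul_le_mul_of_nonneg_left hα hm.le]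
    have h2 := mul_le_mul_of_nonneg_right h1 (by positivity : 0 ≤ e * f)
    have h3 : 0 ≤ m ^ 2 * e * (e * s) := by positivity
    have h4 := mul_le_mul_of_nonneg_left heX hm.le
    have h5 : 2 * m / α * e * f = 2 * m / α * (e * f) := by ring
    rw [h5]
    have h6 : 4 * m * (e * f) = 4 * m * (e * (b * x ^ 2)) - 4 * (m * e * (m * (e * s))) := by
      rw [hfd]; ring
    rw [hP, ← hW]
    linarith
  have hmixA : 13 * (A ^ 2 * W) ≤ A * B * (4 * P - 2 * m / α * e * f) := by
    have h1 : 13 * (A ^ 2 * W) ≤ 4 * (1 - 3 * m) * K * (A ^ 2 * W) :=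
      mul_le_mul_of_nonneg_right hK (by positivity)
    have h2 : A * (K * A) * (4 * (1 - 3 * m) * W) ≤ A * B * (4 * (1 - 3 * m) * W) := by
      have : 0 ≤ 4 * (1 - 3 * m) * W := mul_nonneg (by linarith) hW0
      gcongr
    have h3 := mul_le_mul_of_nonneg_left hmix (mul_nonneg hA hB0)
    linarith
  have hquad : 8 * τ * (A ^ 2 * ((2 * α - 1) * (b * x ^ 2) * (b - m * e) - 2 * m * e * f))
      ≤ 2 * (A ^ 2 * W) := by
    have h1 : (2 * α - 1) * (b * x ^ 2) * (b - m * e) - 2 * m * e * f ≤ W := by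
      have h2 : 0 ≤ m * e * f := by positivity
      have h3 : 0 ≤ b - m * e := by linarith
      have h4 : (2 * α - 1) * ((b * x ^ 2) * (b - m * e)) ≤ 1 * ((b * x ^ 2) * (b - m * e)) :=
        mul_le_mul_of_nonneg_right (by linarith) (by positivity)
      have h5 : 0 ≤ m * e * (b * x ^ 2) := by positivity
      rw [hW]
      linarith
    have h2 := mul_le_mul_of_nonneg_left h1 (sq_nonneg A)
    have h3 : 0 ≤ A ^ 2 * W := by positivity
    have h4 := mul_le_mul_of_nonneg_left h2 (by linarith : 0 ≤ 8 * τ)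
    have h5 := mul_le_mul_of_nonneg_right (by linarith : 8 * τ ≤ 2) h3
    linarith
  have hPA := mul_le_mul_of_nonneg_left hPW (sq_nonneg A)
  have hAW : 0 ≤ A ^ 2 * W := by positivity
  have hPτ : 8 * τ * (A ^ 2 * P) ≤ 2 * (A ^ 2 * W) := by
    have := mul_le_mul_of_nonneg_left hPA (by linarith : 0 ≤ 8 * τ)
    have h5 := mul_le_mul_of_nonneg_right (by linarith : 8 * τ ≤ 2) hAW
    linarith
  have hF2 : F ^ 2 ≤ 5 + A ^ 2 * W := by
    have h1 : F ^ 2 ≤ 2 * (2 * τ + 1) ^ 2 + 8 * m ^ 2 * (A ^ 2 * e ^ 2) := by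
      rw [hF]; linarith [sq_nonneg (2 * τ + 1 - 2 * m * A * e)]
    have h2 := mul_le_mul_of_nonneg_left heW (sq_nonneg A)
    have h3 : 8 * m ^ 2 ≤ 1 := by linarith [pow_le_pow_left₀ hm.le (by linarith : m ≤ 1 / 3) 2]
    have h4 : 8 * m ^ 2 * (A ^ 2 * e ^ 2) ≤ 1 * (A ^ 2 * e ^ 2) :=
      mul_le_mul_of_nonneg_right h3 (by positivity)
    have h5 : (2 * τ + 1) ^ 2 ≤ 9 / 4 := by
      linarith [pow_le_pow_left₀ (by linarith : 0 ≤ 2 * τ + 1) (by linarith : 2 * τ + 1 ≤ 3 / 2) 2]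
    linarith
  have hft : 0 ≤ C / (2 * α) * f - (4 * τ + 2 * τ / α + 1 / α) * B * f + Λ := by
    have h1 : C / 2 ≤ C / (2 * α) := div_le_div_of_nonneg_left hC0 (by linarith) (by linarith)
    have h2 : 1 / α ≤ 2 := by rw [div_le_iff₀ hα0]; linarith
    have h3 : 2 * τ / α ≤ 1 := by rw [div_le_iff₀ hα0]; linarith
    have h4 : (4 * τ + 2 * τ / α + 1 / α) * B ≤ 4 * B :=
      mul_le_mul_of_nonneg_right (by linarith) hB0
    have h5 : L * A ≤ C / (2 * α) - (4 * τ + 2 * τ / α + 1 / α) * B := by linarith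
    have h6 := mul_le_mul_of_nonneg_right h5 (by linarith : 0 ≤ f)
    have h7 : 0 ≤ L * A * (f - 1) := mul_nonneg (by positivity) (by linarith)
    linarith
  have hτs : 6 ≤ τ ^ 2 * s := by
    have : (1 / 12 : ℝ) ^ 2 ≤ τ ^ 2 := by gcongr
    linarith [mul_le_mul_of_nonneg_right this hs0.le]
  have hd : 0 ≤ 8 * A * m * (1 - α) * (e / s) * (-(τ + m * A * e) * s + A * b * x * x) ^ 2 := by
    have : 0 ≤ 1 - α := by linarith
    positivity
  have hcubA := mul_nonneg (mul_nonneg hA (by norm_num : (0 : ℝ) ≤ 4)) (mul_nonneg (sq_nonneg A) hcub)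
  have hAτ : 0 ≤ A * τ * f := by have : 0 ≤ τ := by linarith
                                 positivity
  have hlin : 0 ≤ 4 * A * ((2 * α - 1) * (b * x ^ 2) * τ ^ 2) := by
    have : 0 ≤ 2 * α - 1 := by linarith
    positivity
  have key : 4 * (-(τ + m * A * e) * N + 2 * A * m * (1 - α) * (e / s) *
          (-(τ + m * A * e) * s + A * b * x * x) ^ 2
        + A * (2 * α - 1) * b * (-(τ + m * A * e) * x + A * b * x) ^ 2)
      - 4 * (-(τ + m * A * e) * (4 * τ ^ 2 + m * B * e) * s
        + (A * b * x * (4 * τ ^ 2 + m * B * e) + -B * b * x * -(τ + m * A * e)) * x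
        + A * b * x * (-B * b * x))
      + (-16 * τ ^ 3 * s + C / (2 * α) * f) + Λ
      + 2 * F * (N - (2 * τ ^ 2 * s - B / (2 * α) * f)) =
      A * 4 * (A ^ 2 * ((2 * α - 1) * b * (b - m * e) ^ 2 * x ^ 2 - 2 * m * e * P))
      + 8 * A * m * (1 - α) * (e / s) * (-(τ + m * A * e) * s + A * b * x * x) ^ 2
      + 4 * A * ((2 * α - 1) * (b * x ^ 2) * τ ^ 2)
      - 8 * τ * (A ^ 2 * ((2 * α - 1) * (b * x ^ 2) * (b - m * e) - 2 * m * e * f))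
      - 8 * τ * (A ^ 2 * P) + A * B * (4 * P - 2 * m / α * e * f)
      + (C / (2 * α) * f - (4 * τ + 2 * τ / α + 1 / α) * B * f + Λ)
      - 2 * (A ^ 2 * P) + 4 * (A * τ * f) + 2 * (τ ^ 2 * s) := by
    rw [hNP, hF, hP, hfd]
    ring
  rw [key, hNP]
  linarith

end Algebra

section ConeWeight

theorem hasDerivAt_inv_mul {t : ℝ} (c : ℝ) (ht : t ∈ Ioi (0 : ℝ)) :
    HasDerivAt (fun t : ℝ => c * t⁻¹) (-c * (t ^ 2)⁻¹) t :=
  ((hasDerivAt_inv (ne_of_gt ht)).const_mul c).congr_deriv (by ring)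

theorem hasDerivAt_inv_sq_mul {t : ℝ} (c : ℝ) (ht : t ∈ Ioi (0 : ℝ)) :
    HasDerivAt (fun t : ℝ => c * (t ^ 2)⁻¹) (-2 * c * (t ^ 3)⁻¹) t := by
  have h0 : t ≠ 0 := ne_of_gt ht
  have := ((hasDerivAt_pow 2 t).fun_inv (by positivity)).const_mul c
  exact this.congr_deriv (by simp; field_simp)

theorem hasDerivAt_mul_rpow {y : ℝ} (c β : ℝ) (hy : y ∈ Ioi (0 : ℝ)) :
    HasDerivAt (fun y : ℝ => c * y ^ β) (c * β * y ^ (β - 1)) y :=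
  ((Real.hasDerivAt_rpow_const (Or.inl (ne_of_gt hy))).const_mul c).congr_deriv (by ring)

/-- The weight of the Carleman estimate in the cone. -/
noncomputable def coneWeight (α m K a : ℝ) : SepData (Ioi 0) (Ioi 0) (Ioi 0) where
  k₀ _ := 0
  k₀' _ := 0
  k₀'' _ := 0
  k₁ t := -(1 / 8) * t⁻¹
  k₁' t := -(-(1 / 8)) * (t ^ 2)⁻¹
  k₁'' t := -2 * -(-(1 / 8)) * (t ^ 3)⁻¹
  k₂ t := a * prof K t
  k₂' t := a * prof₁ K t
  k₂'' t := a * prof₂ K t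
  g y := 1 * y ^ (2 * α)
  g' y := 1 * (2 * α) * y ^ (2 * α - 1)
  g'' y := 1 * (2 * α) * (2 * α - 1) * y ^ (2 * α - 1 - 1)
  h s := -m * s ^ α
  h' s := -m * α * s ^ (α - 1)
  h'' s := -m * α * (α - 1) * s ^ (α - 1 - 1)
  hk₀ _ _ := hasDerivAt_const _ _
  hk₀' _ _ := hasDerivAt_const _ _
  hk₁ _ ht := hasDerivAt_inv_mul _ ht
  hk₁' _ ht := hasDerivAt_inv_sq_mul _ ht
  hk₂ _ _ := (hasDerivAt_prof K _).const_mul a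
  hk₂' _ _ := (hasDerivAt_prof₁ K _).const_mul a
  hg _ hy := hasDerivAt_mul_rpow _ _ hy
  hg' _ hy := hasDerivAt_mul_rpow _ _ hy
  hh _ hs := hasDerivAt_mul_rpow _ _ hs
  hh' _ hs := hasDerivAt_mul_rpow _ _ hs

/-- The radial coefficient of `coneAux`. -/
noncomputable def auxCoeff (n : ℕ) (α m : ℝ) : ℝ :=
  -4 * α * m - 4 * m * α * (1 - α) + 2 * n * m * α

/-- The zeroth order multiplier of the Carleman estimate in the cone. -/
noncomputable def coneAux (n : ℕ) (α m K a : ℝ) : SepData (Ioi 0) (Ioi 0) (Ioi 0) where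
  k₀ t := ((n - 2) / 4) * t⁻¹ - 1
  k₀' t := -((n - 2) / 4) * (t ^ 2)⁻¹
  k₀'' t := -2 * -((n - 2) / 4) * (t ^ 3)⁻¹
  k₁ _ := 0
  k₁' _ := 0
  k₁'' _ := 0
  k₂ t := a * prof K t
  k₂' t := a * prof₁ K t
  k₂'' t := a * prof₂ K t
  g y := -(2 * α * (2 * α - 1)) * y ^ (2 * α - 1 - 1)
  g' y := -(2 * α * (2 * α - 1)) * (2 * α - 1 - 1) * y ^ (2 * α - 1 - 1 - 1)
  g'' y := -(2 * α * (2 * α - 1)) * (2 * α - 1 - 1) * (2 * α - 1 - 1 - 1)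
    * y ^ (2 * α - 1 - 1 - 1 - 1)
  h s := auxCoeff n α m * s ^ (α - 1)
  h' s := auxCoeff n α m * (α - 1) * s ^ (α - 1 - 1)
  h'' s := auxCoeff n α m * (α - 1) * (α - 1 - 1) * s ^ (α - 1 - 1 - 1)
  hk₀ _ ht := (hasDerivAt_inv_mul _ ht).sub_const 1
  hk₀' _ ht := hasDerivAt_inv_sq_mul _ ht
  hk₁ _ _ := hasDerivAt_const _ _
  hk₁' _ _ := hasDerivAt_const _ _
  hk₂ _ _ := (hasDerivAt_prof K _).const_mul a
  hk₂' _ _ := (hasDerivAt_prof₁ K _).const_mul a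
  hg _ hy := hasDerivAt_mul_rpow _ _ hy
  hg' _ hy := hasDerivAt_mul_rpow _ _ hy
  hh _ hs := hasDerivAt_mul_rpow _ _ hs
  hh' _ hs := hasDerivAt_mul_rpow _ _ hs

variable {n : ℕ} [NeZero n]

/-- The region where the profiles of the cone weight are smooth. -/
def coneRegion (n : ℕ) [NeZero n] : Set (EuclideanSpace ℝ (Fin n) × ℝ) :=
  sepDomain n (Ioi 0) (Ioi 0) (Ioi 0)

theorem isOpen_coneRegion : IsOpen (coneRegion n) := isOpen_sepDomain isOpen_Ioi isOpen_Ioi isOpen_Ioi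

theorem contDiffOn_mul_rpow (c β : ℝ) : ContDiffOn ℝ ∞ (fun y : ℝ => c * y ^ β) (Ioi 0) :=
  contDiffOn_const.mul (contDiffOn_id.rpow_const_of_ne fun _ hx => ne_of_gt hx)

theorem contDiffOn_mul_inv (c : ℝ) : ContDiffOn ℝ ∞ (fun y : ℝ => c * y⁻¹) (Ioi 0) :=
  contDiffOn_const.mul (contDiffOn_id.inv fun _ hx => ne_of_gt hx)

theorem contDiffOn_coneWeight (α m K a : ℝ) :
    ContDiffOn ℝ ∞ (coneWeight α m K a).fn (coneRegion n) :=
  contDiffOn_sep contDiffOn_const (contDiffOn_mul_inv _)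
    (contDiff_const.mul (contDiff_prof K)).contDiffOn (contDiffOn_mul_rpow _ _)
    (contDiffOn_mul_rpow _ _)

theorem contDiffOn_coneAux (N : ℕ) (α m K a : ℝ) :
    ContDiffOn ℝ ∞ (coneAux N α m K a).fn (coneRegion n) :=
  contDiffOn_sep ((contDiffOn_mul_inv _).sub contDiffOn_const) contDiffOn_const
    (contDiff_const.mul (contDiff_prof K)).contDiffOn (contDiffOn_mul_rpow _ _)
    (contDiffOn_mul_rpow _ _)

/-- The homogeneous function used in the cone weight. -/
noncomputable def gauge' (α m : ℝ) (p : EuclideanSpace ℝ (Fin n) × ℝ) : ℝ :=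
  p.1 0 ^ (2 * α) - m * nsq p ^ α

theorem coneWeight_fn (α m K a : ℝ) (p : EuclideanSpace ℝ (Fin n) × ℝ) :
    (coneWeight α m K a).fn p = -(1 / 8) * (p.2)⁻¹ * nsq p + a * prof K p.2 * gauge' α m p := by
  simp only [SepData.fn, coneWeight, sep, gauge']; ring

variable {α m K a : ℝ} {p : EuclideanSpace ℝ (Fin n) × ℝ}

theorem coneAux_add_lapl (hp : p ∈ coneRegion n) :
    (coneAux n α m K a).fn p + lapl ex (coneWeight α m K a).fn p =
      -2 * (1 / 4 * (p.2)⁻¹) - 1 - 2 * m * (2 * α * (a * prof K p.2)) * nsq p ^ (α - 1) := by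
  have hs : (0 : ℝ) < nsq p := hp.2.2
  rw [SepData.lapl_fn isOpen_Ioi isOpen_Ioi isOpen_Ioi hp]
  simp only [SepData.fn, SepData.rad, coneWeight, coneAux, sep, auxCoeff]
  have : nsq p ^ (α - 1 - 1) = nsq p ^ (α - 1) / nsq p := Real.rpow_sub_one hs.ne' _
  rw [this]
  field_simp
  ring

theorem coneWeight_hess (hα : 1 / 2 ≤ α) (hα1 : α ≤ 1) (hm : 0 ≤ m) (ha : 0 ≤ a)
    (hp : p ∈ coneRegion n) (ξ : Fin n → ℝ) :
    1 * ∑ i, ξ i ^ 2 ≤ 4 * hess ex (coneWeight α m K a).fn p ξ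
      - 2 * ((coneAux n α m K a).fn p + lapl ex (coneWeight α m K a).fn p) * ∑ i, ξ i ^ 2 := by
  have hs : (0 : ℝ) < nsq p := hp.2.2
  have hx : (0 : ℝ) < p.1 0 := hp.2.1
  rw [coneAux_add_lapl hp, SepData.hess_fn isOpen_Ioi isOpen_Ioi isOpen_Ioi hp]
  have h1 : 0 ≤ 4 * (4 * (a * prof K p.2) * (m * α * (1 - α) * nsq p ^ (α - 1 - 1)) *
      (∑ i, p.1 i * ξ i) ^ 2) := by
    have := prof_nonneg K p.2
    have : 0 ≤ 1 - α := by linarith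
    positivity
  have h2 : 0 ≤ 4 * (a * prof K p.2 * (2 * α * (2 * α - 1) * p.1 0 ^ (2 * α - 1 - 1)) * ξ 0 ^ 2) := by
    have := prof_nonneg K p.2
    have : 0 ≤ 2 * α - 1 := by linarith
    positivity
  have h3 : 0 ≤ ∑ i, ξ i ^ 2 := Finset.sum_nonneg fun i _ => sq_nonneg _
  simp only [SepData.rad, coneWeight]
  nlinarith

/-- A bound for the Laplacian of the zeroth order multiplier. -/
noncomputable def auxBound (n : ℕ) (α m : ℝ) : ℝ :=
  |2 * n * (auxCoeff n α m * (α - 1))| + |4 * (auxCoeff n α m * (α - 1) * (α - 1 - 1))|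
    + |2 * α * (2 * α - 1) * (2 * α - 1 - 1) * (2 * α - 1 - 1 - 1)|

theorem auxBound_nonneg (n : ℕ) (α m : ℝ) : 0 ≤ auxBound n α m := by
  unfold auxBound; positivity

theorem sq_coord_le_nsq (p : EuclideanSpace ℝ (Fin n) × ℝ) : p.1 0 ^ 2 ≤ nsq p := by
  rw [nsq_eq]
  exact Finset.single_le_sum (f := fun i => p.1 i ^ 2) (fun i _ => sq_nonneg _) (Finset.mem_univ 0)

theorem lapl_coneAux_ge (hα : 1 / 2 ≤ α) (hα1 : α ≤ 1) (ha : 0 ≤ a) (hp : p ∈ coneRegion n)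
    (hx : 1 ≤ p.1 0) :
    -(auxBound n α m * (2 * α * (a * prof K p.2))) ≤ lapl ex (coneAux n α m K a).fn p := by
  have hs : 1 ≤ nsq p := le_trans (by nlinarith) (sq_coord_le_nsq p)
  have hs0 : 0 < nsq p := by linarith
  rw [SepData.lapl_fn isOpen_Ioi isOpen_Ioi isOpen_Ioi hp]
  simp only [SepData.rad, coneAux]
  have e1 : nsq p ^ (α - 1 - 1) ≤ 1 := Real.rpow_le_one_of_one_le_of_nonpos hs (by linarith)
  have e2 : p.1 0 ^ (2 * α - 1 - 1 - 1 - 1) ≤ 1 :=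
    Real.rpow_le_one_of_one_le_of_nonpos hx (by linarith)
  have e0 : 0 ≤ nsq p ^ (α - 1 - 1) := by positivity
  have e3 : 0 ≤ p.1 0 ^ (2 * α - 1 - 1 - 1 - 1) := by positivity
  have e4 : nsq p ^ (α - 1 - 1 - 1) * nsq p = nsq p ^ (α - 1 - 1) := by
    rw [Real.rpow_sub_one hs0.ne']; field_simp
  have hap : 0 ≤ a * prof K p.2 := mul_nonneg ha (prof_nonneg _ _)
  have key : ∀ {c y : ℝ}, 0 ≤ y → y ≤ 1 → -|c| ≤ c * y := by
    intro c y h0 h1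
    have := neg_abs_le (c * y)
    rw [abs_mul, abs_of_nonneg h0] at this
    nlinarith [abs_nonneg c]
  have k1 := key (c := 2 * n * (auxCoeff n α m * (α - 1))) e0 e1
  have k2 := key (c := 4 * (auxCoeff n α m * (α - 1) * (α - 1 - 1))) e0 e1
  have k3 := key (c := -(2 * α * (2 * α - 1) * (2 * α - 1 - 1) * (2 * α - 1 - 1 - 1))) e3 e2
  rw [abs_neg] at k3
  have k4 : -auxBound n α m ≤ 2 * n * (auxCoeff n α m * (α - 1)) * nsq p ^ (α - 1 - 1) +
      4 * (auxCoeff n α m * (α - 1) * (α - 1 - 1)) * (nsq p ^ (α - 1 - 1)) +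
      -(2 * α * (2 * α - 1) * (2 * α - 1 - 1) * (2 * α - 1 - 1 - 1)) *
        p.1 0 ^ (2 * α - 1 - 1 - 1 - 1) := by
    unfold auxBound; linarith
  have k5 := mul_le_mul_of_nonneg_left k4 hap
  rw [← e4] at k5
  have k6 : a * prof K p.2 * auxBound n α m ≤ 2 * α * (a * prof K p.2 * auxBound n α m) :=
    le_mul_of_one_le_left (mul_nonneg hap (auxBound_nonneg _ _ _)) (by linarith)
  rw [e4] at k5
  have e5 : 4 * (a * prof K p.2) * (auxCoeff n α m * (α - 1) * (α - 1 - 1) * nsq p ^ (α - 1 - 1 - 1))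
      * nsq p = 4 * (a * prof K p.2) * (auxCoeff n α m * (α - 1) * (α - 1 - 1) *
        nsq p ^ (α - 1 - 1)) := by rw [← e4]; ring
  rw [e5]
  linarith

theorem coneWeight_zeroTerm (hα : 1 / 2 ≤ α) (hα1 : α ≤ 1) (hm : 0 < m) (hm3 : 3 * m < 1)
    (hαm : 2 * m ≤ (2 * α - 1) * (1 - m)) (ha : 0 ≤ a) (hK : 10 + 2 * auxBound n α m ≤ K)
    (hKm : 13 ≤ 4 * (1 - 3 * m) * K) (ht : 1 ≤ p.2) (ht3 : p.2 ≤ 3) (hx : 1 ≤ p.1 0)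
    (hs : 1000 ≤ nsq p) (hf : 1 ≤ gauge' α m p) :
    1 + ((coneAux n α m K a).fn p + lapl ex (coneWeight α m K a).fn p) ^ 2
        + 1 * gdot ex (coneWeight α m K a).fn (coneWeight α m K a).fn p ≤
      zeroTerm ex et (coneWeight α m K a).fn (coneAux n α m K a).fn p := by
  have ht0 : 0 < p.2 := by linarith
  have hs0 : 0 < nsq p := by linarith
  have hx0 : 0 < p.1 0 := by linarith
  have hp : p ∈ coneRegion n := ⟨ht0, hx0, hs0⟩
  have hL := auxBound_nonneg n α m
  have hap : 0 ≤ a * prof K p.2 := mul_nonneg ha (prof_nonneg _ _)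
  have hα0 : 0 < α := by linarith
  have eb1 : p.1 0 ^ (2 * α - 1) = p.1 0 ^ (2 * α - 2) * p.1 0 := by
    rw [← Real.rpow_add_one hx0.ne']; congr 1; ring
  have eb0 : p.1 0 ^ (2 * α) = p.1 0 ^ (2 * α - 2) * p.1 0 ^ 2 := by
    rw [← Real.rpow_add_natCast hx0.ne']; congr 1; push_cast; ring
  have eb2 : p.1 0 ^ (2 * α - 1 - 1) = p.1 0 ^ (2 * α - 2) := by congr 1; ring
  have ee0 : nsq p ^ α = nsq p ^ (α - 1) * nsq p := by
    rw [← Real.rpow_add_one hs0.ne']; congr 1; ring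
  have ee2 : nsq p ^ (α - 1 - 1) = nsq p ^ (α - 1) / nsq p := Real.rpow_sub_one hs0.ne' _
  have hbe : nsq p ^ (α - 1) ≤ p.1 0 ^ (2 * α - 2) := by
    have : p.1 0 ^ (2 * α - 2) = (p.1 0 ^ 2) ^ (α - 1) := by
      rw [← Real.rpow_natCast, ← Real.rpow_mul hx0.le]; congr 1; push_cast; ring
    rw [this]
    exact Real.rpow_le_rpow_of_nonpos (by positivity) (sq_coord_le_nsq p) (by linarith)
  have h := carleman_weight_le (α := α) (m := m) (τ := 1 / 4 * (p.2)⁻¹)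
    (A := 2 * α * (a * prof K p.2)) (B := 2 * α * (a * -prof₁ K p.2))
    (C := 2 * α * (a * prof₂ K p.2)) (K := K) (L := auxBound n α m)
    (Λ := lapl ex (coneAux n α m K a).fn p) (b := p.1 0 ^ (2 * α - 2)) (e := nsq p ^ (α - 1))
    (x := p.1 0) (s := nsq p) hα hα1 hm hm3 hαm
    (by
      have : (3 : ℝ)⁻¹ ≤ (p.2)⁻¹ := inv_anti₀ ht0 ht3
      linarith)
    (by
      have : (p.2)⁻¹ ≤ (1 : ℝ)⁻¹ := inv_anti₀ one_pos ht
      linarith) (by positivity)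
    (by
      have := mul_le_mul_of_nonneg_left (mul_prof_le (K := K) (by linarith) ht)
        (by positivity : 0 ≤ 2 * α * a)
      linarith) hL hKm
    (by
      have := mul_le_mul_of_nonneg_left (le_prof₂ hL hK ht) (by positivity : 0 ≤ 2 * α * a)
      linarith) (lapl_coneAux_ge hα hα1 ha hp hx) (by positivity) hbe hx hs
    (by
      rw [gauge', eb0, ee0] at hf
      linarith) (coneAux_add_lapl hp)
    (N := gdot ex (coneWeight α m K a).fn (coneWeight α m K a).fn p)
    (by
      rw [SepData.gdot_fn hp]
      simp only [SepData.rad, SepData.axial, coneWeight, eb1]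
      ring)
  rw [one_mul]
  refine h.trans (le_of_eq ?_)
  rw [SepData.zeroTerm_fn isOpen_Ioi isOpen_Ioi isOpen_Ioi hp, coneAux_add_lapl hp]
  generalize lapl ex (coneAux n α m K a).fn p = Λ
  generalize gdot ex (coneWeight α m K a).fn (coneWeight α m K a).fn p = N
  simp only [SepData.rad, SepData.axial, coneWeight, sep, eb0, eb1, eb2, ee0, ee2]
  have hd1 : 2 * α * (a * prof₂ K p.2) / (2 * α) = a * prof₂ K p.2 := by field_simp
  have hd2 : 2 * α * (a * -prof₁ K p.2) / (2 * α) = a * -prof₁ K p.2 := by field_simp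
  rw [hd1, hd2, ← inv_pow, ← inv_pow, div_eq_mul_inv (nsq p ^ (α - 1))]
  generalize (p.2)⁻¹ = r
  generalize (nsq p)⁻¹ = si
  ring

end ConeWeight

section PointwiseCalculus

variable {V : Type*} [NormedAddCommGroup V] [NormedSpace ℝ V] {ι : Type*} [Fintype ι]
  {e : ι → V} {τ : V} {f g : V → ℝ} {p : V}

theorem ContDiffAt.eventually_differentiableAt (hf : ContDiffAt ℝ ∞ f p) :
    ∀ᶠ x in 𝓝 p, DifferentiableAt ℝ f x := by
  have h1 : ContDiffAt ℝ 1 f p := hf.of_le (by norm_cast)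
  exact (h1.eventually (by simp)).mono fun x hx => hx.differentiableAt (by simp)

theorem ContDiffAt.dir (hf : ContDiffAt ℝ ∞ f p) (w : V) : ContDiffAt ℝ ∞ (dir w f) p := by
  have h : ContDiffAt ℝ ∞ (fderiv ℝ f) p := hf.fderiv_right (by norm_cast)
  exact h.clm_apply contDiffAt_const

theorem lapl_mul (hf : ContDiffAt ℝ ∞ f p) (hg : ContDiffAt ℝ ∞ g p) :
    lapl e (fun p => f p * g p) p = f p * lapl e g p + g p * lapl e f p + 2 * gdot e f g p := by
  simp only [lapl, gdot, Finset.mul_sum, ← Finset.sum_add_distrib]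
  refine Finset.sum_congr rfl fun i _ => ?_
  have : dir (e i) (fun p => f p * g p) =ᶠ[𝓝 p]
      fun p => dir (e i) f p * g p + f p * dir (e i) g p := by
    filter_upwards [hf.eventually_differentiableAt, hg.eventually_differentiableAt] with x hx hy
    exact dir_mul' hx hy _
  have d {k : V → ℝ} (hk : ContDiffAt ℝ ∞ k p) : DifferentiableAt ℝ k p :=
    hk.differentiableAt (by simp)
  rw [(dir_congr this _).self_of_nhds, dir_add' (d ((hf.dir _).mul hg)) (d (hf.mul (hg.dir _))),
    dir_mul' (d (hf.dir _)) (d hg), dir_mul' (d hf) (d (hg.dir _))]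
  ring

theorem lapl_comp {k k' k'' : ℝ → ℝ} (hk : ∀ y, HasDerivAt k (k' y) y)
    (hk' : ∀ y, HasDerivAt k' (k'' y) y) (hf : ContDiffAt ℝ ∞ f p) :
    lapl e (fun p => k (f p)) p = k'' (f p) * gdot e f f p + k' (f p) * lapl e f p := by
  simp only [lapl, gdot, Finset.mul_sum, ← Finset.sum_add_distrib]
  refine Finset.sum_congr rfl fun i _ => ?_
  have : dir (e i) (fun p => k (f p)) =ᶠ[𝓝 p] fun p => k' (f p) * dir (e i) f p := by
    filter_upwards [hf.eventually_differentiableAt] with x hx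
    exact dir_comp (hk _) hx _
  have d {k : V → ℝ} (hk : ContDiffAt ℝ ∞ k p) : DifferentiableAt ℝ k p :=
    hk.differentiableAt (by simp)
  have dk : DifferentiableAt ℝ (fun p => k' (f p)) p :=
    (hk' _).differentiableAt.comp p (d hf)
  rw [(dir_congr this _).self_of_nhds, dir_mul' dk (d (hf.dir _)), dir_comp (hk' _) (d hf)]
  ring

theorem gdot_comp_self {k : ℝ → ℝ} {d : ℝ} (hk : HasDerivAt k d (f p))
    (hf : DifferentiableAt ℝ f p) :
    gdot e (fun p => k (f p)) (fun p => k (f p)) p = d ^ 2 * gdot e f f p := by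
  simp only [gdot, Finset.mul_sum]
  refine Finset.sum_congr rfl fun i _ => ?_
  rw [dir_comp hk hf]
  ring

theorem gdot_self_nonneg : 0 ≤ gdot e f f p := Finset.sum_nonneg fun _ _ => mul_self_nonneg _

theorem two_mul_abs_gdot_le : 2 * |gdot e f g p| ≤ gdot e f f p + gdot e g g p := by
  have h : ∀ s : ℝ, s ^ 2 = 1 → 2 * (s * gdot e f g p) ≤ gdot e f f p + gdot e g g p := by
    intro s hs
    simp only [gdot, Finset.mul_sum, ← Finset.sum_add_distrib]
    refine Finset.sum_le_sum fun i _ => ?_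
    nlinarith [sq_nonneg (dir (e i) f p - s * dir (e i) g p)]
  rcases abs_cases (gdot e f g p) with ⟨h1, -⟩ | ⟨h1, -⟩ <;> rw [h1]
  · linarith [h 1 (by norm_num)]
  · linarith [h (-1) (by norm_num)]

theorem sq_gdot_le : gdot e f g p ^ 2 ≤ gdot e f f p * gdot e g g p := by
  have := Finset.sum_mul_sq_le_sq_mul_sq Finset.univ (fun i => dir (e i) f p)
    (fun i => dir (e i) g p)
  simpa only [gdot, sq] using this

theorem gdot_mul_self_le (hf : DifferentiableAt ℝ f p) (hg : DifferentiableAt ℝ g p) :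
    gdot e (fun p => f p * g p) (fun p => f p * g p) p ≤
      2 * (f p ^ 2 * gdot e g g p) + 2 * (g p ^ 2 * gdot e f f p) := by
  simp only [gdot, Finset.mul_sum, ← Finset.sum_add_distrib]
  refine Finset.sum_le_sum fun i _ => ?_
  rw [dir_mul' hf hg]
  nlinarith [sq_nonneg (dir (e i) f p * g p - f p * dir (e i) g p)]

/-- A smooth function with values in `[-1, 1]` and derivatives controlled by `B` at a point. -/
structure Tame (e : ι → V) (τ : V) (B : ℝ) (g : V → ℝ) (p : V) : Prop where
  contDiffAt : ContDiffAt ℝ ∞ g p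
  abs_le_one : |g p| ≤ 1
  gdot_le : gdot e g g p ≤ B
  lapl_le : |lapl e g p| ≤ B
  dir_le : |dir τ g p| ≤ B

theorem Tame.mul {B : ℝ} (hf : Tame e τ B f p) (hg : Tame e τ B g p) :
    Tame e τ (4 * B) (fun p => f p * g p) p := by
  have hf1 := hf.contDiffAt.differentiableAt (by simp)
  have hg1 := hg.contDiffAt.differentiableAt (by simp)
  have fs : f p ^ 2 ≤ 1 := (sq_le_one_iff_abs_le_one _).2 hf.abs_le_one
  have gs : g p ^ 2 ≤ 1 := (sq_le_one_iff_abs_le_one _).2 hg.abs_le_one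
  have B0 : 0 ≤ B := (abs_nonneg _).trans hf.lapl_le
  have m {x y : ℝ} (hx : |x| ≤ 1) (hy : |y| ≤ B) : |x * y| ≤ B := by
    rw [abs_mul]
    calc |x| * |y| ≤ 1 * B := mul_le_mul hx hy (abs_nonneg _) zero_le_one
      _ = B := one_mul B
  refine ⟨hf.contDiffAt.mul hg.contDiffAt, ?_, ?_, ?_, ?_⟩
  · rw [abs_mul]
    exact mul_le_one₀ hf.abs_le_one (abs_nonneg _) hg.abs_le_one
  · refine (gdot_mul_self_le hf1 hg1).trans ?_
    have h1 := mul_le_mul fs hg.gdot_le gdot_self_nonneg zero_le_one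
    have h2 := mul_le_mul gs hf.gdot_le gdot_self_nonneg zero_le_one
    linarith
  · rw [lapl_mul hf.contDiffAt hg.contDiffAt]
    have h1 := m hf.abs_le_one hg.lapl_le
    have h2 := m hg.abs_le_one hf.lapl_le
    have h3 := two_mul_abs_gdot_le (e := e) (f := f) (g := g) (p := p)
    have h4 := hf.gdot_le
    have h5 := hg.gdot_le
    rw [abs_le] at h1 h2 ⊢
    have h6 := abs_le.1 (le_refl |gdot e f g p|)
    constructor <;> linarith [h6.1, h6.2, h1.1, h2.1, h1.2, h2.2]
  · rw [dir_mul' hf1 hg1]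
    have h1 := m hf.abs_le_one hg.dir_le
    have h2 := m hg.abs_le_one hf.dir_le
    rw [abs_le] at h1 h2 ⊢
    constructor <;> linarith [h1.1, h2.1, h1.2, h2.2]

theorem Tame.mono {B B' : ℝ} (hg : Tame e τ B g p) (h : B ≤ B') : Tame e τ B' g p :=
  ⟨hg.contDiffAt, hg.abs_le_one, hg.gdot_le.trans h, hg.lapl_le.trans h, hg.dir_le.trans h⟩

theorem tame_comp {k k' k'' : ℝ → ℝ} (hks : ContDiff ℝ ∞ k) (hk : ∀ y, HasDerivAt k (k' y) y)
    (hk' : ∀ y, HasDerivAt k' (k'' y) y) {S B : ℝ} (hS : 1 ≤ S) (h0 : ∀ y, |k y| ≤ 1)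
    (h1 : ∀ y, |k' y| ≤ S) (h2 : ∀ y, |k'' y| ≤ S) (hf : ContDiffAt ℝ ∞ f p)
    (hG : gdot e f f p ≤ B) (hL : |lapl e f p| ≤ B) (hD : |dir τ f p| ≤ B) :
    Tame e τ (2 * S ^ 2 * B) (fun p => k (f p)) p := by
  have hf1 := hf.differentiableAt (by simp)
  have B0 : 0 ≤ B := (abs_nonneg _).trans hL
  have hSS : S * B ≤ S ^ 2 * B := mul_le_mul_of_nonneg_right (by nlinarith) B0
  have hg0 := gdot_self_nonneg (e := e) (f := f) (p := p)
  have mm : ∀ {x y : ℝ}, |x| ≤ S → |y| ≤ B → |x * y| ≤ S * B := by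
    intro x y hx hy
    rw [abs_mul]; exact mul_le_mul hx hy (abs_nonneg _) (by linarith)
  refine ⟨hks.contDiffAt.comp p hf, h0 _, ?_, ?_, ?_⟩
  · rw [gdot_comp_self (hk _) hf1]
    have : k' (f p) ^ 2 ≤ S ^ 2 := sq_le_sq' (abs_le.1 (h1 _)).1 (abs_le.1 (h1 _)).2
    have := mul_le_mul this hG hg0 (sq_nonneg S)
    nlinarith [mul_nonneg (sq_nonneg S) B0]
  · rw [lapl_comp hk hk' hf]
    have a := mm (h2 (f p)) (show |gdot e f f p| ≤ B by rwa [abs_of_nonneg hg0])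
    have b := mm (h1 (f p)) hL
    exact (abs_add_le _ _).trans (by linarith)
  · rw [dir_comp (hk _) hf1]
    have b := mm (h1 (f p)) hD
    nlinarith [mul_nonneg (sq_nonneg S) B0]

end PointwiseCalculus

section SmoothStep

theorem bounded_of_zero_outside {g : ℝ → ℝ} (hg : Continuous g) (h0 : ∀ x < 0, g x = 0)
    (h1 : ∀ x > 1, g x = 0) : ∃ C, ∀ x, |g x| ≤ C := by
  have hc : HasCompactSupport g := by
    refine HasCompactSupport.intro (isCompact_Icc (a := (0 : ℝ)) (b := 1)) fun x hx => ?_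
    rw [mem_Icc, not_and_or, not_le, not_le] at hx
    exact hx.elim (h0 x) (h1 x)
  exact hc.exists_bound_of_continuous hg

theorem deriv_eq_zero_outside {g : ℝ → ℝ} {c d : ℝ} (h0 : ∀ x < 0, g x = c) (h1 : ∀ x > 1, g x = d) :
    (∀ x < 0, deriv g x = 0) ∧ ∀ x > 1, deriv g x = 0 := by
  refine ⟨fun x hx => ?_, fun x hx => ?_⟩
  · have : g =ᶠ[𝓝 x] fun _ => c := by
      filter_upwards [Iio_mem_nhds hx] with y hy using h0 y hy
    rw [this.deriv_eq]; simp
  · have : g =ᶠ[𝓝 x] fun _ => d := by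
      filter_upwards [Ioi_mem_nhds hx] with y hy using h1 y hy
    rw [this.deriv_eq]; simp

theorem contDiff_deriv {g : ℝ → ℝ} (hg : ContDiff ℝ ∞ g) : ContDiff ℝ ∞ (deriv g) :=
  (contDiff_infty_iff_deriv.1 hg).2

theorem hasDerivAt_of_contDiff {g : ℝ → ℝ} (hg : ContDiff ℝ ∞ g) (y : ℝ) :
    HasDerivAt g (deriv g y) y := (hg.differentiable (by simp) y).hasDerivAt

theorem contDiff_step : ContDiff ℝ ∞ smoothTransition := smoothTransition.contDiff

theorem abs_step_le (y : ℝ) : |smoothTransition y| ≤ 1 :=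
  abs_le.2 ⟨by linarith [smoothTransition.nonneg y], smoothTransition.le_one y⟩

theorem exists_step_bound : ∃ S, 1 ≤ S ∧ (∀ y, |deriv smoothTransition y| ≤ S) ∧
    ∀ y, |deriv (deriv smoothTransition) y| ≤ S := by
  have a := deriv_eq_zero_outside (g := smoothTransition)
    (fun x hx => smoothTransition.zero_of_nonpos hx.le)
    (fun x hx => smoothTransition.one_of_one_le (le_of_lt hx))
  have b := deriv_eq_zero_outside a.1 a.2
  have h1 := contDiff_deriv contDiff_step
  obtain ⟨C1, hC1⟩ := bounded_of_zero_outside h1.continuous a.1 a.2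
  obtain ⟨C2, hC2⟩ := bounded_of_zero_outside (contDiff_deriv h1).continuous b.1 b.2
  exact ⟨max 1 (max C1 C2), le_max_left _ _,
    fun y => (hC1 y).trans ((le_max_left _ _).trans (le_max_right _ _)),
    fun y => (hC2 y).trans ((le_max_right _ _).trans (le_max_right _ _))⟩

theorem step_deriv_nonneg (y : ℝ) : 0 ≤ deriv smoothTransition y :=
  smoothTransition.monotone.deriv_nonneg

theorem tame_step {V : Type*} [NormedAddCommGroup V] [NormedSpace ℝ V] {ι : Type*} [Fintype ι]
    {e : ι → V} {τ : V} {f : V → ℝ} {p : V} {S B : ℝ} (hS : 1 ≤ S)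
    (h1 : ∀ y, |deriv smoothTransition y| ≤ S) (h2 : ∀ y, |deriv (deriv smoothTransition) y| ≤ S)
    (hf : ContDiffAt ℝ ∞ f p) (hG : gdot e f f p ≤ B) (hL : |lapl e f p| ≤ B)
    (hD : |dir τ f p| ≤ B) : Tame e τ (2 * S ^ 2 * B) (fun p => smoothTransition (f p)) p :=
  tame_comp contDiff_step (hasDerivAt_of_contDiff contDiff_step)
    (hasDerivAt_of_contDiff (contDiff_deriv contDiff_step)) hS abs_step_le h1 h2 hf hG hL hD

end SmoothStep

section ConeCutoff

variable {n : ℕ} [NeZero n] {α m lam R T : ℝ} {p : EuclideanSpace ℝ (Fin n) × ℝ}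

/-- Profiles of `gauge' / lam - 1`. -/
noncomputable def gaugeData (α m lam : ℝ) : SepData univ (Ioi 0) (Ioi 0) where
  k₀ _ := -1
  k₀' _ := 0
  k₀'' _ := 0
  k₁ _ := 0
  k₁' _ := 0
  k₁'' _ := 0
  k₂ _ := lam⁻¹
  k₂' _ := 0
  k₂'' _ := 0
  g y := 1 * y ^ (2 * α)
  g' y := 1 * (2 * α) * y ^ (2 * α - 1)
  g'' y := 1 * (2 * α) * (2 * α - 1) * y ^ (2 * α - 1 - 1)
  h s := -m * s ^ α
  h' s := -m * α * s ^ (α - 1)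
  h'' s := -m * α * (α - 1) * s ^ (α - 1 - 1)
  hk₀ t _ := hasDerivAt_const t _
  hk₀' t _ := hasDerivAt_const t _
  hk₁ t _ := hasDerivAt_const t _
  hk₁' t _ := hasDerivAt_const t _
  hk₂ t _ := hasDerivAt_const t _
  hk₂' t _ := hasDerivAt_const t _
  hg _ hy := hasDerivAt_mul_rpow _ _ hy
  hg' _ hy := hasDerivAt_mul_rpow _ _ hy
  hh _ hs := hasDerivAt_mul_rpow _ _ hs
  hh' _ hs := hasDerivAt_mul_rpow _ _ hs

/-- Profiles of functions which are affine in time, first coordinate and squared norm. -/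
noncomputable def affineData (a b c d : ℝ) : SepData univ univ univ where
  k₀ t := a + b * t
  k₀' _ := b
  k₀'' _ := 0
  k₁ _ := c
  k₁' _ := 0
  k₁'' _ := 0
  k₂ _ := 1
  k₂' _ := 0
  k₂'' _ := 0
  g y := d * y
  g' _ := d
  g'' _ := 0
  h _ := 0
  h' _ := 0
  h'' _ := 0
  hk₀ t _ := ((hasDerivAt_id t).const_mul b).const_add a |>.congr_deriv (mul_one b)
  hk₀' t _ := hasDerivAt_const t _
  hk₁ t _ := hasDerivAt_const t _
  hk₁' t _ := hasDerivAt_const t _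
  hk₂ t _ := hasDerivAt_const t _
  hk₂' t _ := hasDerivAt_const t _
  hg t _ := ((hasDerivAt_id t).const_mul d).congr_deriv (mul_one d)
  hg' t _ := hasDerivAt_const t _
  hh t _ := hasDerivAt_const t _
  hh' t _ := hasDerivAt_const t _

theorem contDiffOn_gaugeData (α m lam : ℝ) :
    ContDiffOn ℝ ∞ (gaugeData α m lam).fn (sepDomain n univ (Ioi 0) (Ioi 0)) :=
  contDiffOn_sep contDiffOn_const contDiffOn_const contDiffOn_const (contDiffOn_mul_rpow _ _)
    (contDiffOn_mul_rpow _ _)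

theorem gaugeData_fn (α m lam : ℝ) (p : EuclideanSpace ℝ (Fin n) × ℝ) :
    (gaugeData α m lam).fn p = gauge' α m p / lam - 1 := by
  simp only [SepData.fn, gaugeData, sep, gauge']; ring

theorem mem_sepDomain_of_pos (hx : 0 < p.1 0) : p ∈ sepDomain n univ (Ioi 0) (Ioi 0) :=
  ⟨mem_univ _, hx, lt_of_lt_of_le (by positivity) (sq_coord_le_nsq p)⟩

theorem isOpen_sepDomain_pos : IsOpen (sepDomain n univ (Ioi 0) (Ioi 0)) :=
  isOpen_sepDomain isOpen_univ isOpen_Ioi isOpen_Ioi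

theorem contDiff_affineData (a b c d : ℝ) : ContDiff ℝ ∞ ((affineData a b c d).fn (n := n)) := by
  have : (affineData a b c d).fn = fun p : EuclideanSpace ℝ (Fin n) × ℝ =>
      a + b * p.2 + c * nsq p + d * p.1 0 := by
    funext p; simp only [SepData.fn, affineData, sep]; ring
  rw [this]; fun_prop

/-- The cutoff function adapted to the gauge of the cone. -/
noncomputable def coneCut (α m lam R T : ℝ) (p : EuclideanSpace ℝ (Fin n) × ℝ) : ℝ :=
  smoothTransition ((affineData (-1) 0 0 1).fn p) * smoothTransition ((gaugeData α m lam).fn p)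
    * (smoothTransition ((affineData 2 0 (-(R ^ 2)⁻¹) 0).fn p)
      * smoothTransition ((affineData T (-1) 0 0).fn p))

theorem tame_gaugeData {S : ℝ} (hS : 1 ≤ S) (h1 : ∀ y, |deriv smoothTransition y| ≤ S)
    (h2 : ∀ y, |deriv (deriv smoothTransition) y| ≤ S) (hα : 1 / 2 ≤ α) (hα1 : α ≤ 1) (hm : 0 ≤ m)
    (hm1 : m ≤ 1) (hl : 1 ≤ lam) (hx : 1 ≤ p.1 0) :
    Tame ex et (2 * S ^ 2 * ((2 * n + 16) * (1 + nsq p)))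
      (fun p => smoothTransition ((gaugeData α m lam).fn p)) p := by
  have hx0 : 0 < p.1 0 := by linarith
  have hp := mem_sepDomain_of_pos hx0
  have hxs := sq_coord_le_nsq p
  have hs : 1 ≤ nsq p := le_trans (by nlinarith) hxs
  have hs0 : 0 < nsq p := by linarith
  have hli : lam⁻¹ ≤ 1 := inv_le_one_of_one_le₀ hl
  have hl0 : 0 ≤ lam⁻¹ := inv_nonneg.2 (by linarith)
  have hn : (0 : ℝ) ≤ n := Nat.cast_nonneg n
  have e1 : nsq p ^ (α - 1) ≤ 1 := Real.rpow_le_one_of_one_le_of_nonpos hs (by linarith)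
  have e2 : nsq p ^ (α - 1 - 1) * nsq p ≤ 1 := by
    rw [Real.rpow_sub_one hs0.ne', div_mul_cancel₀ _ hs0.ne']; exact e1
  have e3 : p.1 0 ^ (2 * α - 1) ≤ p.1 0 := by
    calc p.1 0 ^ (2 * α - 1) ≤ p.1 0 ^ (1 : ℝ) := Real.rpow_le_rpow_of_exponent_le hx (by linarith)
      _ = _ := Real.rpow_one _
  have e4 : p.1 0 ^ (2 * α - 1 - 1) ≤ 1 := Real.rpow_le_one_of_one_le_of_nonpos hx (by linarith)
  have q1 : 0 ≤ nsq p ^ (α - 1) := by positivity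
  have q2 : 0 ≤ nsq p ^ (α - 1 - 1) * nsq p := by positivity
  have q3 : 0 ≤ p.1 0 ^ (2 * α - 1) := by positivity
  have q4 : 0 ≤ p.1 0 ^ (2 * α - 1 - 1) := by positivity
  have hmα : 0 ≤ m * α := by positivity
  have hmα1 : m * α ≤ 1 := mul_le_one₀ hm1 (by linarith) hα1
  obtain ⟨r, hr⟩ : ∃ r, r = lam⁻¹ * (m * α * nsq p ^ (α - 1)) := ⟨_, rfl⟩
  have r0 : 0 ≤ r := by rw [hr]; positivity
  have r1 : r ≤ 1 := by rw [hr]; exact mul_le_one₀ hli (by positivity) (mul_le_one₀ hmα1 q1 e1)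
  obtain ⟨c, hc⟩ : ∃ c, c = lam⁻¹ * (2 * α * p.1 0 ^ (2 * α - 1)) := ⟨_, rfl⟩
  have c0 : 0 ≤ c := by rw [hc]; positivity
  have c1 : c ≤ 2 * p.1 0 := by
    have : 2 * α * p.1 0 ^ (2 * α - 1) ≤ 2 * p.1 0 := mul_le_mul (by linarith) e3 q3 (by norm_num)
    calc c ≤ 1 * (2 * p.1 0) := by rw [hc]; exact mul_le_mul hli this (by positivity) zero_le_one
      _ = _ := one_mul _
  have hr' : (gaugeData α m lam).rad p = -r := by
    rw [hr]; simp only [SepData.rad, gaugeData]; ring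
  have hc' : (gaugeData α m lam).axial p = c := by
    rw [hc]; simp only [SepData.axial, gaugeData]; ring
  refine tame_step hS h1 h2
    ((contDiffOn_gaugeData α m lam).contDiffAt (isOpen_sepDomain_pos.mem_nhds hp)) ?_ ?_ ?_
  · rw [SepData.gdot_fn hp, hr', hc']
    have a1 : r ^ 2 * nsq p ≤ nsq p := by
      have : r ^ 2 ≤ 1 := pow_le_one₀ r0 r1
      nlinarith
    have a2 : 0 ≤ r * c * p.1 0 := by positivity
    have a3 : c ^ 2 ≤ 4 * nsq p := by nlinarith
    nlinarith [mul_nonneg hn hs0.le]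
  · rw [SepData.lapl_fn isOpen_univ isOpen_Ioi isOpen_Ioi hp, hr']
    obtain ⟨u, hu⟩ : ∃ u, u = lam⁻¹ * (m * α * ((1 - α) * (nsq p ^ (α - 1 - 1) * nsq p))) := ⟨_, rfl⟩
    obtain ⟨v, hv⟩ : ∃ v, v = lam⁻¹ * (α * ((2 * α - 1) * p.1 0 ^ (2 * α - 1 - 1))) := ⟨_, rfl⟩
    have h1α : 0 ≤ 1 - α := by linarith
    have h2α : 0 ≤ 2 * α - 1 := by linarith
    have u0 : 0 ≤ u := by rw [hu]; positivity
    have u1 : u ≤ 1 := by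
      rw [hu]
      exact mul_le_one₀ hli (by positivity) (mul_le_one₀ hmα1 (by positivity)
        (mul_le_one₀ (by linarith) (by positivity) e2))
    have v0 : 0 ≤ v := by rw [hv]; positivity
    have v1 : v ≤ 1 := by
      rw [hv]
      exact mul_le_one₀ hli (by positivity) (mul_le_one₀ hα1 (by positivity)
        (mul_le_one₀ (by linarith) (by positivity) e4))
    have : 2 * n * -r + 4 * (gaugeData α m lam).k₂ p.2 * (gaugeData α m lam).h'' (nsq p) * nsq p
        + (gaugeData α m lam).k₂ p.2 * (gaugeData α m lam).g'' (p.1 0)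
        = -(2 * (n * r)) + 4 * u + 2 * v := by
      rw [hu, hv]; simp only [gaugeData]; ring
    rw [this, abs_le]
    have b1 := mul_le_mul_of_nonneg_left r1 hn
    have b2 := mul_nonneg hn r0
    have b3 := mul_nonneg hn hs0.le
    constructor <;> linarith
  · rw [SepData.dir_et_fn hp]
    have : sep (gaugeData α m lam).k₀' (gaugeData α m lam).k₁' (gaugeData α m lam).k₂'
        (gaugeData α m lam).g (gaugeData α m lam).h p = 0 := by simp [sep, gaugeData]
    rw [this, abs_zero]; positivity

theorem tame_affineData {S a b c d : ℝ} (hS : 1 ≤ S) (h1 : ∀ y, |deriv smoothTransition y| ≤ S)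
    (h2 : ∀ y, |deriv (deriv smoothTransition) y| ≤ S) (hb : |b| ≤ 1) (hc : |c| ≤ 1) (hd : |d| ≤ 1)
    (p : EuclideanSpace ℝ (Fin n) × ℝ) :
    Tame ex et (2 * S ^ 2 * ((2 * n + 16) * (1 + nsq p)))
      (fun p => smoothTransition ((affineData a b c d).fn p)) p := by
  have hp : p ∈ sepDomain n univ univ univ := ⟨mem_univ _, mem_univ _, mem_univ _⟩
  have hs0 : 0 ≤ nsq p := nsq_nonneg p
  have hn : (0 : ℝ) ≤ n := Nat.cast_nonneg n
  have hns := mul_nonneg hn hs0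
  have hr' : (affineData a b c d).rad p = c := by simp [SepData.rad, affineData]
  have hc' : (affineData a b c d).axial p = d := by simp [SepData.axial, affineData]
  have hc2 : c ^ 2 ≤ 1 := (sq_le_one_iff_abs_le_one _).2 hc
  have hd2 : d ^ 2 ≤ 1 := (sq_le_one_iff_abs_le_one _).2 hd
  refine tame_step hS h1 h2 (contDiff_affineData a b c d).contDiffAt ?_ ?_ ?_
  · rw [SepData.gdot_fn hp, hr', hc']
    have e : 4 * c * d * p.1 0 ≤ 2 * (c ^ 2 * nsq p) + 2 * d ^ 2 + 0 := by
      have := mul_le_mul_of_nonneg_left (sq_coord_le_nsq p) (sq_nonneg c)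
      nlinarith [sq_nonneg (c * p.1 0 - d)]
    have := mul_le_mul_of_nonneg_right hc2 hs0
    nlinarith
  · rw [SepData.lapl_fn isOpen_univ isOpen_univ isOpen_univ hp, hr']
    simp only [affineData, mul_zero, zero_mul, add_zero]
    rw [abs_mul, abs_of_nonneg (show (0 : ℝ) ≤ 2 * n by positivity)]
    have := mul_le_mul_of_nonneg_left hc hn
    nlinarith
  · rw [SepData.dir_et_fn hp]
    have : sep (affineData a b c d).k₀' (affineData a b c d).k₁' (affineData a b c d).k₂'
        (affineData a b c d).g (affineData a b c d).h p = b := by simp [sep, affineData]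
    rw [this]; nlinarith

theorem exists_tame_coneCut (n : ℕ) [NeZero n] : ∃ B, 1 ≤ B ∧ ∀ {α m lam R T : ℝ}, 1 / 2 ≤ α →
    α ≤ 1 → 0 ≤ m → m ≤ 1 → 1 ≤ lam → 1 ≤ R → ∀ {p : EuclideanSpace ℝ (Fin n) × ℝ}, 1 ≤ p.1 0 →
    Tame ex et (B * (1 + nsq p)) (coneCut α m lam R T) p := by
  obtain ⟨S, hS, h1, h2⟩ := exists_step_bound
  have hn : (0 : ℝ) ≤ n := Nat.cast_nonneg n
  refine ⟨32 * S ^ 2 * (2 * n + 16), ?_, ?_⟩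
  · have : 1 ≤ S ^ 2 := one_le_pow₀ hS
    nlinarith
  intro α m lam R T hα hα1 hm hm1 hl hR p hx
  have hR2 : |-(R ^ 2)⁻¹| ≤ 1 := by
    rw [abs_neg, abs_of_nonneg (by positivity)]
    exact inv_le_one_of_one_le₀ (one_le_pow₀ hR)
  have t1 := tame_affineData (n := n) (a := -1) (b := 0) (c := 0) (d := 1) hS h1 h2 (by simp)
    (by simp) (by simp) p
  have t2 := tame_gaugeData (lam := lam) hS h1 h2 hα hα1 hm hm1 hl hx
  have t3 := tame_affineData (n := n) (a := 2) (b := 0) (d := 0) hS h1 h2 (by simp) hR2 (by simp) p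
  have t4 := tame_affineData (n := n) (a := T) (b := -1) (c := 0) (d := 0) hS h1 h2 (by simp)
    (by simp) (by simp) p
  exact ((t1.mul t2).mul (t3.mul t4)).mono (by apply le_of_eq; ring)

theorem coneCut_eq (α m lam R T : ℝ) (p : EuclideanSpace ℝ (Fin n) × ℝ) : coneCut α m lam R T p =
    smoothTransition (p.1 0 - 1) * smoothTransition (gauge' α m p / lam - 1)
    * (smoothTransition (2 - nsq p / R ^ 2) * smoothTransition (T - p.2)) := by
  have e1 : (affineData (-1) 0 0 1).fn p = p.1 0 - 1 := by
    simp only [SepData.fn, affineData, sep]; ring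
  have e2 : (affineData 2 0 (-(R ^ 2)⁻¹) 0).fn p = 2 - nsq p / R ^ 2 := by
    simp only [SepData.fn, affineData, sep]; ring
  have e3 : (affineData T (-1) 0 0).fn p = T - p.2 := by
    simp only [SepData.fn, affineData, sep]; ring
  rw [coneCut, gaugeData_fn, e1, e2, e3]

theorem coneCut_nonneg (α m lam R T : ℝ) (p : EuclideanSpace ℝ (Fin n) × ℝ) :
    0 ≤ coneCut α m lam R T p :=
  mul_nonneg (mul_nonneg (smoothTransition.nonneg _) (smoothTransition.nonneg _))
    (mul_nonneg (smoothTransition.nonneg _) (smoothTransition.nonneg _))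

theorem continuous_gauge' (hα : 0 < α) (m : ℝ) :
    Continuous (gauge' α m : EuclideanSpace ℝ (Fin n) × ℝ → ℝ) := by
  unfold gauge'
  have h1 := (Real.continuous_rpow_const (q := 2 * α) (by linarith)).comp
    (contDiff_coord (n := n) 0).continuous
  have h2 := (Real.continuous_rpow_const (q := α) hα.le).comp (contDiff_nsq (n := n)).continuous
  exact h1.sub (continuous_const.mul h2)

theorem tsupport_coneCut_subset (hα : 0 < α) (hl : 0 < lam) (hR : 0 < R) :
    tsupport (coneCut α m lam R T) ⊆ {p : EuclideanSpace ℝ (Fin n) × ℝ |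
      1 ≤ p.1 0 ∧ lam ≤ gauge' α m p ∧ nsq p ≤ 2 * R ^ 2 ∧ p.2 ≤ T} := by
  refine closure_minimal (fun p hp => ?_) ?_
  · rw [Function.mem_support, coneCut_eq] at hp
    have pos : ∀ {y : ℝ}, smoothTransition y ≠ 0 → 0 < y := fun {y} h => by
      by_contra hy; exact h (smoothTransition.zero_of_nonpos (not_lt.1 hy))
    simp only [mul_ne_zero_iff] at hp
    obtain ⟨⟨h1, h2⟩, h3, h4⟩ := hp
    have h1 := pos h1
    have h2 := pos h2
    have h3 := pos h3
    have h4 := pos h4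
    rw [sub_pos, one_lt_div hl] at h2
    rw [sub_pos, div_lt_iff₀ (by positivity)] at h3
    exact ⟨by linarith, h2.le, h3.le, by linarith⟩
  · have c0 := (contDiff_coord (n := n) 0).continuous
    have c1 := continuous_gauge' (n := n) hα m
    have c2 := (contDiff_nsq (n := n)).continuous
    exact (isClosed_le continuous_const c0).inter ((isClosed_le continuous_const c1).inter
      ((isClosed_le c2 continuous_const).inter (isClosed_le continuous_snd continuous_const)))

theorem two_le_coord (hα : 1 / 2 ≤ α) (hα1 : α ≤ 1) (hm : 0 ≤ m) (hx : 0 < p.1 0)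
    (hf : 4 ≤ gauge' α m p) : 2 ≤ p.1 0 ∧ gauge' α m p ≤ p.1 0 ^ 2 := by
  have h0 : gauge' α m p ≤ p.1 0 ^ (2 * α) := by
    have : 0 ≤ m * nsq p ^ α := mul_nonneg hm (Real.rpow_nonneg (nsq_nonneg p) _)
    unfold gauge'; linarith
  have h1 : 1 ≤ p.1 0 := by
    by_contra h
    have := Real.rpow_le_one hx.le (not_le.1 h).le (show 0 ≤ 2 * α by linarith)
    linarith
  have h2 : p.1 0 ^ (2 * α) ≤ p.1 0 ^ 2 := by
    rw [← Real.rpow_natCast (p.1 0) 2]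
    exact Real.rpow_le_rpow_of_exponent_le h1 (by push_cast; linarith)
  exact ⟨by nlinarith, by linarith⟩

theorem coneCut_eq_one (hx : 2 ≤ p.1 0) (hl : 0 < lam) (hf : 2 * lam ≤ gauge' α m p) (hR : 0 < R)
    (hs : nsq p ≤ R ^ 2) (ht : p.2 ≤ T - 1) : coneCut α m lam R T p = 1 := by
  have h2 : 2 ≤ gauge' α m p / lam := (le_div_iff₀ hl).2 hf
  have h3 : nsq p / R ^ 2 ≤ 1 := (div_le_one (by positivity)).2 hs
  rw [coneCut_eq, smoothTransition.one_of_one_le (by linarith),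
    smoothTransition.one_of_one_le (by linarith), smoothTransition.one_of_one_le (by linarith),
    smoothTransition.one_of_one_le (by linarith)]
  norm_num

theorem contDiff_coneCut (α m lam R T : ℝ) :
    ContDiff ℝ ∞ (coneCut α m lam R T : EuclideanSpace ℝ (Fin n) × ℝ → ℝ) := by
  have ha : ∀ a b c d : ℝ, ContDiff ℝ ∞ fun p : EuclideanSpace ℝ (Fin n) × ℝ =>
      smoothTransition ((affineData a b c d).fn p) :=
    fun a b c d => contDiff_step.comp (contDiff_affineData a b c d)
  refine (contDiff_mul_of_tsupport isOpen_sepDomain_pos (ha _ _ _ _)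
    (contDiff_step.comp_contDiffOn (contDiffOn_gaugeData α m lam)) ?_).mul
    ((ha _ _ _ _).mul (ha _ _ _ _))
  have : tsupport (fun p : EuclideanSpace ℝ (Fin n) × ℝ =>
      smoothTransition ((affineData (-1) 0 0 1).fn p)) ⊆ {p | 1 ≤ p.1 0} := by
    refine closure_minimal (fun p hp => ?_)
      (isClosed_le continuous_const (contDiff_coord (n := n) 0).continuous)
    by_contra h
    refine hp (smoothTransition.zero_of_nonpos ?_)
    have h : p.1 0 < 1 := not_le.1 h
    simp only [SepData.fn, affineData, sep]
    linarith
  intro p hp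
  have h1 : 1 ≤ p.1 0 := this hp
  exact mem_sepDomain_of_pos (by linarith)

end ConeCutoff

section Support

theorem integrable_of_continuousOn {V : Type*} [NormedAddCommGroup V] [MeasurableSpace V] [BorelSpace V] {μ : Measure V}
    [IsFiniteMeasureOnCompacts μ] {F : V → ℝ} {Ω K : Set V}
    (hΩ : IsOpen Ω) (hF : ContinuousOn F Ω) (hK : IsCompact K) (hKΩ : K ⊆ Ω)
    (h0 : ∀ p, p ∉ K → F p = 0) : Integrable F μ := by
  have hc : Continuous F := by
    refine continuous_iff_continuousAt.2 fun p => ?_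
    by_cases hp : p ∈ Ω
    · exact hF.continuousAt (hΩ.mem_nhds hp)
    · have : F =ᶠ[𝓝 p] fun _ => 0 := by
        filter_upwards [hK.isClosed.isOpen_compl.mem_nhds fun h => hp (hKΩ h)] with x hx
        exact h0 x hx
      exact continuousAt_const.congr this.symm
  exact hc.integrable_of_hasCompactSupport (HasCompactSupport.intro hK h0)

variable {V : Type*} [NormedAddCommGroup V] [NormedSpace ℝ V] {ι : Type*} [Fintype ι] {e : ι → V}

theorem ContDiffOn.gdot {f g : V → ℝ} {Ω : Set V} (hΩ : IsOpen Ω) (hf : ContDiffOn ℝ ∞ f Ω)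
    (hg : ContDiffOn ℝ ∞ g Ω) : ContDiffOn ℝ ∞ (gdot e f g) Ω := by
  unfold _root_.gdot
  exact ContDiffOn.sum fun i _ => (hf.dir hΩ _).mul (hg.dir hΩ _)

theorem lapl_eq_zero_of_notMem {f : V → ℝ} {p : V} (hp : p ∉ tsupport f) : lapl e f p = 0 := by
  have : f =ᶠ[𝓝 p] fun _ => 0 := notMem_tsupport_iff_eventuallyEq.1 hp
  rw [lapl_congr this]
  have h : ∀ w : V, dir w (fun _ : V => (0 : ℝ)) = fun _ => 0 := fun w => funext (dir_const w 0)
  simp [lapl, h]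

theorem dir_eq_zero_of_notMem {f : V → ℝ} {p : V} (hp : p ∉ tsupport f) (w : V) :
    dir w f p = 0 :=
  image_eq_zero_of_notMem_tsupport fun h => hp (tsupport_dir_subset f w h)

theorem gdot_eq_zero_of_notMem {f g : V → ℝ} {p : V} (hp : p ∉ tsupport f) : gdot e f g p = 0 :=
  Finset.sum_eq_zero fun i _ => by rw [dir_eq_zero_of_notMem hp, zero_mul]

end Support

section TimeCutoff

variable {n : ℕ}

/-- A smooth time cutoff which vanishes for `t ≤ 1 + ε` and equals one for `t ≥ 1 + 2ε`. -/
noncomputable def timeCut (ε : ℝ) (p : EuclideanSpace ℝ (Fin n) × ℝ) : ℝ :=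
  smoothTransition ((p.2 - 1) / ε - 1)

theorem contDiff_timeCut (ε : ℝ) :
    ContDiff ℝ ∞ (timeCut ε : EuclideanSpace ℝ (Fin n) × ℝ → ℝ) :=
  contDiff_step.comp (by fun_prop)

theorem timeCut_nonneg (ε : ℝ) (p : EuclideanSpace ℝ (Fin n) × ℝ) : 0 ≤ timeCut ε p :=
  smoothTransition.nonneg _

theorem timeCut_le_one (ε : ℝ) (p : EuclideanSpace ℝ (Fin n) × ℝ) : timeCut ε p ≤ 1 :=
  smoothTransition.le_one _

theorem hasDerivAt_timeCut (ε t : ℝ) : HasDerivAt (fun t : ℝ => smoothTransition ((t - 1) / ε - 1))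
    (deriv smoothTransition ((t - 1) / ε - 1) / ε) t := by
  have h : HasDerivAt (fun t : ℝ => (t - 1) / ε - 1) (1 / ε) t :=
    (((hasDerivAt_id t).sub_const 1).div_const ε).sub_const 1
  exact ((hasDerivAt_of_contDiff contDiff_step _).comp t h).congr_deriv (by ring)

theorem dir_timeCut (ε : ℝ) (w p : EuclideanSpace ℝ (Fin n) × ℝ) :
    dir w (timeCut ε) p = deriv smoothTransition ((p.2 - 1) / ε - 1) / ε * w.2 :=
  dir_comp_snd (hasDerivAt_timeCut ε p.2) w

theorem dir_ex_timeCut (ε : ℝ) (i : Fin n) (p) : dir (ex i) (timeCut ε) p = 0 := by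
  rw [dir_timeCut]; exact mul_zero _

theorem dir_et_timeCut (ε : ℝ) (p : EuclideanSpace ℝ (Fin n) × ℝ) :
    dir et (timeCut ε) p = deriv smoothTransition ((p.2 - 1) / ε - 1) / ε := by
  rw [dir_timeCut]; exact mul_one _

theorem dir_et_timeCut_nonneg {ε : ℝ} (hε : 0 < ε) (p : EuclideanSpace ℝ (Fin n) × ℝ) :
    0 ≤ dir et (timeCut ε) p := by
  rw [dir_et_timeCut]; exact div_nonneg (step_deriv_nonneg _) hε.le

theorem timeCut_eq_one {ε : ℝ} (hε : 0 < ε) {p : EuclideanSpace ℝ (Fin n) × ℝ}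
    (h : 1 + 2 * ε ≤ p.2) : timeCut ε p = 1 := by
  refine smoothTransition.one_of_one_le ?_
  have : 2 ≤ (p.2 - 1) / ε := (le_div_iff₀ hε).2 (by linarith)
  linarith

theorem timeCut_eq_zero {ε : ℝ} (hε : 0 < ε) {p : EuclideanSpace ℝ (Fin n) × ℝ}
    (h : p.2 ≤ 1 + ε) : timeCut ε p = 0 := by
  refine smoothTransition.zero_of_nonpos ?_
  have : (p.2 - 1) / ε ≤ 1 := (div_le_iff₀ hε).2 (by linarith)
  linarith

theorem tsupport_timeCut_subset {ε : ℝ} (hε : 0 < ε) :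
    tsupport (timeCut ε) ⊆ {p : EuclideanSpace ℝ (Fin n) × ℝ | 1 + ε ≤ p.2} := by
  refine closure_minimal (fun p hp => ?_) (isClosed_le continuous_const continuous_snd)
  by_contra h
  exact hp (timeCut_eq_zero hε (not_le.1 h).le)

theorem isCompact_slab (r a b : ℝ) :
    IsCompact {p : EuclideanSpace ℝ (Fin n) × ℝ | nsq p ≤ r ∧ a ≤ p.2 ∧ p.2 ≤ b} := by
  have hc : IsClosed {p : EuclideanSpace ℝ (Fin n) × ℝ | nsq p ≤ r ∧ a ≤ p.2 ∧ p.2 ≤ b} :=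
    (isClosed_le (contDiff_nsq (n := n)).continuous continuous_const).inter
      ((isClosed_le continuous_const continuous_snd).inter
        (isClosed_le continuous_snd continuous_const))
  refine ((isCompact_closedBall (0 : EuclideanSpace ℝ (Fin n)) (√r)).prod
    (isCompact_Icc (a := a) (b := b))).of_isClosed_subset hc fun p hp => ⟨?_, hp.2.1, hp.2.2⟩
  rw [mem_closedBall_zero_iff]
  exact Real.le_sqrt_of_sq_le hp.1

end TimeCutoff

section Gaussian

variable {n : ℕ}

/-- A Gaussian in space, restricted to the times between `1` and `4`. -/
noncomputable def slabGauss (p : EuclideanSpace ℝ (Fin n) × ℝ) : ℝ :=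
  rexp (-(1 / 64) * ‖p.1‖ ^ 2) * (Icc (1 : ℝ) 4).indicator (fun _ => 1) p.2

theorem integrable_slabGauss : Integrable (slabGauss (n := n)) := by
  have h1 : Integrable fun x : EuclideanSpace ℝ (Fin n) => rexp (-(1 / 64) * ‖x‖ ^ 2) := by
    have := (GaussianFourier.integrable_cexp_neg_mul_sq_norm_add (V := EuclideanSpace ℝ (Fin n))
      (b := (1 / 64 : ℂ)) (by norm_num) 0 0).norm
    refine this.congr (Eventually.of_forall fun x => ?_)
    simp only [Complex.norm_exp]
    congr 1
    have : (-(1 / 64 : ℂ) * (‖x‖ : ℂ) ^ 2 + 0 * (inner ℝ (0 : EuclideanSpace ℝ (Fin n)) x : ℂ))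
        = ((-(1 / 64) * ‖x‖ ^ 2 : ℝ) : ℂ) := by push_cast; ring
    rw [this, Complex.ofReal_re]
  have h2 : Integrable ((Icc (1 : ℝ) 4).indicator fun _ => (1 : ℝ)) :=
    (integrable_indicator_iff measurableSet_Icc).2 (integrableOn_const (by simp))
  exact h1.mul_prod h2

theorem slabGauss_nonneg (p : EuclideanSpace ℝ (Fin n) × ℝ) : 0 ≤ slabGauss p :=
  mul_nonneg (Real.exp_pos _).le (indicator_nonneg (fun _ _ => zero_le_one) _)

theorem mul_exp_le_slabGauss {p : EuclideanSpace ℝ (Fin n) × ℝ} (h1 : 1 ≤ p.2) (h4 : p.2 ≤ 4) :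
    (1 + nsq p) * rexp (-(nsq p / 32)) ≤ 64 * slabGauss p := by
  have hi : (Icc (1 : ℝ) 4).indicator (fun _ => (1 : ℝ)) p.2 = 1 := 
    indicator_of_mem (show p.2 ∈ Icc (1 : ℝ) 4 from ⟨h1, h4⟩) _
  rw [slabGauss, hi, mul_one]
  have e1 : nsq p / 64 + 1 ≤ rexp (nsq p / 64) := Real.add_one_le_exp _
  have e2 : 1 + nsq p ≤ 64 * rexp (nsq p / 64) := by linarith [nsq_nonneg p]
  have e3 : rexp (-(1 / 64) * ‖p.1‖ ^ 2) = rexp (nsq p / 64) * rexp (-(nsq p / 32)) := by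
    rw [← Real.exp_add]; congr 1; rw [nsq]; ring
  rw [e3, ← mul_assoc]
  exact mul_le_mul_of_nonneg_right e2 (Real.exp_pos _).le

end Gaussian

section EnergyBound

variable {n : ℕ}

theorem gdot_nsq (p : EuclideanSpace ℝ (Fin n) × ℝ) : gdot ex nsq nsq p = 4 * nsq p := by
  simp only [gdot, dir_ex_nsq, nsq_eq, Finset.mul_sum]
  exact Finset.sum_congr rfl fun i _ => by ring

theorem lapl_nsq (p : EuclideanSpace ℝ (Fin n) × ℝ) : lapl ex nsq p = 2 * n := by
  have : ∀ i : Fin n, dir (ex i) (dir (ex i) nsq) p = 2 := by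
    intro i
    have h : dir (ex i) (nsq (n := n)) = fun p => 2 * p.1 i := funext (dir_ex_nsq i)
    rw [h, dir_const_mul]
    simp only [dir_ex_coord]; simp
  simp [lapl, this, mul_comm]

theorem hasDerivAt_exp_mul (c y : ℝ) : HasDerivAt (fun y : ℝ => rexp (c * y)) (c * rexp (c * y)) y :=
  (((hasDerivAt_id y).const_mul c).exp).congr_deriv (by simp; ring)

theorem lapl_exp_nsq (c : ℝ) (p : EuclideanSpace ℝ (Fin n) × ℝ) :
    lapl ex (fun p => rexp (c * nsq p)) p = (4 * c ^ 2 * nsq p + 2 * n * c) * rexp (c * nsq p) := by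
  rw [lapl_comp (k := fun y => rexp (c * y)) (hasDerivAt_exp_mul c)
    (fun y => (hasDerivAt_exp_mul c y).const_mul c) contDiff_nsq.contDiffAt, gdot_nsq, lapl_nsq]
  ring

theorem gdot_exp_nsq (c : ℝ) (f : EuclideanSpace ℝ (Fin n) × ℝ → ℝ)
    (p : EuclideanSpace ℝ (Fin n) × ℝ) :
    gdot ex f (fun p => rexp (c * nsq p)) p = c * rexp (c * nsq p) * gdot ex f nsq p := by
  simp only [gdot, Finset.mul_sum]
  refine Finset.sum_congr rfl fun i _ => ?_
  rw [dir_comp (g := fun y => rexp (c * y)) (hasDerivAt_exp_mul c _) (contDiff_nsq.diffAt p)]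
  ring

theorem dir_et_exp_nsq (c : ℝ) (p : EuclideanSpace ℝ (Fin n) × ℝ) :
    dir et (fun p => rexp (c * nsq p)) p = 0 := by
  rw [dir_comp (g := fun y => rexp (c * y)) (hasDerivAt_exp_mul c _) (contDiff_nsq.diffAt p),
    dir_et_nsq, mul_zero]

theorem lapl_mul_exp_le {B : ℝ} (hB : 1 ≤ B) {g : EuclideanSpace ℝ (Fin n) × ℝ → ℝ}
    {p : EuclideanSpace ℝ (Fin n) × ℝ} (hg : Tame ex et (B * (1 + nsq p)) g p) (hg0 : 0 ≤ g p) :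
    lapl ex (fun p => g p * rexp (-(1 / 32) * nsq p)) p ≤
      4 * B * (1 + nsq p) * rexp (-(1 / 32) * nsq p) := by
  have hE : ContDiff ℝ ∞ fun p : EuclideanSpace ℝ (Fin n) × ℝ => rexp (-(1 / 32) * nsq p) := by
    fun_prop
  have hs := nsq_nonneg p
  rw [lapl_mul hg.contDiffAt hE.contDiffAt, lapl_exp_nsq, gdot_exp_nsq]
  obtain ⟨E, hE'⟩ : ∃ E, E = rexp (-(1 / 32) * nsq p) := ⟨_, rfl⟩
  have E0 : 0 ≤ E := hE' ▸ (Real.exp_pos _).le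
  rw [← hE']
  have h1 := two_mul_abs_gdot_le (e := ex) (f := g) (g := nsq) (p := p)
  rw [gdot_nsq] at h1
  have h2 := neg_abs_le (gdot ex g nsq p)
  have h3 := hg.gdot_le
  have h4 := (abs_le.1 hg.lapl_le).2
  have hg1 := (abs_le.1 hg.abs_le_one).2
  have hn : (0 : ℝ) ≤ n := Nat.cast_nonneg n
  have key : g p * (4 * (-(1 / 32)) ^ 2 * nsq p + 2 * n * -(1 / 32)) + lapl ex g p
      + 2 * (-(1 / 32) * gdot ex g nsq p) ≤ 4 * B * (1 + nsq p) := by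
    have a1 : g p * nsq p ≤ 1 * nsq p := mul_le_mul_of_nonneg_right hg1 hs
    have a2 : 0 ≤ g p * n := mul_nonneg hg0 hn
    have a3 : nsq p ≤ B * nsq p := by nlinarith
    have a4 : 0 ≤ gdot ex g g p := gdot_self_nonneg
    linarith
  calc _ = (g p * (4 * (-(1 / 32)) ^ 2 * nsq p + 2 * n * -(1 / 32)) + lapl ex g p
      + 2 * (-(1 / 32) * gdot ex g nsq p)) * E := by ring
    _ ≤ _ := mul_le_mul_of_nonneg_right key E0

theorem lapl_timeCut_mul (ε : ℝ) {g : EuclideanSpace ℝ (Fin n) × ℝ → ℝ} (hg : ContDiff ℝ ∞ g)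
    (p : EuclideanSpace ℝ (Fin n) × ℝ) :
    lapl ex (fun p => timeCut ε p * g p) p = timeCut ε p * lapl ex g p := by
  have h : ∀ i, dir (ex i) (timeCut (n := n) ε) = fun _ => 0 := fun i => funext (dir_ex_timeCut ε i)
  rw [lapl_mul (contDiff_timeCut ε).contDiffAt hg.contDiffAt]
  have h1 : lapl ex (timeCut ε) p = 0 := by simp [lapl, h, dir_const]
  have h2 : gdot ex (timeCut ε) g p = 0 := by simp [gdot, h]
  rw [h1, h2]; ring

variable [NeZero n]

/-- A weighted space-time energy bound away from the lateral boundary, uniform in the cutoffs. -/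
theorem exists_energy_bound {α m M c : ℝ} (hα : 1 / 2 ≤ α) (hα1 : α ≤ 1) (hm : 0 ≤ m)
    (hm1 : m ≤ 1) (hc : 0 ≤ c) {Ω : Set (EuclideanSpace ℝ (Fin n) × ℝ)} (hΩ : IsOpen Ω)
    (hΩs : ∀ p : EuclideanSpace ℝ (Fin n) × ℝ, 0 < p.1 0 → 1 ≤ gauge' α m p → 1 < p.2 → p.2 < 5 →
      p ∈ Ω)
    {u : EuclideanSpace ℝ (Fin n) × ℝ → ℝ} (hu : ContDiffOn ℝ ∞ u Ω) (hM : ∀ p ∈ Ω, |u p| ≤ M)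
    (hL : ∀ p ∈ Ω, |dir et u p + lapl ex u p| ≤ c * (√(gdot ex u u p) + |u p|)) :
    ∃ W, 0 ≤ W ∧ ∀ R ε, 1 ≤ R → 0 < ε → ∃ J : EuclideanSpace ℝ (Fin n) × ℝ → ℝ, Integrable J ∧
      ∫ p, J p ≤ 0 ∧ ∀ p, timeCut ε p * (coneCut α m 500 R 4 p * rexp (-(1 / 32) * nsq p)) *
        (gdot ex u u p + u p ^ 2) ≤ J p + W * slabGauss p := by
  obtain ⟨B, hB, hT⟩ := exists_tame_coneCut n
  refine ⟨64 * (M ^ 2 * (5 * B + (c ^ 2 + 2 * c) + 1)), by positivity, fun R ε hR hε => ?_⟩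
  have hα0 : 0 < α := by linarith
  obtain ⟨g, hgdef⟩ : ∃ g : EuclideanSpace ℝ (Fin n) × ℝ → ℝ,
    g = fun p => coneCut α m 500 R 4 p * rexp (-(1 / 32) * nsq p) := ⟨_, rfl⟩
  have hcut := contDiff_coneCut (n := n) α m 500 R 4
  have hgs : ContDiff ℝ ∞ g := by rw [hgdef]; fun_prop
  have hζ := contDiff_timeCut (n := n) ε
  obtain ⟨η, hηdef⟩ : ∃ η : EuclideanSpace ℝ (Fin n) × ℝ → ℝ,
    η = fun p => timeCut ε p * g p := ⟨_, rfl⟩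
  have hη : ContDiff ℝ ∞ η := by rw [hηdef]; exact hζ.mul hgs
  have hg0 : ∀ p, 0 ≤ g p := fun p => by
    rw [hgdef]; exact mul_nonneg (coneCut_nonneg _ _ _ _ _ _) (Real.exp_pos _).le
  have hη0 : ∀ p, 0 ≤ η p := fun p => by
    rw [hηdef]; exact mul_nonneg (timeCut_nonneg _ _) (hg0 p)
  have hsupp : ∀ p ∈ tsupport η, 1 + ε ≤ p.2 ∧ 1 ≤ p.1 0 ∧ 500 ≤ gauge' α m p ∧
      nsq p ≤ 2 * R ^ 2 ∧ p.2 ≤ 4 := by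
    intro p hp
    rw [hηdef] at hp
    have h1 := tsupport_timeCut_subset hε (tsupport_mul_subset_left hp)
    have h2 := tsupport_mul_subset_right hp
    rw [hgdef] at h2
    exact ⟨h1, tsupport_coneCut_subset hα0 (by norm_num) (by linarith) (tsupport_mul_subset_left h2)⟩
  have hηΩ : tsupport η ⊆ Ω := fun p hp => by
    obtain ⟨h1, h2, h3, h4, h5⟩ := hsupp p hp
    exact hΩs p (by linarith) (by linarith) (by linarith) (by linarith)
  have hηc : IsCompact (tsupport η) :=
    (isCompact_slab (2 * R ^ 2) (1 + ε) 4).of_isClosed_subset (isClosed_tsupport η) fun p hp => by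
      obtain ⟨h1, h2, h3, h4, h5⟩ := hsupp p hp
      exact ⟨h4, h1, h5⟩
  refine ⟨fun p => η p * gdot ex u u p
      - u p ^ 2 * (lapl ex η p - dir et η p + (c ^ 2 + 2 * c) * η p), ?_,
    caccioppoli volume hΩ hη hηc hηΩ hη0 hu hL, fun p => ?_⟩
  · refine integrable_of_continuousOn hΩ ?_ hηc hηΩ fun p hp => ?_
    · have h1 := (ContDiffOn.gdot (e := ex) hΩ hu hu).continuousOn
      have h2 := hu.continuousOn
      have h3 := (ContDiff.lapl (e := ex) hη).continuous.continuousOn (s := Ω)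
      have h4 := (hη.dir et).continuous.continuousOn (s := Ω)
      have h5 := hη.continuous.continuousOn (s := Ω)
      exact (h5.mul h1).sub ((h2.pow 2).mul ((h3.sub h4).add (continuousOn_const.mul h5)))
    · rw [lapl_eq_zero_of_notMem hp, dir_eq_zero_of_notMem hp, image_eq_zero_of_notMem_tsupport hp]
      ring
  have e0 : timeCut ε p * (coneCut α m 500 R 4 p * rexp (-(1 / 32) * nsq p)) = η p := by
    rw [hηdef, hgdef]
  rw [e0]
  beta_reduce
  by_cases hp : p ∈ tsupport η
  swap
  · rw [lapl_eq_zero_of_notMem hp, dir_eq_zero_of_notMem hp, image_eq_zero_of_notMem_tsupport hp]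
    have := slabGauss_nonneg p
    have : 0 ≤ 64 * (M ^ 2 * (5 * B + (c ^ 2 + 2 * c) + 1)) * slabGauss p := by positivity
    linarith
  obtain ⟨h1, h2, h3, h4, h5⟩ := hsupp p hp
  have hs := nsq_nonneg p
  have htame := hT (R := R) (T := 4) hα hα1 hm hm1 (by norm_num : (1 : ℝ) ≤ 500) hR h2
  have hlap := lapl_mul_exp_le hB htame (coneCut_nonneg _ _ _ _ _ _)
  obtain ⟨E, hE⟩ : ∃ E, E = rexp (-(1 / 32) * nsq p) := ⟨_, rfl⟩
  have E0 : 0 ≤ E := hE ▸ (Real.exp_pos _).le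
  have hgE : g p ≤ (1 + nsq p) * E := by
    rw [hgdef, hE]
    exact mul_le_mul_of_nonneg_right ((abs_le.1 htame.abs_le_one).2.trans (by linarith))
      (Real.exp_pos _).le
  have hdg : -dir et g p ≤ B * (1 + nsq p) * E := by
    have hEd : ContDiff ℝ ∞ fun p : EuclideanSpace ℝ (Fin n) × ℝ => rexp (-(1 / 32) * nsq p) := by
      fun_prop
    rw [hgdef, dir_mul hcut hEd]
    simp only [dir_et_exp_nsq, mul_zero, add_zero]
    rw [← hE, ← neg_mul]
    exact mul_le_mul_of_nonneg_right ((neg_le_abs _).trans htame.dir_le) E0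
  rw [← hE, show (fun p => coneCut α m 500 R 4 p * rexp (-(1 / 32) * nsq p)) = g from hgdef.symm]
    at hlap
  have hcoef : lapl ex η p - dir et η p + (c ^ 2 + 2 * c) * η p + η p ≤
      (5 * B + (c ^ 2 + 2 * c) + 1) * ((1 + nsq p) * E) := by
    have e1 : lapl ex η p = timeCut ε p * lapl ex g p := by rw [hηdef]; exact lapl_timeCut_mul ε hgs p
    have e2 : dir et η p = dir et (timeCut ε) p * g p + timeCut ε p * dir et g p := by
      rw [hηdef, dir_mul hζ hgs]
    have e3 : η p = timeCut ε p * g p := by rw [hηdef]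
    rw [e1, e2, e3]
    have d0 := mul_nonneg (dir_et_timeCut_nonneg hε p) (hg0 p)
    have z0 := timeCut_nonneg ε p
    have z1 := timeCut_le_one ε p
    have k : lapl ex g p - dir et g p + (c ^ 2 + 2 * c) * g p + g p ≤
        (5 * B + (c ^ 2 + 2 * c) + 1) * ((1 + nsq p) * E) := by
      have := mul_le_mul_of_nonneg_left hgE (show 0 ≤ c ^ 2 + 2 * c + 1 by positivity)
      linarith
    have k2 : 0 ≤ (5 * B + (c ^ 2 + 2 * c) + 1) * ((1 + nsq p) * E) := by positivity
    have k3 := mul_le_mul_of_nonneg_left k z0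
    have k4 := mul_le_mul_of_nonneg_right z1 k2
    linarith
  have hG := mul_exp_le_slabGauss (p := p) (by linarith) h5
  have hEe : rexp (-(nsq p / 32)) = E := by rw [hE]; congr 1; ring
  rw [hEe] at hG
  have hu2 : u p ^ 2 ≤ M ^ 2 := by
    have := abs_le.1 (hM p (hηΩ hp)); exact sq_le_sq' this.1 this.2
  have k1 := mul_le_mul_of_nonneg_left hcoef (sq_nonneg (u p))
  have hK : 0 ≤ 5 * B + (c ^ 2 + 2 * c) + 1 := by positivity
  have k2 := mul_le_mul_of_nonneg_right hu2
    (show 0 ≤ (5 * B + (c ^ 2 + 2 * c) + 1) * ((1 + nsq p) * E) by positivity)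
  have k3 := mul_le_mul_of_nonneg_left hG
    (show 0 ≤ M ^ 2 * (5 * B + (c ^ 2 + 2 * c) + 1) by positivity)
  linarith

end EnergyBound

section ConePointwise

theorem prof_le_of_le {K s t : ℝ} (hK : 1 ≤ K) (h : s ≤ t) : prof K t ≤ prof K s := by
  have : Antitone (prof K) := antitone_of_deriv_nonpos
    (fun t => (hasDerivAt_prof K t).differentiableAt) fun t => by
      rw [(hasDerivAt_prof K t).deriv]; exact prof₁_nonpos hK t
  exact this h

theorem prof_eq_zero {K t : ℝ} (hK : 0 < K) (ht : 2 ≤ t) : prof K t = 0 :=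
  expNegInvGlue.zero_of_nonpos (div_nonpos_of_nonpos_of_nonneg (by linarith) hK.le)

theorem prof_pos {K t : ℝ} (hK : 0 < K) (ht : t < 2) : 0 < prof K t :=
  expNegInvGlue.pos_of_pos (div_pos (by linarith) hK)

theorem exists_rpow_le {α k ε : ℝ} (hα : 0 ≤ α) (hα1 : α < 1) (hk : 0 ≤ k) (hε : 0 < ε) :
    ∃ C, ∀ s, 0 ≤ s → k * s ^ α ≤ ε * s + C := by
  refine ⟨k * ((k / ε) ^ (1 - α)⁻¹) ^ α, fun s hs => ?_⟩
  have hb : 0 ≤ (k / ε) ^ (1 - α)⁻¹ := by positivity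
  rcases le_total s ((k / ε) ^ (1 - α)⁻¹) with h | h
  · have := mul_le_mul_of_nonneg_left (Real.rpow_le_rpow hs h hα) hk
    have := mul_nonneg hε.le hs
    linarith
  · have h1 : k / ε ≤ s ^ (1 - α) := by
      have := Real.rpow_le_rpow hb h (show 0 ≤ 1 - α by linarith)
      rwa [← Real.rpow_mul (by positivity), inv_mul_cancel₀ (by linarith), Real.rpow_one] at this
    have h2 : k ≤ ε * s ^ (1 - α) := by rwa [div_le_iff₀' hε] at h1
    have h3 : s ^ (1 - α) * s ^ α = s := by
      rcases hs.eq_or_lt with rfl | h0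
      · rw [Real.zero_rpow (by linarith : 1 - α ≠ 0)]; simp
      · rw [← Real.rpow_add h0]; simp
    have h4 : 0 ≤ s ^ α := by positivity
    have h5 := mul_le_mul_of_nonneg_right h2 h4
    rw [mul_assoc, h3] at h5
    have : 0 ≤ k * ((k / ε) ^ (1 - α)⁻¹) ^ α := by positivity
    linarith

variable {n : ℕ} [NeZero n] {α m K a C R : ℝ} {p : EuclideanSpace ℝ (Fin n) × ℝ}

theorem gauge'_le_rpow_nsq (hα : 0 ≤ α) (hm : 0 ≤ m) (hx : 0 ≤ p.1 0) :
    gauge' α m p ≤ nsq p ^ α := by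
  have h1 : p.1 0 ^ (2 * α) ≤ nsq p ^ α := by
    rw [Real.rpow_mul hx]
    exact Real.rpow_le_rpow (by positivity) (by simpa using sq_coord_le_nsq p) hα
  have : 0 ≤ m * nsq p ^ α := mul_nonneg hm (Real.rpow_nonneg (nsq_nonneg p) _)
  unfold gauge'; linarith

theorem sq_one_add_le_exp {s : ℝ} (hs : 0 ≤ s) : (1 + s) ^ 2 ≤ 128 ^ 2 * rexp (s / 64) := by
  have h : 1 + s ≤ 128 * rexp (s / 128) := by
    have := Real.add_one_le_exp (s / 128); linarith
  have h2 : rexp (s / 64) = rexp (s / 128) ^ 2 := by rw [← Real.exp_nat_mul]; congr 1; push_cast; ring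
  rw [h2, ← mul_pow]
  exact pow_le_pow_left₀ (by linarith) h 2

theorem exp_coneWeight_le (hα : 0 ≤ α) (hm : 0 ≤ m) (hK : 1 ≤ K) (ha : 0 ≤ a)
    (hC : ∀ s, 0 ≤ s → 2 * a * prof K 1 * s ^ α ≤ 1 / 48 * s + C) (ht : 1 ≤ p.2) (ht3 : p.2 ≤ 3)
    (hx : 0 ≤ p.1 0) (hf : 0 ≤ gauge' α m p)
    (hbad : gauge' α m p ≤ 2000 ∨ R ^ 2 ≤ nsq p ∨ 2 ≤ p.2) :
    rexp (2 * (coneWeight α m K a).fn p) * (1 + nsq p) ^ 2 ≤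
      128 ^ 2 * ((rexp (4000 * a * prof K 1) + rexp (C - R ^ 2 / 64)) *
        rexp (-(1 / 32) * nsq p)) := by
  have hs := nsq_nonneg p
  have hpt := prof_le_of_le hK ht
  have hp0 := prof_nonneg K p.2
  have hp1 := prof_nonneg K 1
  have hinv : 1 / 3 * nsq p ≤ p.2⁻¹ * nsq p := by
    refine mul_le_mul_of_nonneg_right ?_ hs
    rw [one_div]; exact inv_anti₀ (by linarith) ht3
  have hφ : 2 * (coneWeight α m K a).fn p = -(1 / 4) * (p.2⁻¹ * nsq p) +
      2 * (a * (prof K p.2 * gauge' α m p)) := by rw [coneWeight_fn]; ring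
  have hpf : prof K p.2 * gauge' α m p ≤ prof K 1 * gauge' α m p :=
    mul_le_mul_of_nonneg_right hpt hf
  have hmain : rexp (2 * (coneWeight α m K a).fn p) ≤
      (rexp (4000 * a * prof K 1) + rexp (C - R ^ 2 / 64)) * rexp (-(3 / 64) * nsq p) := by
    rw [add_mul, ← Real.exp_add, ← Real.exp_add, hφ]
    have hap : 0 ≤ a * prof K 1 := mul_nonneg ha hp1
    rcases hbad with h | h | h
    · have h1 := mul_le_mul_of_nonneg_left (hpf.trans (mul_le_mul_of_nonneg_left h hp1)) ha
      refine le_add_of_le_of_nonneg (Real.exp_le_exp.2 ?_) (Real.exp_pos _).le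
      linarith
    · have h1 := mul_le_mul_of_nonneg_left
        (hpf.trans (mul_le_mul_of_nonneg_left (gauge'_le_rpow_nsq hα hm hx) hp1)) ha
      refine le_add_of_nonneg_of_le (Real.exp_pos _).le (Real.exp_le_exp.2 ?_)
      have h2 := hC _ hs
      linarith
    · rw [prof_eq_zero (by linarith) h]
      refine le_add_of_le_of_nonneg (Real.exp_le_exp.2 ?_) (Real.exp_pos _).le
      linarith
  have h2 := sq_one_add_le_exp hs
  refine (mul_le_mul hmain h2 (by positivity) (by positivity)).trans (le_of_eq ?_)
  rw [show -(1 / 32) * nsq p = -(3 / 64) * nsq p + nsq p / 64 by ring, Real.exp_add (-(3 / 64) * nsq p)]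
  ring

variable {ι V : Type*} [Fintype ι] [NormedAddCommGroup V] [NormedSpace ℝ V] {e : ι → V} {τ : V}

/-- The commutator with a tame cutoff is controlled by the energy density. -/
theorem Tame.sq_heat_mul_le {B c : ℝ} {g u : V → ℝ} {p : V} (hB : 1 ≤ B) (hg : Tame e τ B g p)
    (hu : ContDiffAt ℝ ∞ u p) (hc8 : c ≤ 1 / 8)
    (hL : |dir τ u p + lapl e u p| ≤ c * (√(gdot e u u p) + |u p|)) :
    (dir τ (fun p => g p * u p) p + lapl e (fun p => g p * u p) p) ^ 2 ≤
      13 * B ^ 2 * (gdot e u u p + u p ^ 2) := by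
  have hτ : dir τ (fun p => g p * u p) p = dir τ g p * u p + g p * dir τ u p :=
    dir_mul' (hg.contDiffAt.differentiableAt (by simp)) (hu.differentiableAt (by simp)) τ
  rw [hτ, lapl_mul hg.contDiffAt hu]
  obtain ⟨G, hG⟩ : ∃ G, G = gdot e u u p := ⟨_, rfl⟩
  have hG0 : 0 ≤ G := hG ▸ gdot_self_nonneg
  have h1 := hg.gdot_le
  have h2 := sq_gdot_le (e := e) (f := g) (g := u) (p := p)
  rw [← hG] at h2 hL ⊢
  have h3 : gdot e g u p ^ 2 ≤ B * G := h2.trans (mul_le_mul_of_nonneg_right h1 hG0)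
  have h4 : (dir τ u p + lapl e u p) ^ 2 ≤ 1 / 32 * (G + u p ^ 2) := by
    have a1 : |dir τ u p + lapl e u p| ≤ 1 / 8 * (√G + |u p|) :=
      hL.trans (mul_le_mul_of_nonneg_right hc8 (by positivity))
    have a2 := pow_le_pow_left₀ (abs_nonneg _) a1 2
    rw [sq_abs] at a2
    have a3 := Real.sq_sqrt hG0
    have a4 := sq_abs (u p)
    have a5 := sq_nonneg (√G - |u p|)
    linarith
  obtain ⟨l, hl⟩ : ∃ l, l = dir τ u p + lapl e u p := ⟨_, rfl⟩
  obtain ⟨k, hk⟩ : ∃ k, k = dir τ g p + lapl e g p := ⟨_, rfl⟩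
  have hk2 : k ^ 2 ≤ 4 * B ^ 2 := by
    have b1 := abs_le.1 hg.dir_le
    have b2 := abs_le.1 hg.lapl_le
    have := sq_le_sq' (show -(2 * B) ≤ k by linarith) (show k ≤ 2 * B by linarith)
    linarith
  have e1 : dir τ g p * u p + g p * dir τ u p + (g p * lapl e u p + u p * lapl e g p +
      2 * gdot e g u p) = g p * l + k * u p + 2 * gdot e g u p := by rw [hl, hk]; ring
  rw [e1]
  rw [← hl] at h4
  have h5 : (g p * l) ^ 2 ≤ l ^ 2 := by
    rw [mul_pow]
    have : g p ^ 2 ≤ 1 := (sq_le_one_iff_abs_le_one _).2 hg.abs_le_one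
    have := mul_le_mul_of_nonneg_right this (sq_nonneg l)
    linarith
  have h6 : (k * u p) ^ 2 ≤ 4 * B ^ 2 * u p ^ 2 := by
    rw [mul_pow]; exact mul_le_mul_of_nonneg_right hk2 (sq_nonneg _)
  have h7 : (g p * l + k * u p + 2 * gdot e g u p) ^ 2 ≤
      3 * ((g p * l) ^ 2 + (k * u p) ^ 2 + 4 * gdot e g u p ^ 2) := by
    have q1 := sq_nonneg (g p * l - k * u p)
    have q2 := sq_nonneg (g p * l - 2 * gdot e g u p)
    have q3 := sq_nonneg (k * u p - 2 * gdot e g u p)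
    linarith
  have hB2 : B ≤ B ^ 2 := by nlinarith
  have h8 := mul_le_mul_of_nonneg_right hB2 hG0
  have h9 := mul_le_mul_of_nonneg_right (show (1 : ℝ) ≤ B ^ 2 by nlinarith)
    (show 0 ≤ G + u p ^ 2 by positivity)
  linarith [mul_nonneg (sq_nonneg B) (sq_nonneg (u p)), mul_nonneg (sq_nonneg B) hG0]

theorem half_sq_le_of_heat_le {c : ℝ} {u : V → ℝ} {p : V} (hc8 : c ≤ 1 / 8)
    (hL : |dir τ u p + lapl e u p| ≤ c * (√(gdot e u u p) + |u p|)) :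
    1 / 2 * u p ^ 2 ≤ 1 / 2 * gdot e u u p + 1 * u p ^ 2 - (dir τ u p + lapl e u p) ^ 2 := by
  obtain ⟨G, hG⟩ : ∃ G, G = gdot e u u p := ⟨_, rfl⟩
  have hG0 : 0 ≤ G := hG ▸ gdot_self_nonneg
  rw [← hG] at hL ⊢
  have a1 : |dir τ u p + lapl e u p| ≤ 1 / 8 * (√G + |u p|) :=
    hL.trans (mul_le_mul_of_nonneg_right hc8 (by positivity))
  have a2 := pow_le_pow_left₀ (abs_nonneg _) a1 2
  rw [sq_abs] at a2
  have a3 := Real.sq_sqrt hG0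
  have a4 := sq_abs (u p)
  have a5 := sq_nonneg (√G - |u p|)
  have a6 := sq_nonneg (u p)
  linarith

end ConePointwise

section Bottom

variable {n : ℕ}

/-- The initial-time contribution of the time cutoff disappears when the data vanish. -/
theorem exists_abs_integral_le {M : ℝ} {Ω : Set (EuclideanSpace ℝ (Fin n) × ℝ)}
    {A : Set (EuclideanSpace ℝ (Fin n))} (hA : IsCompact A)
    (hAΩ : ∀ x ∈ A, ∀ t, 1 < t → t < 3 → (x, t) ∈ Ω)
    {u : EuclideanSpace ℝ (Fin n) × ℝ → ℝ} (hu : ContinuousOn u Ω) (hM : ∀ p ∈ Ω, |u p| ≤ M)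
    (h0 : ∀ x ∈ A, Tendsto (fun t => u (x, t)) (𝓝[>] 1) (𝓝 0)) {D η : ℝ} (hD : 0 ≤ D)
    (hη : 0 < η) :
    ∃ ε₀ > 0, ∀ ε, 0 < ε → ε < ε₀ → ∀ b : EuclideanSpace ℝ (Fin n) × ℝ → ℝ, Integrable b →
      (∀ p, p.1 ∉ A → b p = 0) → (∀ p, p.1 ∈ A → |b p| ≤ D * dir et (timeCut ε) p * u p ^ 2) →
      |∫ p, b p| ≤ η := by
  obtain ⟨S, hS1, hS⟩ := exists_step_bound
  obtain ⟨h, hh⟩ : ∃ h : ℝ → ℝ, h = fun t => ∫ x, A.indicator (fun x => u (x, t) ^ 2) x :=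
    ⟨_, rfl⟩
  have hcont : ∀ t, 1 < t → t < 3 → ContinuousOn (fun x => u (x, t) ^ 2) A := fun t h1 h3 =>
    (hu.comp (by fun_prop) fun x hx => hAΩ x hx t h1 h3).pow 2
  have hint : ∀ t, 1 < t → t < 3 → Integrable (A.indicator fun x => u (x, t) ^ 2) := fun t h1 h3 =>
    (integrable_indicator_iff hA.measurableSet).2 ((hcont t h1 h3).integrableOn_compact hA)
  have hev : ∀ᶠ t in 𝓝[>] (1 : ℝ), 1 < t ∧ t < 3 :=
    (eventually_mem_nhdsWithin).and (mem_nhdsWithin_of_mem_nhds (Iio_mem_nhds (by norm_num)))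
  have hlim : Tendsto h (𝓝[>] 1) (𝓝 0) := by
    have := tendsto_integral_filter_of_dominated_convergence (μ := volume) (l := 𝓝[>] (1 : ℝ))
      (F := fun t => A.indicator fun x => u (x, t) ^ 2) (f := fun _ => 0)
      (A.indicator fun _ => M ^ 2) (hev.mono fun t ht => (hint t ht.1 ht.2).aestronglyMeasurable)
      (hev.mono fun t ht => Eventually.of_forall fun x => ?_)
      ((integrable_indicator_iff hA.measurableSet).2 (continuousOn_const.integrableOn_compact hA))
      (Eventually.of_forall fun x => ?_)
    · rw [hh]; simpa using this
    · by_cases hx : x ∈ A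
      · simp only [hx, indicator_of_mem]
        rw [Real.norm_eq_abs, abs_pow, ← abs_of_nonneg ((abs_nonneg _).trans (hM _ (hAΩ x hx t ht.1 ht.2)))]
        exact pow_le_pow_left₀ (abs_nonneg _) ((hM _ (hAΩ x hx t ht.1 ht.2)).trans (le_abs_self _)) 2
      · simp [hx]
    · by_cases hx : x ∈ A
      · simpa [hx] using (h0 x hx).pow 2
      · simp [hx]
  have hSp : 0 < S := by linarith
  have hη' : 0 < η / (D * S + 1) := by positivity
  obtain ⟨δ, hδ, hδh⟩ := (mem_nhdsGT_iff_exists_Ioo_subset (a := (1 : ℝ))).1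
    ((hlim (Iio_mem_nhds hη')))
  have hδ1 : 1 < δ := hδ
  refine ⟨min ((δ - 1) / 2) 1, by simp; linarith, fun ε hε hεδ b hb hb0 hbD => ?_⟩
  have hε1 : 2 * ε < δ - 1 := by have := hεδ.trans_le (min_le_left _ _); linarith
  have hε2 : ε < 1 := hεδ.trans_le (min_le_right _ _)
  have key : ∀ t, |∫ x, b (x, t)| ≤ (Icc (1 + ε) (1 + 2 * ε)).indicator (fun _ => η / ε) t := by
    intro t
    by_cases ht : t ∈ Icc (1 + ε) (1 + 2 * ε)
    · rw [indicator_of_mem ht]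
      have t1 : 1 < t := by linarith [ht.1]
      have t3 : t < 3 := by linarith [ht.2]
      have htδ : h t < η / (D * S + 1) := hδh ⟨t1, by linarith [ht.2]⟩
      have hle : |∫ x, b (x, t)| ≤ ∫ x, D * (S / ε) * A.indicator (fun x => u (x, t) ^ 2) x := by
        rw [← Real.norm_eq_abs]
        refine norm_integral_le_of_norm_le ((hint t t1 t3).const_mul _)
          (Eventually.of_forall fun x => ?_)
        by_cases hx : x ∈ A
        · rw [indicator_of_mem hx, Real.norm_eq_abs]
          refine (hbD (x, t) hx).trans (mul_le_mul_of_nonneg_right ?_ (sq_nonneg _))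
          refine mul_le_mul_of_nonneg_left ?_ hD
          rw [dir_et_timeCut]
          exact div_le_div_of_nonneg_right ((le_abs_self _).trans (hS.1 _)) hε.le
        · rw [indicator_of_notMem hx, hb0 (x, t) hx]; simp
      rw [integral_const_mul, show (∫ x, A.indicator (fun x => u (x, t) ^ 2) x) = h t by rw [hh]]
        at hle
      refine hle.trans ?_
      have h1 : D * S * h t ≤ η := by
        have e1 : 0 ≤ D * S := by positivity
        have e2 := mul_le_mul_of_nonneg_left htδ.le e1
        have e3 : D * S * (η / (D * S + 1)) ≤ η := by
          rw [mul_div_assoc', div_le_iff₀ (by positivity)]; nlinarith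
        linarith
      rw [show D * (S / ε) * h t = D * S * h t / ε by ring]
      exact div_le_div_of_nonneg_right h1 hε.le
    · rw [indicator_of_notMem ht]
      have : ∀ x, b (x, t) = 0 := by
        intro x
        by_cases hx : x ∈ A
        · have h1 := hbD (x, t) hx
          have h2 : dir et (timeCut ε) (x, t) = 0 := by
            rw [dir_et_timeCut]
            have : deriv smoothTransition ((t - 1) / ε - 1) = 0 := by
              have a := deriv_eq_zero_outside (g := smoothTransition)
                (fun x hx => smoothTransition.zero_of_nonpos hx.le)
                (fun x hx => smoothTransition.one_of_one_le (le_of_lt hx))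
              rw [mem_Icc, not_and_or, not_le, not_le] at ht
              refine ht.elim (fun h => a.1 _ ?_) fun h => a.2 _ ?_
              · rw [sub_neg, div_lt_one hε]; linarith
              · rw [gt_iff_lt, lt_sub_iff_add_lt, lt_div_iff₀ hε]; linarith
            simp only [this, zero_div]
          rw [h2] at h1
          simpa using h1
        · exact hb0 (x, t) hx
      simp [this]
  rw [Measure.volume_eq_prod, integral_prod_symm _ hb, ← Real.norm_eq_abs]
  refine (norm_integral_le_of_norm_le (g := (Icc (1 + ε) (1 + 2 * ε)).indicator fun _ => η / ε) ?_
    (Eventually.of_forall key)).trans (le_of_eq ?_)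
  · exact (integrable_indicator_iff measurableSet_Icc).2 (continuousOn_const.integrableOn_compact isCompact_Icc)
  · rw [integral_indicator measurableSet_Icc, setIntegral_const]
    simp only [Real.volume_real_Icc_of_le (show 1 + ε ≤ 1 + 2 * ε by linarith), smul_eq_mul]
    field_simp
    ring

end Bottom

section ConeVanishing

variable {n : ℕ} [NeZero n]

/-- Carleman estimate with the cone weight, in the form of a pointwise lower bound by an
integrable function of nonpositive integral plus a bottom term. -/
theorem exists_cone_carleman {α m K a R ε : ℝ} (hα : 1 / 2 ≤ α) (hα1 : α ≤ 1) (hm : 0 < m)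
    (hm3 : 3 * m < 1) (hαm : 2 * m ≤ (2 * α - 1) * (1 - m)) (ha : 0 ≤ a)
    (hK : 10 + 2 * auxBound n α m ≤ K) (hKm : 13 ≤ 4 * (1 - 3 * m) * K) (hR : 1 ≤ R) (hε : 0 < ε)
    {Ω : Set (EuclideanSpace ℝ (Fin n) × ℝ)} (hΩ : IsOpen Ω)
    (hΩs : ∀ p : EuclideanSpace ℝ (Fin n) × ℝ, 0 < p.1 0 → 1 ≤ gauge' α m p → 1 < p.2 → p.2 < 5 →
      p ∈ Ω)
    {u U : EuclideanSpace ℝ (Fin n) × ℝ → ℝ} (hu : ContDiffOn ℝ ∞ u Ω)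
    (hU : U = fun p => timeCut (ε / 3) p * coneCut α m 1000 R 3 p * u p) :
    ∃ F b : EuclideanSpace ℝ (Fin n) × ℝ → ℝ, Integrable F ∧ Integrable b ∧ ∫ p, F p ≤ 0 ∧
      (∀ p, F p = timeCut ε p * (rexp (2 * (coneWeight α m K a).fn p) *
        (1 / 2 * gdot ex U U p + 1 * U p ^ 2 - (dir et U p + lapl ex U p) ^ 2)) - b p) ∧
      (∀ p, b p = dir et (timeCut ε) p * (rexp (2 * (coneWeight α m K a).fn p) *
        ((gdot ex (coneWeight α m K a).fn (coneWeight α m K a).fn p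
          - dir et (coneWeight α m K a).fn p) * U p ^ 2))) ∧
      (∀ p ∈ tsupport U, 1 ≤ p.1 0 ∧ 1000 ≤ gauge' α m p ∧ nsq p ≤ 2 * R ^ 2 ∧ 1 ≤ p.2 ∧ p.2 ≤ 3) := by
  have hα0 : 0 < α := by linarith
  have hcut : ContDiff ℝ ∞ fun p : EuclideanSpace ℝ (Fin n) × ℝ =>
      timeCut (ε / 3) p * coneCut α m 1000 R 3 p :=
    (contDiff_timeCut _).mul (contDiff_coneCut _ _ _ _ _)
  have hcs : ∀ p ∈ tsupport (fun p : EuclideanSpace ℝ (Fin n) × ℝ =>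
      timeCut (ε / 3) p * coneCut α m 1000 R 3 p), 1 + ε / 3 ≤ p.2 ∧ 1 ≤ p.1 0 ∧
        1000 ≤ gauge' α m p ∧ nsq p ≤ 2 * R ^ 2 ∧ p.2 ≤ 3 := fun p hp =>
    ⟨tsupport_timeCut_subset (by positivity) (tsupport_mul_subset_left hp),
      tsupport_coneCut_subset hα0 (by norm_num) (by linarith) (tsupport_mul_subset_right hp)⟩
  have hcsΩ : tsupport (fun p : EuclideanSpace ℝ (Fin n) × ℝ =>
      timeCut (ε / 3) p * coneCut α m 1000 R 3 p) ⊆ Ω := fun p hp => by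
    obtain ⟨h1, h2, h3, h4, h5⟩ := hcs p hp
    exact hΩs p (by linarith) (by linarith) (by linarith) (by linarith)
  have hUs : ContDiff ℝ ∞ U := hU ▸ contDiff_mul_of_tsupport hΩ hcut hu hcsΩ
  have hsub : ∀ p ∈ tsupport U, 1 + ε / 3 ≤ p.2 ∧ 1 ≤ p.1 0 ∧
        1000 ≤ gauge' α m p ∧ nsq p ≤ 2 * R ^ 2 ∧ p.2 ≤ 3 := fun p hp =>
    hcs p (tsupport_mul_subset_left (hU ▸ hp))
  have hUc : IsCompact (tsupport U) :=
    (isCompact_slab (2 * R ^ 2) 1 3).of_isClosed_subset (isClosed_tsupport U) fun p hp => by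
      obtain ⟨h1, h2, h3, h4, h5⟩ := hsub p hp
      exact ⟨h4, by linarith, h5⟩
  have hreg : tsupport U ⊆ coneRegion n := fun p hp => by
    obtain ⟨h1, h2, h3, h4, h5⟩ := hsub p hp
    have h6 := sq_coord_le_nsq p
    have h7 : 1 ≤ p.1 0 ^ 2 := one_le_pow₀ h2
    exact ⟨show 0 < p.2 by linarith, show 0 < p.1 0 by linarith, show 0 < nsq p by linarith⟩
  have hφ := contDiffOn_coneWeight (n := n) α m K a
  obtain ⟨φ, hφd⟩ : ∃ φ : EuclideanSpace ℝ (Fin n) × ℝ → ℝ, φ = (coneWeight α m K a).fn := ⟨_, rfl⟩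
  obtain ⟨b, hb⟩ : ∃ b : EuclideanSpace ℝ (Fin n) × ℝ → ℝ, b = fun p => dir et (timeCut ε) p *
    (rexp (2 * φ p) * ((gdot ex φ φ p - dir et φ p) * U p ^ 2)) := ⟨_, rfl⟩
  have hφ' : ContDiffOn ℝ ∞ φ (coneRegion n) := hφd ▸ hφ
  have c1 : ContinuousOn (fun p => rexp (2 * φ p)) (coneRegion n) :=
    Real.continuous_exp.comp_continuousOn (continuousOn_const.mul hφ'.continuousOn)
  have c2 := (ContDiffOn.gdot (e := ex) isOpen_coneRegion hφ' hφ').continuousOn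
  have c3 := (hφ'.dir isOpen_coneRegion et).continuousOn
  have c4 := hUs.continuous.continuousOn (s := coneRegion n)
  have c5 := ((contDiff_timeCut (n := n) ε).dir et).continuous.continuousOn (s := coneRegion n)
  have c6 := (contDiff_timeCut (n := n) ε).continuous.continuousOn (s := coneRegion n)
  have c7 := (ContDiff.gdot (e := ex) hUs hUs).continuous.continuousOn (s := coneRegion n)
  have c8 := ((hUs.dir et).add (ContDiff.lapl (e := ex) hUs)).continuous.continuousOn (s := coneRegion n)
  have hbc : ContinuousOn b (coneRegion n) := by
    rw [hb]; exact c5.mul (c1.mul ((c2.sub c3).mul (c4.pow 2)))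
  have hb0 : ∀ p ∉ tsupport U, b p = 0 := fun p hp => by
    rw [hb]; beta_reduce; rw [image_eq_zero_of_notMem_tsupport hp]; ring
  refine ⟨fun p => timeCut ε p * (rexp (2 * φ p) *
        (1 / 2 * gdot ex U U p + 1 * U p ^ 2 - (dir et U p + lapl ex U p) ^ 2)) - b p, b,
    integrable_of_continuousOn isOpen_coneRegion ?_ hUc hreg fun p hp => ?_,
    integrable_of_continuousOn isOpen_coneRegion hbc hUc hreg hb0, ?_, ?_, ?_, fun p hp => ?_⟩
  · exact (c6.mul (c1.mul (((continuousOn_const.mul c7).add (continuousOn_const.mul (c4.pow 2))).sub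
      (c8.pow 2)))).sub hbc
  · rw [hb0 p hp, gdot_eq_zero_of_notMem hp, dir_eq_zero_of_notMem hp, lapl_eq_zero_of_notMem hp,
      image_eq_zero_of_notMem_tsupport hp]
    ring
  · rw [hb, hφd]
    refine carleman (κ := 1) (κ₀ := 1) (e := ex) (τ := et) (ζ := timeCut ε) (q := (coneAux n α m K a).fn) volume isOpen_coneRegion
      (contDiff_timeCut ε) (dir_ex_timeCut ε) (timeCut_nonneg ε) (dir_et_timeCut_nonneg hε) hUs
      hUc hreg hφ (contDiffOn_coneAux n α m K a) zero_le_one (fun p hp _ ξ => ?_) fun p hp _ => ?_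
    · exact coneWeight_hess hα hα1 hm.le ha (hreg hp) ξ
    · obtain ⟨h1, h2, h3, h4, h5⟩ := hsub p hp
      have h6 := (two_le_coord hα hα1 hm.le (by linarith) (by linarith)).2
      exact coneWeight_zeroTerm hα hα1 hm hm3 hαm ha hK hKm (by linarith) h5 h2
        (by linarith [sq_coord_le_nsq p]) (by linarith)
  · intro p; rw [hφd]
  · intro p; rw [hb, hφd]
  · obtain ⟨h1, h2, h3, h4, h5⟩ := hsub p hp
    exact ⟨h2, h3, h4, by linarith, h5⟩

/-- The integrand of the Carleman inequality is bounded below up to the energy density. -/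
theorem cone_carleman_lower {α m K a C R ε B c : ℝ} (hα : 1 / 2 ≤ α) (hα1 : α ≤ 1) (hm : 0 ≤ m)
    (hK : 1 ≤ K) (ha : 0 ≤ a)
    (hC : ∀ s, 0 ≤ s → 2 * a * prof K 1 * s ^ α ≤ 1 / 48 * s + C) (hR : 1 ≤ R) (hε : 0 < ε)
    {Ω : Set (EuclideanSpace ℝ (Fin n) × ℝ)} (hΩ : IsOpen Ω)
    (hΩs : ∀ p : EuclideanSpace ℝ (Fin n) × ℝ, 0 < p.1 0 → 1 ≤ gauge' α m p → 1 < p.2 → p.2 < 5 →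
      p ∈ Ω)
    {u U : EuclideanSpace ℝ (Fin n) × ℝ → ℝ} (hu : ContDiffOn ℝ ∞ u Ω) (hc8 : c ≤ 1 / 8)
    (hL : ∀ p ∈ Ω, |dir et u p + lapl ex u p| ≤ c * (√(gdot ex u u p) + |u p|))
    (hU : U = fun p => timeCut (ε / 3) p * coneCut α m 1000 R 3 p * u p)
    (hUs : ∀ p ∈ tsupport U,
      1 ≤ p.1 0 ∧ 1000 ≤ gauge' α m p ∧ nsq p ≤ 2 * R ^ 2 ∧ 1 ≤ p.2 ∧ p.2 ≤ 3)
    (hB : 1 ≤ B) (hT : ∀ p : EuclideanSpace ℝ (Fin n) × ℝ, 1 ≤ p.1 0 →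
      Tame ex et (B * (1 + nsq p)) (coneCut α m 1000 R 3) p)
    (p : EuclideanSpace ℝ (Fin n) × ℝ) :
    (0 < p.1 0 → 2000 < gauge' α m p → nsq p < R ^ 2 → p.2 < 2 → 1 + 2 * ε ≤ p.2 →
      1 / 2 * (rexp (2 * (coneWeight α m K a).fn p) * u p ^ 2) ≤
      timeCut ε p * (rexp (2 * (coneWeight α m K a).fn p) *
        (1 / 2 * gdot ex U U p + 1 * U p ^ 2 - (dir et U p + lapl ex U p) ^ 2))) ∧
    -(13 * B ^ 2 * 128 ^ 2 * (rexp (4000 * a * prof K 1) + rexp (C - R ^ 2 / 64)) * (timeCut ε p *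
      (coneCut α m 500 (2 * R) 4 p * rexp (-(1 / 32) * nsq p)) * (gdot ex u u p + u p ^ 2))) ≤
      timeCut ε p * (rexp (2 * (coneWeight α m K a).fn p) *
        (1 / 2 * gdot ex U U p + 1 * U p ^ 2 - (dir et U p + lapl ex U p) ^ 2)) := by
  have hα0 : 0 < α := by linarith
  have hz := timeCut_nonneg ε p
  have hE := (Real.exp_pos (2 * (coneWeight α m K a).fn p)).le
  have hsnd : Continuous fun p : EuclideanSpace ℝ (Fin n) × ℝ => p.2 := continuous_snd
  have hfst : Continuous fun p : EuclideanSpace ℝ (Fin n) × ℝ => p.1 0 := by fun_prop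
  have hnsq : Continuous (nsq (n := n)) := contDiff_nsq.continuous
  have htloc : 1 + ε < p.2 → ∀ᶠ q in 𝓝 p, timeCut (ε / 3) q = 1 := fun h => by
    filter_upwards [hsnd.continuousAt.eventually (Ioi_mem_nhds h)] with q hq
    exact timeCut_eq_one (by positivity) (by have : 1 + ε < q.2 := hq; linarith)
  have hgood : 0 < p.1 0 → 2000 < gauge' α m p → nsq p < R ^ 2 → p.2 < 2 → 1 + ε < p.2 →
      1 / 2 * u p ^ 2 ≤ 1 / 2 * gdot ex U U p + 1 * U p ^ 2 - (dir et U p + lapl ex U p) ^ 2 := by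
    intro h1 h2 h3 h4 h5
    have hUu : U =ᶠ[𝓝 p] u := by
      filter_upwards [htloc h5, hfst.continuousAt.eventually (Ioi_mem_nhds h1),
        (continuous_gauge' hα0 m).continuousAt.eventually (Ioi_mem_nhds h2),
        hnsq.continuousAt.eventually (Iio_mem_nhds h3),
        hsnd.continuousAt.eventually (Iio_mem_nhds h4)] with q q0 q1 q2 q3 q4
      have q1 : 0 < q.1 0 := q1
      have q2 : 2000 < gauge' α m q := q2
      have q3 : nsq q < R ^ 2 := q3
      have q4 : q.2 < 2 := q4
      rw [hU]; beta_reduce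
      rw [q0, coneCut_eq_one (two_le_coord hα hα1 hm q1 (by linarith)).1 (by norm_num)
        (by linarith) (by linarith) q3.le (by linarith)]
      ring
    rw [gdot_congr hUu hUu, hUu.eq_of_nhds, (dir_congr hUu et).eq_of_nhds, lapl_congr hUu]
    exact half_sq_le_of_heat_le hc8 (hL p (hΩs p h1 (by linarith) (by linarith) (by linarith)))
  have hG0 : 0 ≤ gdot ex u u p + u p ^ 2 := add_nonneg gdot_self_nonneg (sq_nonneg _)
  refine ⟨fun h1 h2 h3 h4 h5 => ?_, ?_⟩
  · rw [timeCut_eq_one hε h5, one_mul]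
    have := mul_le_mul_of_nonneg_left (hgood h1 h2 h3 h4 (by linarith)) hE
    linarith
  have hrhs : 0 ≤ 13 * B ^ 2 * 128 ^ 2 * (rexp (4000 * a * prof K 1) + rexp (C - R ^ 2 / 64)) *
      (timeCut ε p * (coneCut α m 500 (2 * R) 4 p * rexp (-(1 / 32) * nsq p)) *
        (gdot ex u u p + u p ^ 2)) := by
    have := coneCut_nonneg α m 500 (2 * R) 4 p
    positivity
  by_cases hp : p ∈ tsupport U
  swap
  · rw [gdot_eq_zero_of_notMem hp, dir_eq_zero_of_notMem hp, lapl_eq_zero_of_notMem hp,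
      image_eq_zero_of_notMem_tsupport hp]
    linarith
  obtain ⟨s1, s2, s3, s4, s5⟩ := hUs p hp
  by_cases h5 : 1 + ε < p.2
  swap
  · rw [timeCut_eq_zero hε (not_lt.1 h5)] at hrhs ⊢
    linarith
  by_cases hg : 2000 < gauge' α m p ∧ nsq p < R ^ 2 ∧ p.2 < 2
  · have h := hgood (by linarith) hg.1 hg.2.1 hg.2.2 h5
    have h' : 0 ≤ 1 / 2 * gdot ex U U p + 1 * U p ^ 2 - (dir et U p + lapl ex U p) ^ 2 :=
      le_trans (by positivity) h
    exact (neg_nonpos.2 hrhs).trans (by positivity)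
  have hbad : gauge' α m p ≤ 2000 ∨ R ^ 2 ≤ nsq p ∨ 2 ≤ p.2 := by
    by_contra! h; exact hg h
  have hUu : U =ᶠ[𝓝 p] fun p => coneCut α m 1000 R 3 p * u p := by
    filter_upwards [htloc h5] with q q0
    rw [hU]; beta_reduce; rw [q0, one_mul]
  have hpΩ := hΩs p (by linarith) (by linarith) (by linarith) (by linarith)
  have hheat := (hT p s1).sq_heat_mul_le
    (one_le_mul_of_one_le_of_one_le hB (by linarith [nsq_nonneg p]))
    (hu.contDiffAt (hΩ.mem_nhds hpΩ)) hc8 (hL p hpΩ)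
  rw [← (dir_congr hUu et).eq_of_nhds, ← lapl_congr hUu] at hheat
  have hw := exp_coneWeight_le hα0.le hm hK ha hC s4 s5 (by linarith) (by linarith) hbad
  rw [coneCut_eq_one (two_le_coord hα hα1 hm (by linarith) (by linarith)).1 (by norm_num)
    (by linarith) (by linarith) (by nlinarith) (by linarith), one_mul]
  have hUU : 0 ≤ gdot ex U U p := gdot_self_nonneg
  have k1 := mul_le_mul_of_nonneg_left hheat hE
  have k2 := mul_le_mul_of_nonneg_right hw
    (mul_nonneg (show 0 ≤ 13 * B ^ 2 by positivity) hG0)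
  have k3 : 0 ≤ rexp (2 * (coneWeight α m K a).fn p) * (1 / 2 * gdot ex U U p + 1 * U p ^ 2) := by
    positivity
  have k4 : -(13 * B ^ 2 * 128 ^ 2 * (rexp (4000 * a * prof K 1) + rexp (C - R ^ 2 / 64)) *
      (rexp (-(1 / 32) * nsq p) * (gdot ex u u p + u p ^ 2))) ≤
      rexp (2 * (coneWeight α m K a).fn p) *
        (1 / 2 * gdot ex U U p + 1 * U p ^ 2 - (dir et U p + lapl ex U p) ^ 2) := by
    linarith
  have k5 := mul_le_mul_of_nonneg_left k4 hz
  linarith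

end ConeVanishing

section ConeVanishing

variable {n : ℕ} [NeZero n]

theorem isCompact_cone_section {α : ℝ} (hα : 0 < α) (m r l : ℝ) :
    IsCompact {x : EuclideanSpace ℝ (Fin n) | ‖x‖ ^ 2 ≤ r ∧ 1 ≤ x 0 ∧ l ≤ gauge' α m (x, (0 : ℝ))} := by
  refine (isCompact_closedBall (0 : EuclideanSpace ℝ (Fin n)) (√r)).of_isClosed_subset ?_ ?_
  · have h1 : Continuous fun x : EuclideanSpace ℝ (Fin n) => x 0 := by fun_prop
    have h0 : Continuous fun x : EuclideanSpace ℝ (Fin n) => ‖x‖ ^ 2 := by fun_prop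
    have h2 : Continuous fun x : EuclideanSpace ℝ (Fin n) => gauge' α m (x, (0 : ℝ)) :=
      (continuous_gauge' hα m).comp (by fun_prop)
    exact (isClosed_le h0 continuous_const).inter
      ((isClosed_le continuous_const h1).inter (isClosed_le continuous_const h2))
  · rintro x ⟨h, -⟩
    simpa using Real.le_sqrt_of_sq_le h

theorem exists_bottom_coeff_bound (α m K a R : ℝ) : ∃ D, 0 ≤ D ∧
    ∀ p : EuclideanSpace ℝ (Fin n) × ℝ, 1 ≤ p.1 0 → nsq p ≤ 2 * R ^ 2 → 1 ≤ p.2 → p.2 ≤ 3 →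
      |rexp (2 * (coneWeight α m K a).fn p) * (gdot ex (coneWeight α m K a).fn
        (coneWeight α m K a).fn p - dir et (coneWeight α m K a).fn p)| ≤ D := by
  obtain ⟨φ, hφ⟩ : ∃ φ : EuclideanSpace ℝ (Fin n) × ℝ → ℝ, φ = (coneWeight α m K a).fn := ⟨_, rfl⟩
  rw [← hφ]
  have hfst : Continuous fun p : EuclideanSpace ℝ (Fin n) × ℝ => p.1 0 := by fun_prop
  have hcpt : IsCompact {p : EuclideanSpace ℝ (Fin n) × ℝ |
      (nsq p ≤ 2 * R ^ 2 ∧ 1 ≤ p.2 ∧ p.2 ≤ 3) ∧ 1 ≤ p.1 0} :=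
    (isCompact_slab (2 * R ^ 2) 1 3).inter_right (isClosed_le continuous_const hfst)
  have hφc : ContDiffOn ℝ ∞ φ (coneRegion n) := hφ ▸ contDiffOn_coneWeight α m K a
  have hcont : ContinuousOn (fun p => rexp (2 * φ p) * (gdot ex φ φ p - dir et φ p))
      (coneRegion n) :=
    (Real.continuous_exp.comp_continuousOn (continuousOn_const.mul hφc.continuousOn)).mul
      ((ContDiffOn.gdot isOpen_coneRegion hφc hφc).continuousOn.sub
        (hφc.dir isOpen_coneRegion et).continuousOn)
  obtain ⟨D, hD⟩ := hcpt.exists_bound_of_continuousOn (hcont.mono fun p hp => by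
    obtain ⟨⟨h1, h2, h3⟩, h4⟩ := hp
    have h6 := sq_coord_le_nsq p
    have h7 : 1 ≤ p.1 0 ^ 2 := one_le_pow₀ h4
    exact ⟨show 0 < p.2 by linarith, show 0 < p.1 0 by linarith, show 0 < nsq p by linarith⟩)
  exact ⟨max D 0, le_max_right _ _, fun p h1 h2 h3 h4 =>
    (hD p ⟨⟨h2, h3, h4⟩, h1⟩).trans (le_max_left _ _)⟩

set_option maxHeartbeats 1000000 in
/-- Bounded solutions in the cone with vanishing initial data vanish far from the boundary for a
short time. -/
theorem exists_vanishing_far {α m M c : ℝ} (hα : 1 / 2 ≤ α) (hα1 : α < 1) (hm : 0 < m)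
    (hm3 : 3 * m < 1) (hαm : 2 * m ≤ (2 * α - 1) * (1 - m)) (hc : 0 ≤ c) (hc8 : c ≤ 1 / 8)
    {Ω : Set (EuclideanSpace ℝ (Fin n) × ℝ)} (hΩ : IsOpen Ω)
    (hΩs : ∀ p : EuclideanSpace ℝ (Fin n) × ℝ, 0 < p.1 0 → 1 ≤ gauge' α m p → 1 < p.2 → p.2 < 5 →
      p ∈ Ω)
    {u : EuclideanSpace ℝ (Fin n) × ℝ → ℝ} (hu : ContDiffOn ℝ ∞ u Ω) (hM : ∀ p ∈ Ω, |u p| ≤ M)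
    (hL : ∀ p ∈ Ω, |dir et u p + lapl ex u p| ≤ c * (√(gdot ex u u p) + |u p|))
    (h0 : ∀ x : EuclideanSpace ℝ (Fin n), 0 < x 0 → 1 ≤ gauge' α m (x, (0 : ℝ)) →
      Tendsto (fun t => u (x, t)) (𝓝[>] 1) (𝓝 0)) :
    ∃ f₁, ∀ p : EuclideanSpace ℝ (Fin n) × ℝ, 0 < p.1 0 → f₁ < gauge' α m p → 1 < p.2 →
      p.2 < 3 / 2 → u p = 0 := by
  have hα0 : 0 < α := by linarith
  obtain ⟨B, hB, hT⟩ := exists_tame_coneCut n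
  obtain ⟨W, hW, hen⟩ := exists_energy_bound hα hα1.le hm.le (by linarith) hc hΩ hΩs hu hM hL
  obtain ⟨K, hK, hKm, hK1⟩ : ∃ K, 10 + 2 * auxBound n α m ≤ K ∧ 13 ≤ 4 * (1 - 3 * m) * K ∧ 1 ≤ K := by
    have := auxBound_nonneg n α m
    refine ⟨10 + 2 * auxBound n α m + 13 / (4 * (1 - 3 * m)), ?_, ?_, ?_⟩
    · have : 0 ≤ 13 / (4 * (1 - 3 * m)) := div_nonneg (by norm_num) (by linarith)
      linarith
    · have h3 : 0 < 4 * (1 - 3 * m) := by linarith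
      have : 4 * (1 - 3 * m) * (13 / (4 * (1 - 3 * m))) = 13 := mul_div_cancel₀ _ h3.ne'
      have : 0 ≤ 4 * (1 - 3 * m) * (10 + 2 * auxBound n α m) := by positivity
      linarith
    · have : 0 ≤ 13 / (4 * (1 - 3 * m)) := div_nonneg (by norm_num) (by linarith)
      linarith
  have hK0 : 0 < K := by linarith
  have hp1 : 0 < prof K 1 := prof_pos hK0 (by norm_num)
  have hp2 : 0 < prof K (3 / 2) := prof_pos hK0 (by norm_num)
  have hp12 : prof K (3 / 2) ≤ prof K 1 := prof_le_of_le hK1 (by norm_num)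
  have hf1 : 8000 ≤ 8000 * prof K 1 / prof K (3 / 2) := by
    rw [le_div_iff₀ hp2]; linarith
  refine ⟨8000 * prof K 1 / prof K (3 / 2), fun p₁ hx₁ hf₁ ht₁ ht₁' => ?_⟩
  by_contra hne
  have hpΩ := hΩs p₁ hx₁ (by linarith) ht₁ (by linarith)
  -- a ball on which `u` is bounded below
  have hu2 : 0 < u p₁ ^ 2 / 2 := by positivity
  have hnsq : Continuous (nsq (n := n)) := contDiff_nsq.continuous
  have hfst : Continuous fun p : EuclideanSpace ℝ (Fin n) × ℝ => p.1 0 := by fun_prop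
  have hev : ∀ᶠ p in 𝓝 p₁, u p₁ ^ 2 / 2 < u p ^ 2 ∧ 0 < p.1 0 ∧
      8000 * prof K 1 / prof K (3 / 2) < gauge' α m p ∧ (1 + p₁.2) / 2 < p.2 ∧ p.2 < 3 / 2 ∧
      nsq p < nsq p₁ + 1 := by
    have hc1 := ((hu.contDiffAt (hΩ.mem_nhds hpΩ)).continuousAt.pow 2).eventually
      (Ioi_mem_nhds (half_lt_self (show 0 < u p₁ ^ 2 by positivity)))
    filter_upwards [hc1, hfst.continuousAt.eventually (Ioi_mem_nhds hx₁),
      (continuous_gauge' hα0 m).continuousAt.eventually (Ioi_mem_nhds hf₁),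
      continuous_snd.continuousAt.eventually (Ioi_mem_nhds (show (1 + p₁.2) / 2 < p₁.2 by linarith)),
      continuous_snd.continuousAt.eventually (Iio_mem_nhds ht₁'),
      hnsq.continuousAt.eventually (Iio_mem_nhds (show nsq p₁ < nsq p₁ + 1 by linarith))]
      with p a1 a2 a3 a4 a5 a6
    exact ⟨a1, a2, a3, a4, a5, a6⟩
  obtain ⟨r, hr, hball⟩ := Metric.eventually_nhds_iff_ball.1 hev
  obtain ⟨S, hS⟩ : ∃ S, S = nsq p₁ + 1 := ⟨_, rfl⟩
  have hS0 : 0 ≤ S := by have := nsq_nonneg p₁; linarith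
  obtain ⟨v, hv⟩ : ∃ v, v = volume.real (Metric.ball p₁ r) := ⟨_, rfl⟩
  have hv0 : 0 < v := by
    rw [hv]
    exact ENNReal.toReal_pos (Metric.measure_ball_pos volume p₁ hr).ne' measure_ball_lt_top.ne
  obtain ⟨G, hG⟩ : ∃ G, G = ∫ p, slabGauss (n := n) p := ⟨_, rfl⟩
  have hG0 : 0 ≤ G := hG ▸ integral_nonneg slabGauss_nonneg
  obtain ⟨Q, hQ⟩ : ∃ Q, Q = 13 * B ^ 2 * 128 ^ 2 := ⟨_, rfl⟩
  have hQ0 : 0 ≤ Q := by rw [hQ]; positivity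
  obtain ⟨k, hk⟩ : ∃ k, k = 1 / 2 * (rexp (-(S / 4)) * (u p₁ ^ 2 / 2)) := ⟨_, rfl⟩
  have hk0 : 0 < k := by rw [hk]; positivity
  -- choice of the large parameter
  obtain ⟨a, ha, haE⟩ : ∃ a, 0 ≤ a ∧ 2 * (Q * W * G) + 2 ≤ rexp (12000 * a * prof K 1) * (k * v) := by
    have h := (Real.tendsto_exp_atTop.comp
      (tendsto_id.const_mul_atTop (show 0 < 12000 * prof K 1 by positivity))).eventually_ge_atTop
        ((2 * (Q * W * G) + 2) / (k * v))
    obtain ⟨a, h1, h2⟩ := (h.and (eventually_ge_atTop 0)).exists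
    refine ⟨a, h2, ?_⟩
    rw [div_le_iff₀ (by positivity)] at h1
    simpa [mul_right_comm, mul_assoc, mul_comm (prof K 1) a] using h1
  obtain ⟨C, hC⟩ := exists_rpow_le hα0.le hα1 (show 0 ≤ 2 * a * prof K 1 by positivity)
    (show (0 : ℝ) < 1 / 48 by norm_num)
  obtain ⟨R, hR, hRS, hRC⟩ : ∃ R, 1 ≤ R ∧ S ≤ R ^ 2 ∧ C - R ^ 2 / 64 ≤ 0 := by
    refine ⟨1 + S + 64 * |C|, ?_, ?_, ?_⟩
    · have := abs_nonneg C; linarith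
    · have := abs_nonneg C; nlinarith
    · have := abs_nonneg C; have := le_abs_self C; nlinarith
  obtain ⟨φ, hφ⟩ : ∃ φ : EuclideanSpace ℝ (Fin n) × ℝ → ℝ, φ = (coneWeight α m K a).fn := ⟨_, rfl⟩
  -- the bottom term
  have hA := isCompact_cone_section (n := n) hα0 m (2 * R ^ 2) 1000
  have hgauge : ∀ p : EuclideanSpace ℝ (Fin n) × ℝ, gauge' α m (p.1, (0 : ℝ)) = gauge' α m p :=
    fun p => rfl
  obtain ⟨D, hD0, hD⟩ := exists_bottom_coeff_bound (n := n) α m K a R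
  rw [← hφ] at hD
  obtain ⟨ε₀, hε₀, hbot⟩ := exists_abs_integral_le (Ω := Ω) (M := M) (u := u) hA
    (fun x hx t h1 h3 => hΩs (x, t) (by have := hx.2.1; simpa using by linarith)
      (by have := hx.2.2; rw [← hgauge]; linarith) h1 (by simpa using by linarith))
    hu.continuousOn hM (fun x hx => h0 x (by linarith [hx.2.1]) (by linarith [hx.2.2])) hD0 one_pos
  obtain ⟨ε, hε, hεε, hεt⟩ : ∃ ε, 0 < ε ∧ ε < ε₀ ∧ 1 + 2 * ε ≤ (1 + p₁.2) / 2 := by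
    have h : 0 < min ε₀ ((p₁.2 - 1) / 4) := lt_min hε₀ (by linarith)
    refine ⟨min ε₀ ((p₁.2 - 1) / 4) / 2, by linarith, ?_, ?_⟩
    · have := min_le_left ε₀ ((p₁.2 - 1) / 4); linarith
    · have := min_le_right ε₀ ((p₁.2 - 1) / 4); linarith
  obtain ⟨U, hU⟩ : ∃ U : EuclideanSpace ℝ (Fin n) × ℝ → ℝ,
    U = fun p => timeCut (ε / 3) p * coneCut α m 1000 R 3 p * u p := ⟨_, rfl⟩
  obtain ⟨F, b, hF, hb, hFint, hFe, hbe, hUs⟩ :=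
    exists_cone_carleman hα hα1.le hm hm3 hαm ha hK hKm hR hε hΩ hΩs hu hU
  obtain ⟨J, hJ, hJint, hJe⟩ := hen (2 * R) ε (by linarith) hε
  have hlow := cone_carleman_lower hα hα1.le hm.le hK1 ha hC hR hε hΩ hΩs hu hc8 hL hU hUs hB
    (fun p hp => hT hα hα1.le hm.le (by linarith) (by norm_num) hR hp)
  obtain ⟨Γ, hΓ⟩ : ∃ Γ, Γ = rexp (4000 * a * prof K 1) + rexp (C - R ^ 2 / 64) := ⟨_, rfl⟩
  have hΓ0 : 0 ≤ Γ := by rw [hΓ]; positivity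
  have hbb : |∫ p, b p| ≤ 1 := by
    refine hbot ε hε hεε b hb (fun p hp => ?_) fun p hp => ?_
    · have : U p = 0 := by
        by_contra h
        obtain ⟨s1, s2, s3, s4, s5⟩ := hUs p (subset_tsupport U h)
        exact hp ⟨s3, s1, s2⟩
      rw [hbe, this]; ring
    · by_cases hpU : p ∈ tsupport U
      · obtain ⟨s1, s2, s3, s4, s5⟩ := hUs p hpU
        have hd := dir_et_timeCut_nonneg hε p
        have hUu : U p ^ 2 ≤ u p ^ 2 := by
          have t1 := timeCut_le_one (ε / 3) p
          have t2 := (abs_le.1 (hT (R := R) (T := 3) hα hα1.le hm.le (by linarith)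
            (by norm_num : (1 : ℝ) ≤ 1000) hR s1).abs_le_one).2
          have t3 := mul_le_one₀ t1 (coneCut_nonneg α m 1000 R 3 p) t2
          have t4 := mul_nonneg (timeCut_nonneg (ε / 3) p) (coneCut_nonneg α m 1000 R 3 p)
          rw [hU]; beta_reduce; rw [mul_pow]
          exact mul_le_of_le_one_left (sq_nonneg _) (pow_le_one₀ t4 t3)
        rw [hbe, ← hφ, show dir et (timeCut ε) p * (rexp (2 * φ p) * ((gdot ex φ φ p - dir et φ p) *
          U p ^ 2)) = dir et (timeCut ε) p * ((rexp (2 * φ p) * (gdot ex φ φ p - dir et φ p)) *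
          U p ^ 2) by ring, abs_mul, abs_mul, abs_of_nonneg hd, abs_of_nonneg (sq_nonneg (U p)),
          mul_comm D, mul_assoc]
        exact mul_le_mul_of_nonneg_left (mul_le_mul (hD p s1 s3 s4 s5) hUu (sq_nonneg _) hD0) hd
      · rw [hbe, image_eq_zero_of_notMem_tsupport hpU]
        have := dir_et_timeCut_nonneg hε p
        simp; positivity
  have hpt : ∀ p, (Metric.ball p₁ r).indicator (fun _ => rexp (16000 * a * prof K 1) * k) p ≤
      F p + b p + Q * Γ * (J p + W * slabGauss p) := by
    intro p
    obtain ⟨l1, l2⟩ := hlow p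
    rw [← hΓ, ← hQ] at l2
    have l3 : 0 ≤ Q * Γ * (timeCut ε p * (coneCut α m 500 (2 * R) 4 p *
        rexp (-(1 / 32) * nsq p)) * (gdot ex u u p + u p ^ 2)) := by
      have := coneCut_nonneg α m 500 (2 * R) 4 p
      have := timeCut_nonneg ε p
      have := gdot_self_nonneg (e := ex) (f := u) (p := p)
      positivity
    have l4 := mul_le_mul_of_nonneg_left (hJe p) (mul_nonneg hQ0 hΓ0)
    have l5 := hFe p
    by_cases hp : p ∈ Metric.ball p₁ r
    · rw [indicator_of_mem hp]
      obtain ⟨b1, b2, b3, b4, b5, b6⟩ := hball p hp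
      have l6 := l1 b2 (by linarith) (by linarith) (by linarith) (by linarith)
      have l7 : rexp (16000 * a * prof K 1) * k ≤
          1 / 2 * (rexp (2 * (coneWeight α m K a).fn p) * u p ^ 2) := by
        have e1 : rexp (16000 * a * prof K 1) * rexp (-(S / 4)) ≤
            rexp (2 * (coneWeight α m K a).fn p) := by
          rw [← Real.exp_add, coneWeight_fn]
          refine Real.exp_le_exp.2 ?_
          have c1 : p.2⁻¹ * nsq p ≤ 1 * S :=
            mul_le_mul (inv_le_one_of_one_le₀ (by linarith)) (by linarith) (nsq_nonneg _) zero_le_one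
          have c2 : 8000 * prof K 1 ≤ prof K p.2 * gauge' α m p := by
            have d1 := prof_le_of_le hK1 b5.le
            have d2 := (div_lt_iff₀ hp2).1 b3
            have d3 := mul_le_mul_of_nonneg_right d1 (show 0 ≤ gauge' α m p by linarith)
            linarith
          have c3 := mul_le_mul_of_nonneg_left c2 ha
          linarith
        have e2 := mul_le_mul e1 b1.le hu2.le (Real.exp_pos _).le
        calc rexp (16000 * a * prof K 1) * k = 1 / 2 * (rexp (16000 * a * prof K 1) *
              rexp (-(S / 4)) * (u p₁ ^ 2 / 2)) := by rw [hk]; ring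
          _ ≤ _ := mul_le_mul_of_nonneg_left e2 (by norm_num)
      linarith
    · rw [indicator_of_notMem hp]
      linarith
  have hind : Integrable ((Metric.ball p₁ r).indicator fun _ => rexp (16000 * a * prof K 1) * k) :=
    (integrable_indicator_iff measurableSet_ball).2
      (integrableOn_const (hs := measure_ball_lt_top.ne))
  have hJW : Integrable fun p => J p + W * slabGauss p := hJ.add (integrable_slabGauss.const_mul W)
  have hFb : Integrable fun p => F p + b p := hF.add hb
  have hfin := integral_mono hind (hFb.add (hJW.const_mul (Q * Γ))) hpt
  rw [integral_indicator measurableSet_ball, setIntegral_const, smul_eq_mul, ← hv] at hfin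
  rw [integral_add' hFb (hJW.const_mul (Q * Γ)), integral_add hF hb, integral_const_mul,
    integral_add hJ (integrable_slabGauss.const_mul W), integral_const_mul, ← hG] at hfin
  have hb1 := (abs_le.1 hbb).2
  have hE1 : 1 ≤ rexp (4000 * a * prof K 1) := Real.one_le_exp (by positivity)
  have hΓ2 : Γ ≤ 2 * rexp (4000 * a * prof K 1) := by
    have : rexp (C - R ^ 2 / 64) ≤ 1 := Real.exp_le_one_iff.2 hRC
    linarith
  have g1 : Q * Γ * (∫ p, J p) ≤ 0 := mul_nonpos_of_nonneg_of_nonpos (mul_nonneg hQ0 hΓ0) hJint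
  have g2 := mul_le_mul_of_nonneg_right hΓ2 (show 0 ≤ Q * W * G by positivity)
  have g3 := mul_le_mul_of_nonneg_left haE (Real.exp_pos (4000 * a * prof K 1)).le
  have g4 : rexp (16000 * a * prof K 1) =
      rexp (4000 * a * prof K 1) * rexp (12000 * a * prof K 1) := by
    rw [← Real.exp_add]; congr 1; ring
  rw [g4] at hfin
  linarith

end ConeVanishing

section Lateral

theorem hasDerivAt_lin_mul_exp (b c t : ℝ) : HasDerivAt (fun s : ℝ => (b + c * s) * rexp (-2 * s))
    ((c - 2 * b + -2 * c * t) * rexp (-2 * t)) t := by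
  have h1 : HasDerivAt (fun s : ℝ => b + c * s) c t :=
    ((hasDerivAt_id t).const_mul c).const_add b |>.congr_deriv (mul_one c)
  have h2 : HasDerivAt (fun s : ℝ => rexp (-2 * s)) (rexp (-2 * t) * (-2)) t :=
    ((hasDerivAt_id t).const_mul (-2)).exp.congr_deriv (by simp)
  exact (h1.mul h2).congr_deriv (by ring)

/-- Profiles of the weight used for unique continuation across spheres. -/
noncomputable def ballWeight (K t₀ a : ℝ) : SepData univ univ univ where
  k₀ t := -(a * K) * (t - t₀) ^ 2
  k₀' t := -(2 * a * K) * (t - t₀)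
  k₀'' _ := -(2 * a * K)
  k₁ _ := 0
  k₁' _ := 0
  k₁'' _ := 0
  k₂ _ := a
  k₂' _ := 0
  k₂'' _ := 0
  g _ := 0
  g' _ := 0
  g'' _ := 0
  h s := (1 + 0 * s) * rexp (-2 * s)
  h' s := (-2 + 0 * s) * rexp (-2 * s)
  h'' s := (4 + 0 * s) * rexp (-2 * s)
  hk₀ t _ := ((((hasDerivAt_id t).sub_const t₀).pow 2).const_mul (-(a * K))).congr_deriv
    (by simp; ring)
  hk₀' t _ := (((hasDerivAt_id t).sub_const t₀).const_mul (-(2 * a * K))).congr_deriv (mul_one _)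
  hk₁ t _ := hasDerivAt_const t _
  hk₁' t _ := hasDerivAt_const t _
  hk₂ t _ := hasDerivAt_const t _
  hk₂' t _ := hasDerivAt_const t _
  hg t _ := hasDerivAt_const t _
  hg' t _ := hasDerivAt_const t _
  hh s _ := (hasDerivAt_lin_mul_exp 1 0 s).congr_deriv (by ring)
  hh' s _ := (hasDerivAt_lin_mul_exp (-2) 0 s).congr_deriv (by ring)

/-- The zeroth order multiplier belonging to `ballWeight`. -/
noncomputable def ballAux (N : ℕ) (κ a : ℝ) : SepData univ univ univ where
  k₀ _ := -(κ / 2)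
  k₀' _ := 0
  k₀'' _ := 0
  k₁ _ := 0
  k₁' _ := 0
  k₁'' _ := 0
  k₂ _ := a
  k₂' _ := 0
  k₂'' _ := 0
  g _ := 0
  g' _ := 0
  g'' _ := 0
  h s := (4 * N - 8 + (-16) * s) * rexp (-2 * s)
  h' s := (-8 * N + 32 * s) * rexp (-2 * s)
  h'' s := (16 * N + 32 + (-64) * s) * rexp (-2 * s)
  hk₀ t _ := hasDerivAt_const t _
  hk₀' t _ := hasDerivAt_const t _
  hk₁ t _ := hasDerivAt_const t _
  hk₁' t _ := hasDerivAt_const t _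
  hk₂ t _ := hasDerivAt_const t _
  hk₂' t _ := hasDerivAt_const t _
  hg t _ := hasDerivAt_const t _
  hg' t _ := hasDerivAt_const t _
  hh s _ := (hasDerivAt_lin_mul_exp _ _ s).congr_deriv (by ring)
  hh' s _ := (hasDerivAt_lin_mul_exp _ _ s).congr_deriv (by ring)

variable {n : ℕ} [NeZero n] {K t₀ a κ : ℝ}

theorem sepDomain_univ : sepDomain n univ univ univ = univ := by
  simp [sepDomain]

theorem contDiff_ballWeight (K t₀ a : ℝ) :
    ContDiff ℝ ∞ ((ballWeight K t₀ a).fn : EuclideanSpace ℝ (Fin n) × ℝ → ℝ) := by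
  rw [← contDiffOn_univ, ← sepDomain_univ]
  refine contDiffOn_sep ?_ ?_ ?_ ?_ ?_ <;>
  · simp only [ballWeight]; fun_prop

theorem contDiff_ballAux (N : ℕ) (κ a : ℝ) :
    ContDiff ℝ ∞ ((ballAux N κ a).fn : EuclideanSpace ℝ (Fin n) × ℝ → ℝ) := by
  rw [← contDiffOn_univ, ← sepDomain_univ]
  refine contDiffOn_sep ?_ ?_ ?_ ?_ ?_ <;>
  · simp only [ballAux]; fun_prop

variable (p : EuclideanSpace ℝ (Fin n) × ℝ)

theorem mem_sepDomain_univ : p ∈ sepDomain n univ univ univ :=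
  (sepDomain_univ (n := n)).symm ▸ mem_univ p

theorem ballWeight_fn :
    (ballWeight K t₀ a).fn p = a * (rexp (-2 * nsq p) - K * (p.2 - t₀) ^ 2) := by
  simp only [SepData.fn, ballWeight, sep]; ring

theorem ballAux_add_lapl : (ballAux n κ a).fn p + lapl ex (ballWeight K t₀ a).fn p =
    -8 * a * rexp (-2 * nsq p) - κ / 2 := by
  rw [SepData.lapl_fn isOpen_univ isOpen_univ isOpen_univ (mem_sepDomain_univ p)]
  simp only [SepData.fn, SepData.rad, ballWeight, ballAux, sep]
  ring

theorem gdot_ballWeight : gdot ex (ballWeight K t₀ a).fn (ballWeight K t₀ a).fn p =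
    16 * a ^ 2 * rexp (-2 * nsq p) ^ 2 * nsq p := by
  rw [SepData.gdot_fn (mem_sepDomain_univ p)]
  simp only [SepData.rad, SepData.axial, ballWeight]
  ring

theorem ballWeight_hess (ha : 0 ≤ a) (ξ : Fin n → ℝ) : κ * ∑ i, ξ i ^ 2 ≤
    4 * hess ex (ballWeight K t₀ a).fn p ξ -
      2 * ((ballAux n κ a).fn p + lapl ex (ballWeight K t₀ a).fn p) * ∑ i, ξ i ^ 2 := by
  rw [ballAux_add_lapl, SepData.hess_fn isOpen_univ isOpen_univ isOpen_univ (mem_sepDomain_univ p)]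
  simp only [SepData.rad, ballWeight]
  have : 0 ≤ a * rexp (-2 * nsq p) * (∑ i, p.1 i * ξ i) ^ 2 := by positivity
  linarith

theorem ballWeight_zeroTerm : zeroTerm ex et (ballWeight K t₀ a).fn (ballAux n κ a).fn p =
    1024 * a ^ 3 * rexp (-2 * nsq p) ^ 3 * nsq p ^ 2 - 512 * a ^ 3 * rexp (-2 * nsq p) ^ 3 * nsq p
      - 16 * κ * a ^ 2 * rexp (-2 * nsq p) ^ 2 * nsq p
      - (16 * a * rexp (-2 * nsq p) + κ) * (a * (2 * K * (p.2 - t₀))) - 2 * a * K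
      + a * (rexp (-2 * nsq p) * (2 * n * (-8 * n + 32 * nsq p)
        + 4 * (16 * n + 32 - 64 * nsq p) * nsq p)) := by
  rw [SepData.zeroTerm_fn isOpen_univ isOpen_univ isOpen_univ (mem_sepDomain_univ p),
    ballAux_add_lapl, gdot_ballWeight,
    SepData.lapl_fn isOpen_univ isOpen_univ isOpen_univ (mem_sepDomain_univ p)]
  simp only [SepData.rad, SepData.axial, ballWeight, ballAux, sep]
  ring

theorem ball_numeric {κ₀ s G g d D C : ℝ} (ha : 1 ≤ a) (hκ : 0 ≤ κ) (hκ₀ : 0 ≤ κ₀) (hK : 0 ≤ K)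
    (hs : 1 ≤ s) (hs5 : s ≤ 5) (hg : 0 < g) (hgG : g ≤ G) (hG : G ≤ 1) (hd : d ≤ K + 2)
    (hD : |D| ≤ C)
    (hC : κ₀ + (8 + κ / 2) ^ 2 + 160 * κ + (16 + κ) * (K + 2) + 2 * K + C ≤ 512 * a * g ^ 3) :
    κ₀ + (-8 * a * G - κ / 2) ^ 2 + κ * (16 * a ^ 2 * G ^ 2 * s) ≤
      1024 * a ^ 3 * G ^ 3 * s ^ 2 - 512 * a ^ 3 * G ^ 3 * s - 16 * κ * a ^ 2 * G ^ 2 * s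
      - (16 * a * G + κ) * (a * d) - 2 * a * K + a * D := by
  have hG0 : 0 < G := hg.trans_le hgG
  have ha2 : 1 ≤ a ^ 2 := one_le_pow₀ ha
  have haa : a ≤ a ^ 2 := by nlinarith
  have b1 : κ₀ ≤ a ^ 2 * κ₀ := le_mul_of_one_le_left hκ₀ ha2
  have b2 : (-8 * a * G - κ / 2) ^ 2 ≤ a ^ 2 * (8 + κ / 2) ^ 2 := by
    have e : (-8 * a * G - κ / 2) ^ 2 = (8 * a * G + κ / 2) ^ 2 := by ring
    rw [e, ← mul_pow]
    refine pow_le_pow_left₀ (by positivity) ?_ 2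
    have := mul_le_mul_of_nonneg_left hG (by positivity : 0 ≤ 8 * a)
    have := mul_le_mul_of_nonneg_right ha (by positivity : 0 ≤ κ / 2)
    linarith
  have b3 : G ^ 2 * s ≤ 5 := by
    have : G ^ 2 ≤ 1 := pow_le_one₀ hG0.le hG
    nlinarith
  have b4 : κ * a ^ 2 * (G ^ 2 * s) ≤ κ * a ^ 2 * 5 := mul_le_mul_of_nonneg_left b3 (by positivity)
  have b5 : (16 * a * G + κ) * (a * d) ≤ a ^ 2 * ((16 + κ) * (K + 2)) := by
    have e1 : (16 * a * G + κ) * (a * d) ≤ (16 * a * G + κ) * (a * (K + 2)) := by gcongr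
    have e2 : 16 * a * G + κ ≤ a * (16 + κ) := by
      have := mul_le_mul_of_nonneg_left hG (by positivity : 0 ≤ 16 * a)
      have := mul_le_mul_of_nonneg_right ha hκ
      linarith
    have e3 := mul_le_mul_of_nonneg_right e2 (by positivity : 0 ≤ a * (K + 2))
    linarith
  have b6 : 2 * a * K ≤ a ^ 2 * (2 * K) := by
    have := mul_le_mul_of_nonneg_right haa (by positivity : 0 ≤ 2 * K)
    linarith
  have hC0 : 0 ≤ C := (abs_nonneg D).trans hD
  have b7 : -(a * D) ≤ a ^ 2 * C := by
    have e1 : a * (-D) ≤ a * C := mul_le_mul_of_nonneg_left (by linarith [neg_abs_le D]) (by linarith)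
    have e2 := mul_le_mul_of_nonneg_right haa hC0
    linarith
  have b8 : a ^ 2 * (512 * a * g ^ 3) ≤
      1024 * a ^ 3 * G ^ 3 * s ^ 2 - 512 * a ^ 3 * G ^ 3 * s := by
    have e1 : g ^ 3 ≤ G ^ 3 := pow_le_pow_left₀ hg.le hgG 3
    have e2 : a ^ 3 * g ^ 3 ≤ a ^ 3 * G ^ 3 := mul_le_mul_of_nonneg_left e1 (by positivity)
    have e3 : 1 ≤ 2 * s ^ 2 - s := by nlinarith
    have e4 := mul_le_mul_of_nonneg_left e3 (by positivity : 0 ≤ a ^ 3 * G ^ 3)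
    linarith
  have b9 := mul_le_mul_of_nonneg_left hC (by positivity : 0 ≤ a ^ 2)
  linarith

theorem ball_lower_order (n : ℕ) {s G : ℝ} (hs : 1 ≤ s) (hs5 : s ≤ 5) (hG0 : 0 ≤ G) (hG : G ≤ 1) :
    |G * (2 * n * (-8 * n + 32 * s) + 4 * (16 * n + 32 - 64 * s) * s)| ≤
      16 * n ^ 2 + 640 * n + 7040 := by
  have hn : (0 : ℝ) ≤ n := n.cast_nonneg
  have h1 : |2 * n * (-8 * n + 32 * s) + 4 * (16 * n + 32 - 64 * s) * s| ≤
      16 * (n : ℝ) ^ 2 + 640 * n + 7040 := by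
    have a1 : n * s ≤ n * 5 := mul_le_mul_of_nonneg_left hs5 hn
    have a2 : 0 ≤ n * s := by positivity
    have a3 : s ^ 2 ≤ 5 ^ 2 := pow_le_pow_left₀ (by linarith) hs5 2
    have a4 := sq_nonneg (n : ℝ)
    rw [abs_le]; constructor
    · linarith
    · nlinarith
  rw [abs_mul, abs_of_nonneg hG0]
  exact (mul_le_of_le_one_left (abs_nonneg _) hG).trans h1

end Lateral

section Lateral

variable {n : ℕ} {K t₀ a κ : ℝ}

/-- The cutoff used with `ballWeight`. -/
noncomputable def ballCut (K t₀ : ℝ) (p : EuclideanSpace ℝ (Fin n) × ℝ) : ℝ :=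
  smoothTransition (5 - nsq p) * smoothTransition (2 - K * (p.2 - t₀) ^ 2)

theorem contDiff_ballCut (K t₀ : ℝ) :
    ContDiff ℝ ∞ (ballCut K t₀ : EuclideanSpace ℝ (Fin n) × ℝ → ℝ) :=
  (contDiff_step.comp (by fun_prop)).mul (contDiff_step.comp (by fun_prop))

theorem ballCut_eq_zero {p : EuclideanSpace ℝ (Fin n) × ℝ}
    (h : 5 ≤ nsq p ∨ 2 ≤ K * (p.2 - t₀) ^ 2) : ballCut K t₀ p = 0 := by
  rcases h with h | h
  · rw [ballCut, smoothTransition.zero_of_nonpos (by linarith), zero_mul]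
  · rw [ballCut, smoothTransition.zero_of_nonpos (x := 2 - _) (by linarith), mul_zero]

theorem ballCut_eq_one {p : EuclideanSpace ℝ (Fin n) × ℝ}
    (h1 : nsq p ≤ 4) (h2 : K * (p.2 - t₀) ^ 2 ≤ 1) : ballCut K t₀ p = 1 := by
  rw [ballCut, smoothTransition.one_of_one_le (by linarith),
    smoothTransition.one_of_one_le (by linarith), one_mul]

theorem tsupport_ballCut_subset (K t₀ : ℝ) : tsupport (ballCut (n := n) K t₀) ⊆
    {p | nsq p ≤ 5 ∧ K * (p.2 - t₀) ^ 2 ≤ 2} := by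
  refine closure_minimal (fun p hp => ?_) ?_
  · by_contra h
    refine hp (ballCut_eq_zero ?_)
    by_contra! h'
    exact h ⟨h'.1.le, h'.2.le⟩
  · exact (isClosed_le contDiff_nsq.continuous continuous_const).inter
      (isClosed_le (f := fun p : EuclideanSpace ℝ (Fin n) × ℝ => K * (p.2 - t₀) ^ 2) (by fun_prop)
        continuous_const)

variable [NeZero n]

/-- Carleman estimate with `ballWeight`. -/
theorem ball_carleman {U : EuclideanSpace ℝ (Fin n) × ℝ → ℝ} (ha : 1 ≤ a) (hκ : 0 ≤ κ) (hK : 0 ≤ K)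
    (hC : κ + (8 + κ / 2) ^ 2 + 160 * κ + (16 + κ) * (K + 2) + 2 * K
      + (16 * n ^ 2 + 640 * n + 7040) ≤ 512 * a * rexp (-10) ^ 3)
    (hU : ContDiff ℝ ∞ U) (hUc : HasCompactSupport U)
    (hUs : ∀ p ∈ tsupport U, 1 ≤ nsq p ∧ nsq p ≤ 5 ∧ K * (p.2 - t₀) ^ 2 ≤ 2) :
    Integrable (fun p => rexp (2 * (ballWeight K t₀ a).fn p) *
      (κ / 2 * gdot ex U U p + κ * U p ^ 2 - (dir et U p + lapl ex U p) ^ 2)) ∧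
    ∫ p, rexp (2 * (ballWeight K t₀ a).fn p) *
      (κ / 2 * gdot ex U U p + κ * U p ^ 2 - (dir et U p + lapl ex U p) ^ 2) ≤ 0 := by
  have hφ := contDiff_ballWeight (n := n) K t₀ a
  have c7 := (ContDiff.gdot (e := ex) hU hU).continuous
  have c8 := ((hU.dir et).add (ContDiff.lapl (e := ex) hU)).continuous
  constructor
  · refine integrable_of_continuousOn isOpen_univ (Continuous.continuousOn ?_) hUc (subset_univ _)
      fun p hp => ?_
    · exact (Real.continuous_exp.comp (continuous_const.mul hφ.continuous)).mul
        (((continuous_const.mul c7).add (continuous_const.mul (hU.continuous.pow 2))).sub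
          (c8.pow 2))
    · rw [gdot_eq_zero_of_notMem hp, dir_eq_zero_of_notMem hp, lapl_eq_zero_of_notMem hp,
        image_eq_zero_of_notMem_tsupport hp]
      ring
  · have hd : ∀ w p : EuclideanSpace ℝ (Fin n) × ℝ, dir w (fun _ => (1 : ℝ)) p = 0 :=
      fun w p => dir_const w 1 p
    have := carleman (κ := κ) (κ₀ := κ) (e := ex) (τ := et)
      (ζ := fun _ : EuclideanSpace ℝ (Fin n) × ℝ => (1 : ℝ)) (q := (ballAux n κ a).fn) volume
      isOpen_univ contDiff_const (fun i p => hd _ p) (fun _ => zero_le_one)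
      (fun p => (hd _ p).ge) hU hUc (subset_univ _) hφ.contDiffOn
      (contDiff_ballAux n κ a).contDiffOn hκ
      (fun p _ _ ξ => ballWeight_hess p (by linarith) ξ) fun p hp _ => ?_
    · simpa only [hd, zero_mul, sub_zero, one_mul] using this
    · obtain ⟨h1, h2, h3⟩ := hUs p hp
      have hG1 : rexp (-2 * nsq p) ≤ 1 := Real.exp_le_one_iff.2 (by linarith)
      rw [ballWeight_zeroTerm, ballAux_add_lapl, gdot_ballWeight]
      refine ball_numeric ha hκ hκ hK h1 h2 (Real.exp_pos (-10))
        (Real.exp_le_exp.2 (by linarith)) hG1 ?_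
        (ball_lower_order n h1 h2 (Real.exp_pos _).le hG1) hC
      have := mul_nonneg hK (sq_nonneg (p.2 - t₀ - 1))
      linarith

theorem half_sq_le_of_heat_le' {L g v c : ℝ} (hg : 0 ≤ g) (hL : |L| ≤ c * (√g + |v|)) :
    1 / 2 * v ^ 2 ≤ (4 * c ^ 2 + 1) / 2 * g + (4 * c ^ 2 + 1) * v ^ 2 - L ^ 2 := by
  have h1 : L ^ 2 ≤ (c * (√g + |v|)) ^ 2 := by
    rw [← sq_abs L]; exact pow_le_pow_left₀ (abs_nonneg _) hL 2
  have h2 : (√g + |v|) ^ 2 ≤ 2 * (g + v ^ 2) := by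
    have := sq_nonneg (√g - |v|)
    have := Real.sq_sqrt hg
    have := sq_abs v
    linarith
  have h3 := mul_le_mul_of_nonneg_left h2 (sq_nonneg c)
  have h4 := mul_nonneg (sq_nonneg c) (sq_nonneg v)
  have h5 := sq_nonneg v
  rw [mul_pow] at h1
  linarith

end Lateral

section Lateral

variable {n : ℕ} [NeZero n] {K t₀ a κ : ℝ}

/-- Pointwise lower bound of the Carleman integrand of `ball_carleman`. -/
theorem ball_carleman_lower {u U : EuclideanSpace ℝ (Fin n) × ℝ → ℝ} {c : ℝ}
    {Ω : Set (EuclideanSpace ℝ (Fin n) × ℝ)} (hK : 0 ≤ K) (ha : 0 ≤ a)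
    (hΩs : ∀ p : EuclideanSpace ℝ (Fin n) × ℝ, nsq p ≤ 5 → K * (p.2 - t₀) ^ 2 ≤ 2 → p ∈ Ω)
    (hL : ∀ p ∈ Ω, |dir et u p + lapl ex u p| ≤ c * (√(gdot ex u u p) + |u p|))
    (hU : U = fun p => ballCut K t₀ p * u p)
    (hUs : ∀ p ∈ tsupport U, 1 ≤ nsq p ∧ nsq p ≤ 5 ∧ K * (p.2 - t₀) ^ 2 ≤ 2)
    (p : EuclideanSpace ℝ (Fin n) × ℝ) :
    (nsq p < 4 → K * (p.2 - t₀) ^ 2 < 1 →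
      rexp (2 * (ballWeight K t₀ a).fn p) * (1 / 2 * u p ^ 2) ≤
      rexp (2 * (ballWeight K t₀ a).fn p) * ((4 * c ^ 2 + 1) / 2 * gdot ex U U p
        + (4 * c ^ 2 + 1) * U p ^ 2 - (dir et U p + lapl ex U p) ^ 2)) ∧
    -(rexp (2 * (a * rexp (-8))) * (dir et U p + lapl ex U p) ^ 2) ≤
      rexp (2 * (ballWeight K t₀ a).fn p) * ((4 * c ^ 2 + 1) / 2 * gdot ex U U p
        + (4 * c ^ 2 + 1) * U p ^ 2 - (dir et U p + lapl ex U p) ^ 2) := by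
  have hgood : nsq p < 4 → K * (p.2 - t₀) ^ 2 < 1 →
      rexp (2 * (ballWeight K t₀ a).fn p) * (1 / 2 * u p ^ 2) ≤
      rexp (2 * (ballWeight K t₀ a).fn p) * ((4 * c ^ 2 + 1) / 2 * gdot ex U U p
        + (4 * c ^ 2 + 1) * U p ^ 2 - (dir et U p + lapl ex U p) ^ 2) := by
    intro h1 h2
    have hw : Continuous fun p : EuclideanSpace ℝ (Fin n) × ℝ => K * (p.2 - t₀) ^ 2 := by fun_prop
    have hUu : U =ᶠ[𝓝 p] u := by
      filter_upwards [contDiff_nsq.continuous.continuousAt.eventually (Iio_mem_nhds h1),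
        hw.continuousAt.eventually (Iio_mem_nhds h2)] with q q1 q2
      rw [hU]; beta_reduce
      rw [ballCut_eq_one (le_of_lt q1) (le_of_lt q2), one_mul]
    rw [gdot_congr hUu hUu, hUu.eq_of_nhds, (dir_congr hUu et).eq_of_nhds, lapl_congr hUu]
    exact mul_le_mul_of_nonneg_left (half_sq_le_of_heat_le' gdot_self_nonneg
      (hL p (hΩs p (by linarith) (by linarith)))) (Real.exp_pos _).le
  refine ⟨hgood, ?_⟩
  have hneg : -(rexp (2 * (a * rexp (-8))) * (dir et U p + lapl ex U p) ^ 2) ≤ 0 :=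
    neg_nonpos.2 (by positivity)
  by_cases hg : nsq p < 4 ∧ K * (p.2 - t₀) ^ 2 < 1
  · exact hneg.trans ((by positivity : 0 ≤ rexp (2 * (ballWeight K t₀ a).fn p) *
      (1 / 2 * u p ^ 2)).trans (hgood hg.1 hg.2))
  by_cases hp : p ∈ tsupport U
  · obtain ⟨h1, h2, h3⟩ := hUs p hp
    have hψ : rexp (-2 * nsq p) - K * (p.2 - t₀) ^ 2 ≤ rexp (-8) := by
      rcases lt_or_ge (nsq p) 4 with h4 | h4
      · have h5 : 1 ≤ K * (p.2 - t₀) ^ 2 := le_of_not_gt fun h => hg ⟨h4, h⟩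
        have h6 : rexp (-2 * nsq p) ≤ 1 := Real.exp_le_one_iff.2 (by linarith)
        linarith [Real.exp_pos (-8)]
      · have h6 : rexp (-2 * nsq p) ≤ rexp (-8) := Real.exp_le_exp.2 (by linarith)
        linarith [mul_nonneg hK (sq_nonneg (p.2 - t₀))]
    have hE : rexp (2 * (ballWeight K t₀ a).fn p) ≤ rexp (2 * (a * rexp (-8))) := by
      rw [ballWeight_fn]
      exact Real.exp_le_exp.2 (by linarith [mul_le_mul_of_nonneg_left hψ ha])
    have h1 := mul_le_mul_of_nonneg_right hE (sq_nonneg (dir et U p + lapl ex U p))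
    have h2 : 0 ≤ rexp (2 * (ballWeight K t₀ a).fn p) * ((4 * c ^ 2 + 1) / 2 * gdot ex U U p
        + (4 * c ^ 2 + 1) * U p ^ 2) := by
      have := gdot_self_nonneg (e := ex) (f := U) (p := p)
      positivity
    linarith
  · rw [gdot_eq_zero_of_notMem hp, dir_eq_zero_of_notMem hp, lapl_eq_zero_of_notMem hp,
      image_eq_zero_of_notMem_tsupport hp]
    simp

/-- Unique continuation across a sphere. -/
theorem vanishing_across_sphere {u : EuclideanSpace ℝ (Fin n) × ℝ → ℝ} {c τ : ℝ}
    {Ω : Set (EuclideanSpace ℝ (Fin n) × ℝ)} (hτ : 0 < τ) (hΩ : IsOpen Ω)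
    (hΩs : ∀ p : EuclideanSpace ℝ (Fin n) × ℝ, nsq p < 9 → |p.2 - t₀| < τ → p ∈ Ω)
    (hu : ContDiffOn ℝ ∞ u Ω)
    (hL : ∀ p ∈ Ω, |dir et u p + lapl ex u p| ≤ c * (√(gdot ex u u p) + |u p|))
    (h0 : ∀ p : EuclideanSpace ℝ (Fin n) × ℝ, nsq p < 1 → |p.2 - t₀| < τ → u p = 0)
    {p₀ : EuclideanSpace ℝ (Fin n) × ℝ} (hp4 : nsq p₀ < 4) (hpt : p₀.2 = t₀) : u p₀ = 0 := by
  obtain ⟨K, hK⟩ : ∃ K, K = 4 / τ ^ 2 := ⟨_, rfl⟩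
  have hK0 : 0 < K := by rw [hK]; positivity
  have hKτ : ∀ t, K * (t - t₀) ^ 2 ≤ 2 → |t - t₀| < τ := fun t ht => by
    refine abs_lt_of_sq_lt_sq ?_ hτ.le
    rw [hK, div_mul_eq_mul_div, div_le_iff₀ (by positivity)] at ht
    have := sq_pos_of_pos hτ
    linarith
  have hΩK : ∀ p : EuclideanSpace ℝ (Fin n) × ℝ, nsq p ≤ 5 → K * (p.2 - t₀) ^ 2 ≤ 2 → p ∈ Ω :=
    fun p h1 h2 => hΩs p (by linarith) (hKτ _ h2)
  obtain ⟨U, hU⟩ : ∃ U : EuclideanSpace ℝ (Fin n) × ℝ → ℝ, U = fun p => ballCut K t₀ p * u p :=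
    ⟨_, rfl⟩
  have hUs : ContDiff ℝ ∞ U := hU ▸ contDiff_mul_of_tsupport hΩ (contDiff_ballCut _ _) hu fun p hp =>
    hΩK p (tsupport_ballCut_subset _ _ hp).1 (tsupport_ballCut_subset _ _ hp).2
  have hsub : ∀ p ∈ tsupport U, 1 ≤ nsq p ∧ nsq p ≤ 5 ∧ K * (p.2 - t₀) ^ 2 ≤ 2 := by
    intro p hp
    have h1 := tsupport_ballCut_subset K t₀ (tsupport_mul_subset_left (hU ▸ hp))
    refine ⟨?_, h1⟩
    by_contra! h2
    have ht : Continuous fun p : EuclideanSpace ℝ (Fin n) × ℝ => |p.2 - t₀| := by fun_prop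
    refine notMem_tsupport_iff_eventuallyEq.2 ?_ hp
    filter_upwards [contDiff_nsq.continuous.continuousAt.eventually (Iio_mem_nhds h2),
      ht.continuousAt.eventually (Iio_mem_nhds (hKτ _ h1.2))] with q q1 q2
    rw [hU]; beta_reduce
    rw [h0 q q1 q2, mul_zero]; rfl
  have hUc : HasCompactSupport U :=
    (isCompact_slab 5 (t₀ - τ) (t₀ + τ)).of_isClosed_subset (isClosed_tsupport U) fun p hp => by
      obtain ⟨h1, h2, h3⟩ := hsub p hp
      have := abs_lt.1 (hKτ _ h3)
      exact ⟨h2, by linarith, by linarith⟩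
  by_contra hne
  -- the weight at `p₀` exceeds its values on the set where the cutoff is not locally constant
  obtain ⟨β, hβ1, hβ2⟩ := exists_between (show rexp (-8) < rexp (-2 * nsq p₀) - K * (p₀.2 - t₀) ^ 2 by
    rw [hpt, sub_self]; simpa using Real.exp_lt_exp.2 (by linarith : -8 < -2 * nsq p₀))
  have hw : Continuous fun p : EuclideanSpace ℝ (Fin n) × ℝ => K * (p.2 - t₀) ^ 2 := by fun_prop
  have hnsq := contDiff_nsq (n := n).continuous
  have hψ : Continuous fun p : EuclideanSpace ℝ (Fin n) × ℝ =>
      rexp (-2 * nsq p) - K * (p.2 - t₀) ^ 2 :=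
    (Real.continuous_exp.comp (continuous_const.mul hnsq)).sub hw
  have hp0 : p₀ ∈ Ω := hΩs p₀ (by linarith) (by rw [hpt]; simpa using hτ)
  have hw1 : K * (p₀.2 - t₀) ^ 2 < 1 := by rw [hpt]; simp
  have hu0 : 0 < u p₀ ^ 2 := by positivity
  have huc : ContinuousAt (fun p => u p ^ 2) p₀ :=
    ((hu.continuousOn.continuousAt (hΩ.mem_nhds hp0)).pow 2)
  obtain ⟨r, hr, hball⟩ := Metric.eventually_nhds_iff_ball.1 <|
    ((hψ.continuousAt.eventually (Ioi_mem_nhds hβ2)).and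
      (huc.eventually (Ioi_mem_nhds (half_lt_self hu0)))).and
      ((hnsq.continuousAt.eventually (Iio_mem_nhds hp4)).and
        (hw.continuousAt.eventually (Iio_mem_nhds hw1)))
  obtain ⟨I₀, hI₀⟩ : ∃ I₀, I₀ = ∫ p, (dir et U p + lapl ex U p) ^ 2 := ⟨_, rfl⟩
  have hJi : Integrable fun p => (dir et U p + lapl ex U p) ^ 2 :=
    integrable_of_continuousOn isOpen_univ ((((hUs.dir et).add
      (ContDiff.lapl (e := ex) hUs)).continuous.pow 2).continuousOn) hUc (subset_univ _)
      fun p hp => by rw [dir_eq_zero_of_notMem hp, lapl_eq_zero_of_notMem hp]; ring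
  have hvol : 0 < volume.real (Metric.ball p₀ r) := ENNReal.toReal_pos
    (Metric.measure_ball_pos _ _ hr).ne' measure_ball_lt_top.ne
  have key : ∀ᶠ a : ℝ in atTop, rexp (2 * (a * β)) * (1 / 2 * (u p₀ ^ 2 / 2)) *
      volume.real (Metric.ball p₀ r) ≤ rexp (2 * (a * rexp (-8))) * I₀ := by
    have hev : ∀ᶠ a : ℝ in atTop, (4 * c ^ 2 + 1) + (8 + (4 * c ^ 2 + 1) / 2) ^ 2
        + 160 * (4 * c ^ 2 + 1) + (16 + (4 * c ^ 2 + 1)) * (K + 2) + 2 * K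
        + (16 * n ^ 2 + 640 * n + 7040) ≤ 512 * a * rexp (-10) ^ 3 :=
      ((tendsto_id.const_mul_atTop (by norm_num : (0 : ℝ) < 512)).atTop_mul_const
        (by positivity)).eventually_ge_atTop _
    filter_upwards [hev, eventually_ge_atTop 1] with a hC ha
    obtain ⟨hFi, hF⟩ := ball_carleman (t₀ := t₀) ha (by positivity) hK0.le hC hUs hUc hsub
    have hlow := ball_carleman_lower (a := a) hK0.le (by linarith) hΩK hL hU hsub
    obtain ⟨F, hFd⟩ : ∃ F : EuclideanSpace ℝ (Fin n) × ℝ → ℝ, F = fun p =>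
      rexp (2 * (ballWeight K t₀ a).fn p) * ((4 * c ^ 2 + 1) / 2 * gdot ex U U p
        + (4 * c ^ 2 + 1) * U p ^ 2 - (dir et U p + lapl ex U p) ^ 2) := ⟨_, rfl⟩
    have hFd' := fun p => (congrFun hFd p).symm
    simp only [hFd'] at hlow
    rw [← hFd] at hFi hF
    have hJi' := hJi.const_mul (rexp (2 * (a * rexp (-8))))
    have hsum : ∫ p, (F p + rexp (2 * (a * rexp (-8))) * (dir et U p + lapl ex U p) ^ 2) =
        (∫ p, F p) + rexp (2 * (a * rexp (-8))) * I₀ := by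
      rw [integral_add hFi hJi', integral_const_mul, hI₀]
    have h1 : rexp (2 * (a * β)) * (1 / 2 * (u p₀ ^ 2 / 2)) * volume.real (Metric.ball p₀ r) ≤
        ∫ p in Metric.ball p₀ r,
          (F p + rexp (2 * (a * rexp (-8))) * (dir et U p + lapl ex U p) ^ 2) := by
      refine setIntegral_ge_of_const_le_real measurableSet_ball measure_ball_lt_top.ne
        (fun p hp => ?_) (hFi.add hJi').integrableOn
      obtain ⟨⟨b1, b2⟩, b3, b4⟩ := hball p hp
      have b1 : β < rexp (-2 * nsq p) - K * (p.2 - t₀) ^ 2 := b1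
      have b2 : u p₀ ^ 2 / 2 < u p ^ 2 := b2
      have e1 : rexp (2 * (a * β)) ≤ rexp (2 * (ballWeight K t₀ a).fn p) := by
        rw [ballWeight_fn]
        exact Real.exp_le_exp.2 (by linarith [mul_le_mul_of_nonneg_left b1.le (by linarith : 0 ≤ a)])
      have e2 : rexp (2 * (a * β)) * (1 / 2 * (u p₀ ^ 2 / 2)) ≤
          rexp (2 * (ballWeight K t₀ a).fn p) * (1 / 2 * u p ^ 2) := by gcongr
      exact e2.trans (((hlow p).1 b3 b4).trans (le_add_of_nonneg_right (by positivity)))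
    have h2 := setIntegral_le_integral (s := Metric.ball p₀ r) (hFi.add hJi')
      (ae_of_all _ fun p => by
        have := (hlow p).2
        simp only [Pi.zero_apply, Pi.add_apply]; linarith)
    simp only [Pi.add_apply] at h2
    linarith
  have hlim : Tendsto (fun a : ℝ => rexp (2 * (a * (β - rexp (-8)))) *
      ((1 / 2 * (u p₀ ^ 2 / 2)) * volume.real (Metric.ball p₀ r))) atTop atTop :=
    (Real.tendsto_exp_atTop.comp ((tendsto_id.atTop_mul_const
      (sub_pos.2 hβ1)).const_mul_atTop two_pos)).atTop_mul_const (by positivity)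
  obtain ⟨a, h1, h2⟩ := (key.and (hlim.eventually_gt_atTop I₀)).exists
  have h3 : rexp (2 * (a * β)) = rexp (2 * (a * (β - rexp (-8)))) * rexp (2 * (a * rexp (-8))) := by
    rw [← Real.exp_add]; congr 1; ring
  rw [h3] at h1
  have h4 := mul_lt_mul_of_pos_left h2 (Real.exp_pos (2 * (a * rexp (-8))))
  linarith

end Lateral

section Rescale

variable {n : ℕ}

/-- Parabolic rescaling, mapping the origin at time `1` to the point `y` at time `T`. -/
noncomputable def rescale (r : ℝ) (y : EuclideanSpace ℝ (Fin n)) (T : ℝ)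
    (p : EuclideanSpace ℝ (Fin n) × ℝ) : EuclideanSpace ℝ (Fin n) × ℝ :=
  (r • p.1 + y, T + r ^ 2 * (p.2 - 1))

variable {r T c : ℝ} {y : EuclideanSpace ℝ (Fin n)} {u : EuclideanSpace ℝ (Fin n) × ℝ → ℝ}
  {Ω : Set (EuclideanSpace ℝ (Fin n) × ℝ)} {p : EuclideanSpace ℝ (Fin n) × ℝ}

theorem contDiff_rescale (r T : ℝ) (y : EuclideanSpace ℝ (Fin n)) :
    ContDiff ℝ ∞ (rescale r y T) := by
  unfold rescale; fun_prop

theorem hasFDerivAt_rescale (r T : ℝ) (y : EuclideanSpace ℝ (Fin n))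
    (p : EuclideanSpace ℝ (Fin n) × ℝ) :
    HasFDerivAt (rescale r y T) ((r • ContinuousLinearMap.fst ℝ _ ℝ).prod
      (r ^ 2 • ContinuousLinearMap.snd ℝ (EuclideanSpace ℝ (Fin n)) ℝ)) p := by
  refine HasFDerivAt.prodMk ?_ ?_
  · exact (hasFDerivAt_fst.const_smul r).add_const y
  · exact ((hasFDerivAt_snd.sub_const 1).const_mul (r ^ 2)).const_add T

theorem dir_comp_rescale (hu : DifferentiableAt ℝ u (rescale r y T p))
    (w : EuclideanSpace ℝ (Fin n) × ℝ) :
    dir w (fun p => u (rescale r y T p)) p = dir (r • w.1, r ^ 2 * w.2) u (rescale r y T p) := by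
  have h := hu.hasFDerivAt.comp p (hasFDerivAt_rescale r T y p)
  have h' : fderiv ℝ (fun p => u (rescale r y T p)) p = _ := h.fderiv
  rw [dir, dir, h']
  rfl

theorem dir_ex_comp_rescale (hu : DifferentiableAt ℝ u (rescale r y T p)) (i : Fin n) :
    dir (ex i) (fun p => u (rescale r y T p)) p = r * dir (ex i) u (rescale r y T p) := by
  have h : (r • (ex i).1, r ^ 2 * (ex i).2) = r • ex i := by simp [ex]
  rw [dir_comp_rescale hu, h, dir, map_smul]; rfl

theorem dir_et_comp_rescale (hu : DifferentiableAt ℝ u (rescale r y T p)) :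
    dir et (fun p => u (rescale r y T p)) p = r ^ 2 * dir et u (rescale r y T p) := by
  have h : (r • (et (n := n)).1, r ^ 2 * (et (n := n)).2) = r ^ 2 • et := by simp [et]
  rw [dir_comp_rescale hu, h, dir, map_smul]; rfl

theorem lapl_comp_rescale (hΩ : IsOpen Ω) (hu : ContDiffOn ℝ ∞ u Ω) (hp : rescale r y T p ∈ Ω) :
    lapl ex (fun p => u (rescale r y T p)) p = r ^ 2 * lapl ex u (rescale r y T p) := by
  simp only [lapl, Finset.mul_sum]
  refine Finset.sum_congr rfl fun i _ => ?_
  have hd : ∀ q ∈ Ω, DifferentiableAt ℝ u q := fun q hq =>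
    (hu.contDiffAt (hΩ.mem_nhds hq)).differentiableAt (by simp)
  have h1 : dir (ex i) (fun p => u (rescale r y T p)) =ᶠ[𝓝 p]
      fun p => r * dir (ex i) u (rescale r y T p) := by
    filter_upwards [(hΩ.preimage (contDiff_rescale r T y).continuous).mem_nhds hp] with q hq
    exact dir_ex_comp_rescale (hd _ hq) i
  have h2 : DifferentiableAt ℝ (dir (ex i) u) (rescale r y T p) :=
    ((hu.contDiffAt (hΩ.mem_nhds hp)).dir (ex i)).differentiableAt (by simp)
  rw [(dir_congr h1 (ex i)).eq_of_nhds]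
  have h3 := dir_const_mul (ex i) r (fun p => dir (ex i) u (rescale r y T p))
  rw [h3]
  beta_reduce
  rw [dir_ex_comp_rescale h2]
  ring

theorem gdot_comp_rescale (hu : DifferentiableAt ℝ u (rescale r y T p)) :
    gdot ex (fun p => u (rescale r y T p)) (fun p => u (rescale r y T p)) p =
      r ^ 2 * gdot ex u u (rescale r y T p) := by
  simp only [gdot, Finset.mul_sum, dir_ex_comp_rescale hu]
  exact Finset.sum_congr rfl fun i _ => by ring

theorem heat_comp_rescale_le (hr : 0 ≤ r) (hr1 : r ≤ 1) (hc : 0 ≤ c) (hΩ : IsOpen Ω)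
    (hu : ContDiffOn ℝ ∞ u Ω)
    (hL : ∀ p ∈ Ω, |dir et u p + lapl ex u p| ≤ c * (√(gdot ex u u p) + |u p|))
    (hp : rescale r y T p ∈ Ω) :
    |dir et (fun p => u (rescale r y T p)) p + lapl ex (fun p => u (rescale r y T p)) p| ≤
      r * c * (√(gdot ex (fun p => u (rescale r y T p)) (fun p => u (rescale r y T p)) p)
        + |u (rescale r y T p)|) := by
  have hd : DifferentiableAt ℝ u (rescale r y T p) :=
    (hu.contDiffAt (hΩ.mem_nhds hp)).differentiableAt (by simp)
  rw [dir_et_comp_rescale hd, lapl_comp_rescale hΩ hu hp, gdot_comp_rescale hd,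
    Real.sqrt_mul (sq_nonneg r), Real.sqrt_sq hr, ← mul_add, abs_mul, abs_of_nonneg (sq_nonneg r)]
  have h1 := mul_le_mul_of_nonneg_left (hL _ hp) (sq_nonneg r)
  have h2 : r ^ 2 * (c * |u (rescale r y T p)|) ≤ r * (c * |u (rescale r y T p)|) :=
    mul_le_mul_of_nonneg_right (by nlinarith) (by positivity)
  linarith

/-- Unique continuation across a sphere, for balls of arbitrary centre. -/
theorem vanishing_double_ball [NeZero n] {t₁ t₂ : ℝ} (hr : 0 < r) (hr1 : r ≤ 1) (hc : 0 ≤ c)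
    (hΩ : IsOpen Ω) (hu : ContDiffOn ℝ ∞ u Ω)
    (hL : ∀ p ∈ Ω, |dir et u p + lapl ex u p| ≤ c * (√(gdot ex u u p) + |u p|))
    (hΩs : ∀ x ∈ Metric.ball y (3 * r), ∀ t ∈ Ioo t₁ t₂, (x, t) ∈ Ω)
    (h0 : ∀ x ∈ Metric.ball y r, ∀ t ∈ Ioo t₁ t₂, u (x, t) = 0) :
    ∀ x ∈ Metric.ball y (2 * r), ∀ t ∈ Ioo t₁ t₂, u (x, t) = 0 := by
  intro x hx t ht
  obtain ⟨τ, hτ, hτ1, hτ2⟩ : ∃ τ, 0 < τ ∧ r ^ 2 * τ ≤ t - t₁ ∧ r ^ 2 * τ ≤ t₂ - t := by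
    have h1 := sub_pos.2 ht.1
    have h2 := sub_pos.2 ht.2
    have hr2 : 0 < r ^ 2 := by positivity
    refine ⟨min (t - t₁) (t₂ - t) / r ^ 2, by positivity, ?_, ?_⟩ <;>
      rw [mul_div_cancel₀ _ hr2.ne']
    · exact min_le_left _ _
    · exact min_le_right _ _
  have hball : ∀ (p : EuclideanSpace ℝ (Fin n) × ℝ) (k : ℝ), 0 ≤ k → nsq p < k ^ 2 →
      r • p.1 + y ∈ Metric.ball y (k * r) := by
    intro p k hk hp
    rw [mem_ball_iff_norm, add_sub_cancel_right, norm_smul, Real.norm_of_nonneg hr.le, mul_comm]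
    exact mul_lt_mul_of_pos_right (lt_of_pow_lt_pow_left₀ 2 hk hp) hr
  have htime : ∀ s : ℝ, |s - 1| < τ → t + r ^ 2 * (s - 1) ∈ Ioo t₁ t₂ := by
    intro s hs
    have hr2 : 0 < r ^ 2 := by positivity
    obtain ⟨h1, h2⟩ := abs_lt.1 hs
    have h3 := mul_lt_mul_of_pos_left h1 hr2
    have h4 := mul_lt_mul_of_pos_left h2 hr2
    constructor <;> linarith
  have hx' : rescale r y t (r⁻¹ • (x - y), 1) = (x, t) := by
    simp [rescale, smul_smul, hr.ne']
  rw [← hx']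
  refine vanishing_across_sphere (t₀ := 1) (u := fun p => u (rescale r y t p)) (c := r * c) hτ
    (hΩ.preimage (contDiff_rescale r t y).continuous) (fun p h1 h2 => ?_)
    (hu.comp (contDiff_rescale r t y).contDiffOn fun p hp => hp)
    (fun p hp => heat_comp_rescale_le hr.le hr1 hc hΩ hu hL hp) (fun p h1 h2 => ?_) ?_ rfl
  · exact hΩs _ (hball p 3 (by norm_num) (by linarith)) _ (htime _ h2)
  · have := hball p 1 zero_le_one (by linarith)
    rw [one_mul] at this
    exact h0 _ this _ (htime _ h2)
  · rw [mem_ball_iff_norm] at hx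
    have h1 : nsq (r⁻¹ • (x - y), (1 : ℝ)) = (r⁻¹ * ‖x - y‖) ^ 2 := by
      simp [nsq, norm_smul, abs_of_pos hr]
    have h2 : r⁻¹ * ‖x - y‖ < 2 := by
      rw [inv_mul_lt_iff₀ hr]; linarith
    have h3 := pow_lt_pow_left₀ h2 (by positivity) two_ne_zero
    rw [h1]
    linarith

end Rescale

section ConeGeometry

theorem exists_cone_exponents {b : ℝ} (h0 : 0 < b) (h : 3 * b < 1) :
    ∃ α m : ℝ, 1 / 2 ≤ α ∧ α < 1 ∧ 0 < m ∧ 3 * m < 1 ∧ 2 * m ≤ (2 * α - 1) * (1 - m) ∧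
      b ^ α ≤ m := by
  obtain ⟨m, hbm, hm3⟩ := exists_between (show b < 1 / 3 by linarith)
  have h1 : Tendsto (fun α : ℝ => b ^ α) (𝓝[<] 1) (𝓝 (b ^ (1 : ℝ))) :=
    ((Real.continuous_const_rpow h0.ne').tendsto 1).mono_left nhdsWithin_le_nhds
  have h2 : Tendsto (fun α : ℝ => (2 * α - 1) * (1 - m)) (𝓝[<] 1) (𝓝 ((2 * 1 - 1) * (1 - m))) :=
    (Continuous.tendsto (by fun_prop) 1).mono_left nhdsWithin_le_nhds
  rw [Real.rpow_one] at h1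
  have h3 : ∀ᶠ α : ℝ in 𝓝[<] 1, 1 / 2 < α :=
    (eventually_gt_nhds (by norm_num)).filter_mono nhdsWithin_le_nhds
  obtain ⟨α, ⟨a1, a2⟩, a3, a4⟩ := (((h1.eventually (eventually_lt_nhds hbm)).and
    (h2.eventually (eventually_gt_nhds (b := 2 * m) (by linarith)))).and
      (h3.and self_mem_nhdsWithin)).exists
  exact ⟨α, m, a3.le, a4, h0.trans hbm, by linarith, a2.le, a1.le⟩

variable {n : ℕ} [NeZero n] {α m c₀ : ℝ}

theorem mem_cone_of_gauge {p : EuclideanSpace ℝ (Fin n) × ℝ} (hα : 0 < α)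
    (hm : (c₀ ^ 2) ^ α ≤ m) (h0 : 0 < p.1 0) (h : 0 < gauge' α m p) : ‖p.1‖ * c₀ < p.1 0 := by
  have h1 : ((‖p.1‖ * c₀) ^ 2) ^ α < (p.1 0 ^ 2) ^ α := by
    have e1 : (p.1 0 ^ 2) ^ α = p.1 0 ^ (2 * α) := by
      rw [← Real.rpow_natCast, ← Real.rpow_mul h0.le]; norm_num
    have e2 : ((‖p.1‖ * c₀) ^ 2) ^ α = (c₀ ^ 2) ^ α * nsq p ^ α := by
      rw [mul_pow, mul_comm, Real.mul_rpow (sq_nonneg _) (sq_nonneg _), nsq]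
    have e3 := mul_le_mul_of_nonneg_right hm (Real.rpow_nonneg (nsq_nonneg p) α)
    rw [gauge'] at h
    rw [e1, e2]
    linarith
  exact lt_of_pow_lt_pow_left₀ 2 h0.le ((Real.rpow_lt_rpow_iff (by positivity) (by positivity) hα).1 h1)

theorem half_sub_le_gauge {p : EuclideanSpace ℝ (Fin n) × ℝ} {j b : ℝ} (hα : 1 / 2 ≤ α) (hα1 : α ≤ 1)
    (hm : 0 ≤ m) (hm3 : 3 * m ≤ 1) (hb : 0 ≤ b) (hj : 11 * b + 1 ≤ j) (h1 : j - b ≤ p.1 0)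
    (h2 : ‖p.1‖ ≤ j + b) : 1 / 2 * (j - b) ≤ gauge' α m p := by
  have hpos : 1 ≤ j - b := by linarith
  have h3 : (j - b) ^ (2 * α) ≤ p.1 0 ^ (2 * α) :=
    Real.rpow_le_rpow (by linarith) h1 (by linarith)
  have h4 : nsq p ^ α ≤ (6 / 5 * (j - b)) ^ (2 * α) := by
    have e : nsq p ^ α = ‖p.1‖ ^ (2 * α) := by
      rw [nsq, ← Real.rpow_natCast, ← Real.rpow_mul (norm_nonneg _)]; norm_num
    rw [e]
    exact Real.rpow_le_rpow (norm_nonneg _) (by linarith) (by linarith)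
  have h5 : (6 / 5 * (j - b)) ^ (2 * α) ≤ 3 / 2 * (j - b) ^ (2 * α) := by
    rw [Real.mul_rpow (by norm_num) (by linarith)]
    refine mul_le_mul_of_nonneg_right ?_ (by positivity)
    calc (6 / 5 : ℝ) ^ (2 * α) ≤ (6 / 5) ^ (2 : ℝ) :=
          Real.rpow_le_rpow_of_exponent_le (by norm_num) (by linarith)
      _ ≤ 3 / 2 := by norm_num
  have h6 : j - b ≤ (j - b) ^ (2 * α) := by
    simpa using Real.rpow_le_rpow_of_exponent_le hpos (by linarith : 1 ≤ 2 * α)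
  have h7 := mul_le_mul_of_nonneg_left (h4.trans h5) hm
  have h8 := mul_le_mul_of_nonneg_right hm3 ((by linarith : 0 ≤ j - b).trans h6)
  rw [gauge']
  linarith

theorem add_mem_cone {x : EuclideanSpace ℝ (Fin n)} (hc₀ : 0 ≤ c₀) (hc₁ : c₀ ≤ 1)
    (hx : ‖x‖ * c₀ < x 0) {j : ℝ} (hj : 0 ≤ j) :
    ‖x + EuclideanSpace.single 0 j‖ * c₀ <
      (x + EuclideanSpace.single 0 j : EuclideanSpace ℝ (Fin n)) 0 := by
  have h1 : ‖x + EuclideanSpace.single 0 j‖ ≤ ‖x‖ + j := by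
    refine (norm_add_le _ _).trans_eq ?_
    rw [PiLp.norm_single, Real.norm_of_nonneg hj]
  have h2 := mul_le_mul_of_nonneg_right h1 hc₀
  have h3 := mul_le_mul_of_nonneg_left hc₁ hj
  simp
  linarith

theorem isOpen_setOf_cone (c₀ : ℝ) : IsOpen {x : EuclideanSpace ℝ (Fin n) | ‖x‖ * c₀ < x 0} :=
  isOpen_lt (by fun_prop) (by fun_prop)

/-- Vanishing far out in the cone, just after a time at which the solution vanishes. -/
theorem exists_vanishing_far_after {c M T : ℝ} {u : EuclideanSpace ℝ (Fin n) × ℝ → ℝ}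
    (hα : 1 / 2 ≤ α) (hα1 : α < 1) (hm : 0 < m) (hm3 : 3 * m < 1)
    (hαm : 2 * m ≤ (2 * α - 1) * (1 - m)) (hcm : (c₀ ^ 2) ^ α ≤ m) (hc : 0 ≤ c)
    (hu : ContDiffOn ℝ ∞ u ({x | ‖x‖ * c₀ < x 0} ×ˢ Ioo 0 1))
    (hM : ∀ p ∈ {x : EuclideanSpace ℝ (Fin n) | ‖x‖ * c₀ < x 0} ×ˢ Ioo (0 : ℝ) 1, |u p| ≤ M)
    (hL : ∀ p ∈ {x : EuclideanSpace ℝ (Fin n) | ‖x‖ * c₀ < x 0} ×ˢ Ioo (0 : ℝ) 1,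
      |dir et u p + lapl ex u p| ≤ c * (√(gdot ex u u p) + |u p|))
    (hT : 0 ≤ T) (hT1 : T < 1)
    (h0 : ∀ x : EuclideanSpace ℝ (Fin n), ‖x‖ * c₀ < x 0 →
      Tendsto (fun t => u (x, t)) (𝓝[>] T) (𝓝 0)) :
    ∃ r > 0, ∃ f₁, ∀ (x : EuclideanSpace ℝ (Fin n)) (t s : ℝ), 0 < x 0 →
      f₁ < gauge' α m (r⁻¹ • x, s) → t ∈ Ioo T (T + r ^ 2 / 2) → u (x, t) = 0 := by
  obtain ⟨r, hr, hr1, hrc, hrT⟩ : ∃ r : ℝ, 0 < r ∧ r ≤ 1 ∧ r * c ≤ 1 / 8 ∧ r ^ 2 * 4 ≤ 1 - T := by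
    have h1 : Tendsto (fun r : ℝ => r * c) (𝓝[>] 0) (𝓝 (0 * c)) :=
      (Continuous.tendsto (by fun_prop) 0).mono_left nhdsWithin_le_nhds
    have h2 : Tendsto (fun r : ℝ => r ^ 2 * 4) (𝓝[>] 0) (𝓝 (0 ^ 2 * 4)) :=
      (Continuous.tendsto (by fun_prop) 0).mono_left nhdsWithin_le_nhds
    have h3 : ∀ᶠ r : ℝ in 𝓝[>] 0, r < 1 :=
      (eventually_lt_nhds one_pos).filter_mono nhdsWithin_le_nhds
    obtain ⟨r, ⟨a1, a2⟩, a3, a4⟩ := (((h1.eventually (eventually_lt_nhds (b := 1 / 8)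
      (by norm_num))).and (h2.eventually (eventually_lt_nhds (b := 1 - T) (by linarith)))).and
        (h3.and self_mem_nhdsWithin)).exists
    exact ⟨r, a4, a3.le, a1.le, a2.le⟩
  have hr2 : 0 < r ^ 2 := by positivity
  have hΩ : IsOpen ({x : EuclideanSpace ℝ (Fin n) | ‖x‖ * c₀ < x 0} ×ˢ Ioo (0 : ℝ) 1) :=
    (isOpen_setOf_cone c₀).prod isOpen_Ioo
  have hscale : ∀ x : EuclideanSpace ℝ (Fin n), ‖x‖ * c₀ < x 0 →
      ‖r • x + 0‖ * c₀ < (r • x + 0) 0 := fun x hx => by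
    have := mul_lt_mul_of_pos_left hx hr
    rw [add_zero, norm_smul, Real.norm_of_nonneg hr.le, PiLp.smul_apply, smul_eq_mul]
    linarith
  obtain ⟨f₁, hf₁⟩ := exists_vanishing_far (u := fun p => u (rescale r 0 T p)) (c := r * c) (M := M)
    hα hα1 hm hm3 hαm (by positivity) hrc (hΩ.preimage (contDiff_rescale r T 0).continuous)
    (fun p h1 h2 h3 h4 => ⟨hscale _ (mem_cone_of_gauge (by linarith) hcm h1 (by linarith)),
      show 0 < T + r ^ 2 * (p.2 - 1) ∧ T + r ^ 2 * (p.2 - 1) < 1 by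
        have e1 := mul_lt_mul_of_pos_left (show p.2 - 1 < 4 by linarith) hr2
        have e2 := mul_pos hr2 (show 0 < p.2 - 1 by linarith)
        constructor <;> linarith⟩)
    (hu.comp (contDiff_rescale r T 0).contDiffOn fun p hp => hp) (fun p hp => hM _ hp)
    (fun p hp => heat_comp_rescale_le hr.le hr1 hc hΩ hu hL hp) (fun x h1 h2 => by
      have hx : ‖x‖ * c₀ < x 0 :=
        mem_cone_of_gauge (p := (x, (0 : ℝ))) (by linarith) hcm h1 (by linarith)
      refine (h0 _ (hscale _ hx)).comp (tendsto_nhdsWithin_iff.2 ⟨?_, ?_⟩)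
      · refine ((Continuous.tendsto' (by fun_prop) _ _ ?_).mono_left nhdsWithin_le_nhds)
        ring
      · filter_upwards [self_mem_nhdsWithin] with t ht
        have := mul_pos hr2 (sub_pos.2 (show (1 : ℝ) < t from ht))
        exact show T < T + r ^ 2 * (t - 1) by linarith)
  refine ⟨r, hr, f₁, fun x t s hx hg ht => ?_⟩
  have hxt : rescale r 0 T (r⁻¹ • x, 1 + (t - T) / r ^ 2) = (x, t) := by
    simp only [rescale, smul_smul, mul_inv_cancel₀ hr.ne', one_smul, add_zero, add_sub_cancel_left]
    rw [mul_div_cancel₀ _ hr2.ne']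
    simp
  have h1 : 0 < (t - T) / r ^ 2 := div_pos (sub_pos.2 ht.1) hr2
  have h2 : (t - T) / r ^ 2 < 1 / 2 := by rw [div_lt_iff₀ hr2]; linarith [ht.2]
  have := hf₁ (r⁻¹ • x, 1 + (t - T) / r ^ 2) (by
    show 0 < (r⁻¹ • x) 0
    rw [PiLp.smul_apply, smul_eq_mul]; positivity) hg (by linarith) (by linarith)
  rwa [hxt] at this

end ConeGeometry

section ConeGlobal

variable {n : ℕ} [NeZero n] {c₀ c M : ℝ} {u : EuclideanSpace ℝ (Fin n) × ℝ → ℝ}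

theorem exists_vanishing_after {T : ℝ} (hc₀ : 0 < c₀) (hc₀3 : 3 * c₀ ^ 2 < 1) (hc : 0 ≤ c)
    (hu : ContDiffOn ℝ ∞ u ({x | ‖x‖ * c₀ < x 0} ×ˢ Ioo 0 1))
    (hM : ∀ p ∈ {x : EuclideanSpace ℝ (Fin n) | ‖x‖ * c₀ < x 0} ×ˢ Ioo (0 : ℝ) 1, |u p| ≤ M)
    (hL : ∀ p ∈ {x : EuclideanSpace ℝ (Fin n) | ‖x‖ * c₀ < x 0} ×ˢ Ioo (0 : ℝ) 1,
      |dir et u p + lapl ex u p| ≤ c * (√(gdot ex u u p) + |u p|))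
    (hT : 0 ≤ T) (hT1 : T < 1)
    (h0 : ∀ x : EuclideanSpace ℝ (Fin n), ‖x‖ * c₀ < x 0 →
      Tendsto (fun t => u (x, t)) (𝓝[>] T) (𝓝 0)) :
    ∃ δ > 0, T + δ ≤ 1 ∧ ∀ x : EuclideanSpace ℝ (Fin n), ‖x‖ * c₀ < x 0 →
      ∀ t ∈ Ioo T (T + δ), u (x, t) = 0 := by
  have hc₁ : c₀ ≤ 1 := by nlinarith
  obtain ⟨α, m, hα, hα1, hm, hm3, hαm, hcm⟩ :=
    exists_cone_exponents (by positivity : 0 < c₀ ^ 2) hc₀3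
  obtain ⟨r, hr, f₁, hfar⟩ :=
    exists_vanishing_far_after hα hα1 hm hm3 hαm hcm hc hu hM hL hT hT1 h0
  refine ⟨min (r ^ 2 / 2) (1 - T), by have := sub_pos.2 hT1; positivity,
    by linarith [min_le_right (r ^ 2 / 2) (1 - T)], fun x hx => ?_⟩
  obtain ⟨δ, hδ⟩ : ∃ δ, δ = min (r ^ 2 / 2) (1 - T) := ⟨_, rfl⟩
  rw [← hδ]
  have hδ1 : δ ≤ r ^ 2 / 2 := hδ ▸ min_le_left _ _
  have hδ2 : T + δ ≤ 1 := by linarith [hδ ▸ min_le_right (r ^ 2 / 2) (1 - T)]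
  obtain ⟨d, hd, hball⟩ := Metric.isOpen_iff.1 (isOpen_setOf_cone c₀) x hx
  obtain ⟨l, hl⟩ : ∃ l, l = min 1 (d / 3) := ⟨_, rfl⟩
  have hl0 : 0 < l := by rw [hl]; positivity
  have hl1 : l ≤ 1 := hl ▸ min_le_left _ _
  have hld : 3 * l ≤ d := by linarith [hl ▸ min_le_right 1 (d / 3)]
  -- points translated along the axis
  obtain ⟨y, hy⟩ : ∃ y : ℕ → EuclideanSpace ℝ (Fin n),
      y = fun j : ℕ => x + EuclideanSpace.single 0 ((j : ℝ) * l) := ⟨_, rfl⟩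
  have hycone : ∀ j, ∀ z ∈ Metric.ball (y j) (3 * l), ‖z‖ * c₀ < z 0 := by
    intro j z hz
    have h1 : z - EuclideanSpace.single 0 (j * l) ∈ Metric.ball x d := by
      rw [hy, mem_ball_iff_norm] at hz
      rw [mem_ball_iff_norm]
      have e : z - EuclideanSpace.single 0 (j * l) - x =
        z - (x + EuclideanSpace.single 0 (j * l)) := by abel
      rw [e]; linarith
    have h2 := add_mem_cone hc₀.le hc₁ (hball h1) (by positivity : 0 ≤ j * l)
    simpa only [sub_add_cancel] using h2
  obtain ⟨N, hN⟩ : ∃ N : ℕ, ∀ z ∈ Metric.ball (y N) l, ∀ t ∈ Ioo T (T + δ), u (z, t) = 0 := by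
    obtain ⟨b, hb⟩ : ∃ b, b = r⁻¹ * (‖x‖ + 1) := ⟨_, rfl⟩
    have hb0 : 0 ≤ b := by rw [hb]; positivity
    obtain ⟨N, hN⟩ := exists_nat_ge (max (11 * b + 1) (2 * f₁ + 1 + b) / (r⁻¹ * l))
    rw [div_le_iff₀ (by positivity)] at hN
    have hN1 := (le_max_left _ _).trans hN
    have hN2 := (le_max_right _ _).trans hN
    refine ⟨N, fun z hz t ht => ?_⟩
    rw [hy, mem_ball_iff_norm] at hz
    have hz' : ‖z - EuclideanSpace.single 0 (N * l)‖ ≤ ‖x‖ + 1 := by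
      have e : z - EuclideanSpace.single 0 (N * l) =
        x + (z - (x + EuclideanSpace.single 0 (N * l))) := by abel
      rw [e]
      exact (norm_add_le _ _).trans (by linarith)
    have hz0 : N * l - (‖x‖ + 1) ≤ z 0 := by
      have h1 := (PiLp.norm_apply_le (z - EuclideanSpace.single 0 (N * l)) 0).trans hz'
      have h2 := (abs_le.1 h1).1
      simp at h2
      linarith
    have hzn : ‖z‖ ≤ N * l + (‖x‖ + 1) := by
      have h1 := norm_add_le (z - EuclideanSpace.single 0 (N * l)) (EuclideanSpace.single 0 (N * l))
      rw [sub_add_cancel, PiLp.norm_single, Real.norm_of_nonneg (by positivity)] at h1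
      linarith
    have hri : 0 < r⁻¹ := by positivity
    have h1 := mul_le_mul_of_nonneg_left hz0 hri.le
    have h2 := mul_le_mul_of_nonneg_left hzn hri.le
    have h3 : 1 / 2 * (N * (r⁻¹ * l) - b) ≤ gauge' α m (r⁻¹ • z, (0 : ℝ)) :=
      half_sub_le_gauge hα hα1.le hm.le hm3.le hb0 hN1
        (by show _ ≤ (r⁻¹ • z) 0
            rw [PiLp.smul_apply, smul_eq_mul, hb]; linarith)
        (by show ‖r⁻¹ • z‖ ≤ _
            rw [norm_smul, Real.norm_of_nonneg hri.le, hb]; linarith)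
    refine hfar z t 0 ?_ (by linarith) ⟨ht.1, by linarith [ht.2]⟩
    have h4 : 0 < r⁻¹ * z 0 := by
      rw [hb] at hN1; linarith
    exact pos_of_mul_pos_right h4 hri.le
  have hstep : ∀ j, (∀ z ∈ Metric.ball (y (j + 1)) l, ∀ t ∈ Ioo T (T + δ), u (z, t) = 0) →
      ∀ z ∈ Metric.ball (y j) l, ∀ t ∈ Ioo T (T + δ), u (z, t) = 0 := by
    intro j hj z hz
    refine vanishing_double_ball hl0 hl1 hc ((isOpen_setOf_cone c₀).prod isOpen_Ioo) hu hL
      (fun z hz t ht => ⟨hycone _ z hz, by linarith [ht.1], by linarith [ht.2]⟩) hj z ?_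
    rw [Metric.mem_ball] at hz ⊢
    have h1 : dist (y j) (y (j + 1)) = l := by
      have e : x + EuclideanSpace.single 0 ((j : ℝ) * l) -
          (x + EuclideanSpace.single 0 (((j : ℝ) + 1) * l)) =
          -(EuclideanSpace.single 0 l : EuclideanSpace ℝ (Fin n)) := by
        have e' : (EuclideanSpace.single 0 (((j : ℝ) + 1) * l) : EuclideanSpace ℝ (Fin n)) =
            EuclideanSpace.single 0 ((j : ℝ) * l) + EuclideanSpace.single 0 l := by
          ext i; by_cases hi : i = 0 <;> simp [hi]; ring
        rw [e']; abel
      rw [hy, dist_eq_norm]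
      push_cast
      rw [e, norm_neg, PiLp.norm_single, Real.norm_of_nonneg hl0.le]
    linarith [dist_triangle z (y j) (y (j + 1))]
  have hdesc : ∀ k ≤ N, ∀ z ∈ Metric.ball (y (N - k)) l, ∀ t ∈ Ioo T (T + δ), u (z, t) = 0 := by
    intro k
    induction k with
    | zero => exact fun _ => hN
    | succ k ih =>
      intro hk
      refine hstep _ ?_
      rw [show N - (k + 1) + 1 = N - k by omega]
      exact ih (by omega)
  have := hdesc N le_rfl x
  rw [Nat.sub_self, hy] at this
  refine this ?_
  simpa using hl0

/-- A solution in the cone which vanishes initially vanishes at all times. -/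
theorem vanishing_of_initial (hc₀ : 0 < c₀) (hc₀3 : 3 * c₀ ^ 2 < 1) (hc : 0 ≤ c)
    (hu : ContDiffOn ℝ ∞ u ({x | ‖x‖ * c₀ < x 0} ×ˢ Ioo 0 1))
    (hM : ∀ p ∈ {x : EuclideanSpace ℝ (Fin n) | ‖x‖ * c₀ < x 0} ×ˢ Ioo (0 : ℝ) 1, |u p| ≤ M)
    (hL : ∀ p ∈ {x : EuclideanSpace ℝ (Fin n) | ‖x‖ * c₀ < x 0} ×ˢ Ioo (0 : ℝ) 1,
      |dir et u p + lapl ex u p| ≤ c * (√(gdot ex u u p) + |u p|))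
    (h0 : ∀ x : EuclideanSpace ℝ (Fin n), ‖x‖ * c₀ < x 0 →
      Tendsto (fun t => u (x, t)) (𝓝[>] 0) (𝓝 0)) {x : EuclideanSpace ℝ (Fin n)}
    (hx : ‖x‖ * c₀ < x 0) {t : ℝ} (ht : t ∈ Ioo (0 : ℝ) 1) : u (x, t) = 0 := by
  obtain ⟨s, hs⟩ : ∃ s : Set ℝ, s = {T | ∀ x : EuclideanSpace ℝ (Fin n), ‖x‖ * c₀ < x 0 →
    ∀ t, 0 < t → t < T → u (x, t) = 0} := ⟨_, rfl⟩
  have hclosed : IsClosed s := by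
    have e : s = ⋂ (x : EuclideanSpace ℝ (Fin n)) (_ : ‖x‖ * c₀ < x 0) (t : ℝ) (_ : 0 < t)
        (_ : u (x, t) ≠ 0), Iic t := by
      ext T
      simp only [hs, mem_ofPred_eq, mem_iInter, mem_Iic]
      refine forall₄_congr fun x _ t _ => ⟨fun h h' => ?_, fun h h' => ?_⟩
      · exact not_lt.1 fun h'' => h' (h h'')
      · by_contra h''
        exact absurd (h h'') (not_le.2 h')
    rw [e]
    exact isClosed_iInter fun _ => isClosed_iInter fun _ => isClosed_iInter fun _ =>
      isClosed_iInter fun _ => isClosed_iInter fun _ => isClosed_Iic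
  have hsub : Icc (0 : ℝ) 1 ⊆ s := by
    refine (hclosed.inter isClosed_Icc).Icc_subset_of_forall_exists_gt
      (by rw [hs]; exact fun x _ t h1 h2 => absurd h1 (not_lt.2 h2.le)) ?_
    rintro T ⟨hTs, hT0, hT1⟩ T' hT'
    rw [hs] at hTs
    have hT : ∀ x : EuclideanSpace ℝ (Fin n), ‖x‖ * c₀ < x 0 → 0 < T → u (x, T) = 0 ∧
        ContinuousAt (fun t => u (x, t)) T := by
      intro x hx hTp
      have hmem : ((x, T) : EuclideanSpace ℝ (Fin n) × ℝ) ∈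
        ({x : EuclideanSpace ℝ (Fin n) | ‖x‖ * c₀ < x 0} ×ˢ Ioo (0 : ℝ) 1) := ⟨hx, hTp, hT1⟩
      have hcont : ContinuousAt (fun t => u (x, t)) T :=
        ContinuousAt.comp (f := fun t : ℝ => (x, t)) (hu.continuousOn.continuousAt
          (((isOpen_setOf_cone c₀).prod isOpen_Ioo).mem_nhds hmem)) (by fun_prop)
      refine ⟨?_, hcont⟩
      refine tendsto_nhds_unique (hcont.tendsto.mono_left nhdsWithin_le_nhds : Tendsto _ (𝓝[<] T) _)
        (tendsto_const_nhds.congr' ?_)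
      filter_upwards [Ioo_mem_nhdsLT hTp] with t ht
      exact (hTs x hx t ht.1 ht.2).symm
    obtain ⟨δ, hδ, hδ1, hv⟩ := exists_vanishing_after hc₀ hc₀3 hc hu hM hL hT0 hT1 fun x hx => by
      rcases hT0.eq_or_lt with h | h
      · rw [← h]; exact h0 x hx
      · obtain ⟨e1, e2⟩ := hT x hx h
        have := e2.tendsto.mono_left (nhdsWithin_le_nhds (s := Ioi T))
        rwa [e1] at this
    refine ⟨min T' (T + δ), ?_, lt_min hT' (by linarith), min_le_left _ _⟩
    rw [hs]
    intro x hx t ht0 ht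
    rcases lt_trichotomy t T with h | h | h
    · exact hTs x hx t ht0 h
    · rw [h]; exact (hT x hx (h ▸ ht0)).1
    · exact hv x hx t ⟨h, ht.trans_le (min_le_right _ _)⟩
  have h1 := hsub (right_mem_Icc.2 zero_le_one)
  rw [hs] at h1
  exact h1 x hx t ht.1 ht.2

end ConeGlobal

section Slices

variable {n : ℕ} {w : EuclideanSpace ℝ (Fin n) × ℝ → ℝ} {x : EuclideanSpace ℝ (Fin n)} {t : ℝ}

theorem fderiv_slice_single (hw : DifferentiableAt ℝ w (x, t)) (i : Fin n) :
    fderiv ℝ (fun y => w (y, t)) x (EuclideanSpace.single i 1) = dir (ex i) w (x, t) := by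
  have h : HasFDerivAt (fun y : EuclideanSpace ℝ (Fin n) => (y, t))
      (ContinuousLinearMap.inl ℝ _ ℝ) x := hasFDerivAt_prodMk_left x t
  have := (hw.hasFDerivAt (x := (x, t))).comp x h
  rw [show (fun y => w (y, t)) = w ∘ fun y => (y, t) from rfl, this.fderiv]
  rfl

theorem deriv_slice (hw : DifferentiableAt ℝ w (x, t)) :
    deriv (fun s => w (x, s)) t = dir et w (x, t) := by
  have h : HasFDerivAt (fun s : ℝ => (x, s)) (ContinuousLinearMap.inr ℝ _ ℝ) t :=
    hasFDerivAt_prodMk_right x t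
  have := (hw.hasFDerivAt (x := (x, t))).comp t h
  rw [show (fun s => w (x, s)) = w ∘ fun s => (x, s) from rfl, ← fderiv_apply_one_eq_deriv,
    this.fderiv]
  rfl

theorem lap_slice (hw : ContDiffAt ℝ ∞ w (x, t)) :
    lap (fun y => w (y, t)) x = lapl ex w (x, t) := by
  have h1 : ContDiffAt ℝ 1 w (x, t) := hw.of_le (by norm_cast)
  refine Finset.sum_congr rfl fun i _ => ?_
  have h : (fun y => fderiv ℝ (fun z => w (z, t)) y (EuclideanSpace.single i 1)) =ᶠ[𝓝 x]
      fun y => dir (ex i) w (y, t) := by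
    have hc : Tendsto (fun y : EuclideanSpace ℝ (Fin n) => (y, t)) (𝓝 x) (𝓝 (x, t)) :=
      (Continuous.prodMk_left t).tendsto x
    filter_upwards [hc.eventually (h1.eventually (by simp))] with y hy
    exact fderiv_slice_single (hy.differentiableAt (by simp)) i
  rw [h.fderiv_eq]
  exact fderiv_slice_single ((hw.dir _).differentiableAt (by simp)) i

theorem norm_gradient_slice (hw : DifferentiableAt ℝ w (x, t)) :
    ‖gradient (fun y => w (y, t)) x‖ = √(gdot ex w w (x, t)) := by
  rw [EuclideanSpace.norm_eq, gdot]
  congr 1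
  refine Finset.sum_congr rfl fun i _ => ?_
  have : gradient (fun y => w (y, t)) x i = dir (ex i) w (x, t) := by
    rw [← fderiv_slice_single hw, ← InnerProductSpace.toDual_symm_apply,
      EuclideanSpace.inner_single_right]
    simp [gradient]
  rw [this, norm_eq_abs, sq_abs, sq]

end Slices

theorem cos_half_pos_and_sq_lt {θ : ℝ} (h1 : 2 * arccos (1 / √3) < θ) (h2 : θ < π) :
    0 < cos (θ / 2) ∧ 3 * cos (θ / 2) ^ 2 < 1 := by
  have h0 := arccos_nonneg (1 / √3)
  have hs : (1 : ℝ) ≤ √3 := one_le_sqrt.2 (by norm_num)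
  have hp : 0 < cos (θ / 2) := cos_pos_of_mem_Ioo ⟨by linarith [pi_pos], by linarith⟩
  have hlt : cos (θ / 2) < cos (arccos (1 / √3)) :=
    cos_lt_cos_of_nonneg_of_le_pi h0 (by linarith [pi_pos]) (by linarith)
  rw [cos_arccos (by linarith [show 0 ≤ 1 / √3 by positivity])
    (div_le_one_of_le₀ hs (by positivity))] at hlt
  refine ⟨hp, ?_⟩
  have := pow_lt_pow_left₀ hlt hp.le two_ne_zero
  rw [div_pow, sq_sqrt (by norm_num)] at this
  linarith

end

/-- A bounded solution of the backward parabolic inequality in a cone of opening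
`θ ∈ (2 arccos (1/√3), π)` which vanishes at time `0` vanishes identically on
`𝒪_θ × (0, γ₁)` for some `γ₁ > 0` depending only on `c₁`. -/
theorem vanishing_in_cone (c₁ : ℝ) (hc₁ : 0 ≤ c₁) :
    ∃ γ₁ : ℝ, 0 < γ₁ ∧
      ∀ (n : ℕ) [NeZero n], 2 ≤ n →
        ∀ θ : ℝ, 2 * Real.arccos (1 / Real.sqrt 3) < θ → θ < π →
          ∀ M : ℝ, 0 < M →
            ∀ u : EuclideanSpace ℝ (Fin n) → ℝ → ℝ,
              ContDiffOn ℝ (⊤ : ℕ∞) (fun p : EuclideanSpace ℝ (Fin n) × ℝ => u p.1 p.2)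
                (cone n θ ×ˢ Set.Ioo 0 1) →
              (∀ x ∈ cone n θ, ∀ t ∈ Set.Ioo (0 : ℝ) 1,
                |deriv (u x) t + lap (fun y => u y t) x| ≤
                  c₁ * (‖gradient (fun y => u y t) x‖ + |u x t|)) →
              (∀ x ∈ cone n θ,
                Filter.Tendsto (u x) (nhdsWithin 0 (Set.Ioi 0)) (nhds 0)) →
              (∀ x ∈ cone n θ, ∀ t ∈ Set.Ioo (0 : ℝ) 1, |u x t| < M) →
              ∀ x ∈ cone n θ, ∀ t ∈ Set.Ioo 0 γ₁, u x t = 0 := by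
  refine ⟨1, one_pos, fun n _ _ θ h1 h2 M _ u hu hL h0 hM x hx t ht => ?_⟩
  obtain ⟨hc, hc3⟩ := cos_half_pos_and_sq_lt h1 h2
  refine vanishing_of_initial hc hc3 hc₁ hu (fun p hp => (hM p.1 hp.1 p.2 hp.2).le)
    (fun p hp => ?_) h0 hx ht
  have hw := hu.contDiffAt (((isOpen_setOf_cone _).prod isOpen_Ioo).mem_nhds hp)
  have hd := hw.differentiableAt (by simp)
  rw [← deriv_slice hd, ← lap_slice hw, ← norm_gradient_slice hd]
  exact hL p.1 hp.1 p.2 hp.2
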